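/- Fix n ≥ 1 and let Γ = BS(n,n) = ⟨a, b ∣ a bⁿ a^{-1} b^{-n}⟩ be the Baumslag–Solitar group, with ā, b̄ the images of the generators in Γ. Then Γ is weakly ucp stable conditional on vanishing of the winding number invariant associated to the relator: for every finite subset S ⊆ Γ and every ε > 0 there exist a finite subset T ⊆ Γ and δ > 0 such that for every m ≥ 1 and every ucp (T,δ)-representation φ : Γ → M_m(ℂ) satisfying (a) the matrices φ(ā) and φ(b̄ⁿ) are invertible (b̄ⁿ being the n-th power of b̄ in Γ), (b) the matrix c(φ) := φ(ā)φ(b̄ⁿ)φ(ā)^{-1}φ(b̄ⁿ)^{-1} satisfies ‖c(φ) − 1‖ < 1, and (c) there exists a continuous function h : [0,1] → ℂ with h(0) = h(1) and exp(h(t)) = det(t·1 + (1−t)·c(φ)) for all t ∈ [0,1] (i.e. the winding number of this loop of nonzero determinants is zero), there exist k ∈ ℕ, a unitary representation θ : Γ → M_k(ℂ), and a unitary representation π : Γ → M_{m+k}(ℂ) such that ‖(φ(s) ⊕ θ(s)) − π(s)‖ < ε for all s ∈ S. -/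

import Mathlib

open scoped Matrix.Norms.L2Operator ComplexOrder

noncomputable section

/-- The relator `a bⁿ a⁻¹ b⁻ⁿ` of the Baumslag–Solitar group `BS(n,n)` in the free group on
two generators (`0` is `a`, `1` is `b`). -/
def bsRelator (n : ℕ) : FreeGroup (Fin 2) :=
  FreeGroup.of 0 * (FreeGroup.of 1) ^ n * (FreeGroup.of 0)⁻¹ * ((FreeGroup.of 1) ^ n)⁻¹

/-- The Baumslag–Solitar group `BS(n,n) = ⟨a, b ∣ a bⁿ a⁻¹ b⁻ⁿ⟩`. -/
abbrev BSnn (n : ℕ) : Type := PresentedGroup ({bsRelator n} : Set (FreeGroup (Fin 2)))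

/-- The image `ā` of the generator `a` in `BS(n,n)`. -/
def aBar {n : ℕ} : BSnn n := PresentedGroup.of 0

/-- The image `b̄` of the generator `b` in `BS(n,n)`. -/
def bBar {n : ℕ} : BSnn n := PresentedGroup.of 1

/-- A `(T,δ)`-representation of `Γ` on `M_m(ℂ)` (operator norm): a unital map into the closed
unit ball that is `δ`-multiplicative on `T`. -/
def IsQuasiRep {Γ : Type*} [Group Γ] (T : Set Γ) (δ : ℝ) {m : ℕ}
    (φ : Γ → Matrix (Fin m) (Fin m) ℂ) : Prop :=
  φ 1 = 1 ∧ (∀ x, ‖φ x‖ ≤ 1) ∧ ∀ s ∈ T, ∀ t ∈ T, ‖φ s * φ t - φ (s * t)‖ < δ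

/-- A map `φ : Γ → M_m(ℂ)` is unital completely positive if all matrices
`∑_{g,h∈F} conj (z g) * z h • φ (g⁻¹ h)` are positive semidefinite. -/
def IsUcpQuasiRep {Γ : Type*} [Group Γ] {m : ℕ} (φ : Γ → Matrix (Fin m) (Fin m) ℂ) : Prop :=
  ∀ (F : Finset Γ) (z : Γ → ℂ),
    (∑ g ∈ F, ∑ h ∈ F, ((starRingEnd ℂ) (z g) * z h) • φ (g⁻¹ * h)).PosSemidef

/-- A unitary representation of `Γ` on `M_k(ℂ)`. -/
def IsUnitaryRep {Γ : Type*} [Group Γ] {k : ℕ} (θ : Γ → Matrix (Fin k) (Fin k) ℂ) : Prop :=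
  θ 1 = 1 ∧ (∀ x y, θ (x * y) = θ x * θ y) ∧
    ∀ x, θ x ∈ unitary (Matrix (Fin k) (Fin k) ℂ)

/-- Block sum of square matrices. -/
def blockSum {n k : ℕ} (x : Matrix (Fin n) (Fin n) ℂ) (y : Matrix (Fin k) (Fin k) ℂ) :
    Matrix (Fin (n + k)) (Fin (n + k)) ℂ :=
  Matrix.reindex finSumFinEquiv finSumFinEquiv (Matrix.fromBlocks x 0 0 y)

/-- The image `φ(ā)φ(b̄ⁿ)φ(ā)⁻¹φ(b̄ⁿ)⁻¹` of the relator under a quasi-representation `φ`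
(with matrix inverses). -/
def relImage {n m : ℕ} (φ : BSnn n → Matrix (Fin m) (Fin m) ℂ) :
    Matrix (Fin m) (Fin m) ℂ :=
  φ aBar * φ (bBar ^ n) * (φ aBar)⁻¹ * (φ (bBar ^ n))⁻¹

section Norms

variable {ι κ : Type*} [Fintype ι] [DecidableEq ι] [Fintype κ] [DecidableEq κ]

theorem norm_one_matrix_le : ‖(1 : Matrix ι ι ℂ)‖ ≤ 1 := by
  rw [← Matrix.diagonal_one, Matrix.l2_opNorm_diagonal]
  exact (pi_norm_le_iff_of_nonneg zero_le_one).2 fun i => by simp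

theorem norm_le_one_of_unitary {U : Matrix ι ι ℂ} (hU : U ∈ unitary (Matrix ι ι ℂ)) :
    ‖U‖ ≤ 1 := by
  have h : ‖U‖ * ‖U‖ ≤ 1 := by
    rw [← CStarRing.norm_star_mul_self, (Unitary.mem_iff.1 hU).1]
    exact norm_one_matrix_le
  nlinarith [norm_nonneg U]

theorem norm_unitary_mul {U : Matrix ι ι ℂ} (hU : U ∈ unitary (Matrix ι ι ℂ))
    (A : Matrix ι ι ℂ) : ‖U * A‖ = ‖A‖ :=
  CStarRing.norm_coe_unitary_mul ⟨U, hU⟩ A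

theorem norm_mul_unitary {U : Matrix ι ι ℂ} (hU : U ∈ unitary (Matrix ι ι ℂ))
    (A : Matrix ι ι ℂ) : ‖A * U‖ = ‖A‖ :=
  CStarRing.norm_mul_coe_unitary A ⟨U, hU⟩

theorem norm_mul_le_left_of_le_one {A B : Matrix ι ι ℂ} (hA : ‖A‖ ≤ 1) : ‖A * B‖ ≤ ‖B‖ :=
  (norm_mul_le _ _).trans (mul_le_of_le_one_left (norm_nonneg _) hA)

theorem norm_mul_le_right_of_le_one {A B : Matrix ι ι ℂ} (hB : ‖B‖ ≤ 1) : ‖A * B‖ ≤ ‖A‖ :=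
  (norm_mul_le _ _).trans (mul_le_of_le_one_right (norm_nonneg _) hB)

theorem norm_diagonal_le {d : ι → ℂ} {r : ℝ} (hr : 0 ≤ r) (h : ∀ i, ‖d i‖ ≤ r) :
    ‖Matrix.diagonal d‖ ≤ r := by
  rw [Matrix.l2_opNorm_diagonal]
  exact (pi_norm_le_iff_of_nonneg hr).2 h

theorem diagonal_mem_unitary {d : ι → ℂ} (h : ∀ i, ‖d i‖ = 1) :
    Matrix.diagonal d ∈ unitary (Matrix ι ι ℂ) := by
  have h' : ∀ i, (starRingEnd ℂ) (d i) * d i = 1 := fun i => by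
    rw [Complex.conj_mul', h]; simp
  rw [Unitary.mem_iff]
  constructor
  · rw [Matrix.star_eq_conjTranspose, Matrix.diagonal_conjTranspose, Matrix.diagonal_mul_diagonal,
      ← Matrix.diagonal_one]
    congr 1; ext i; simpa using h' i
  · rw [Matrix.star_eq_conjTranspose, Matrix.diagonal_conjTranspose, Matrix.diagonal_mul_diagonal,
      ← Matrix.diagonal_one]
    congr 1; ext i; rw [mul_comm]; simpa using h' i

/-- Reindexing square matrices, as a star homomorphism. -/
def reindexHom (e : ι ≃ κ) : Matrix ι ι ℂ →⋆ₐ[ℂ] Matrix κ κ ℂ :=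
  { (Matrix.reindexAlgEquiv ℂ ℂ e : Matrix ι ι ℂ →ₐ[ℂ] Matrix κ κ ℂ) with
    map_star' := fun _ => rfl }

theorem reindexHom_apply (e : ι ≃ κ) (A : Matrix ι ι ℂ) :
    reindexHom e A = Matrix.reindex e e A := rfl

theorem norm_reindex (e : ι ≃ κ) (A : Matrix ι ι ℂ) : ‖Matrix.reindex e e A‖ = ‖A‖ :=
  NonUnitalStarAlgHom.norm_map (reindexHom e) (Matrix.reindex e e).injective A

/-- Block diagonal matrices with two blocks, as a star homomorphism. -/
def fromBlocksHom : (Matrix ι ι ℂ × Matrix κ κ ℂ) →⋆ₐ[ℂ] Matrix (ι ⊕ κ) (ι ⊕ κ) ℂ where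
  toFun p := Matrix.fromBlocks p.1 0 0 p.2
  map_one' := Matrix.fromBlocks_one
  map_mul' p q := by simp [Matrix.fromBlocks_multiply]
  map_zero' := Matrix.fromBlocks_zero
  map_add' p q := by simp [Matrix.fromBlocks_add]
  commutes' z := by
    simp only [Algebra.algebraMap_eq_smul_one, Prod.smul_fst, Prod.smul_snd, Prod.fst_one,
      Prod.snd_one]
    rw [← Matrix.fromBlocks_one, Matrix.fromBlocks_smul]
    simp
  map_star' p := by
    simp [Matrix.star_eq_conjTranspose, Matrix.fromBlocks_conjTranspose]

theorem norm_fromBlocks_diagonal (A : Matrix ι ι ℂ) (B : Matrix κ κ ℂ) :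
    ‖Matrix.fromBlocks A 0 0 B‖ = max ‖A‖ ‖B‖ :=
  NonUnitalStarAlgHom.norm_map (fromBlocksHom (ι := ι) (κ := κ)) (fun p q h => by
    have := Matrix.fromBlocks_inj.1 h
    exact Prod.ext this.1 this.2.2.2) (A, B)

/-- Fibrewise matrices, fibre index second, as a star homomorphism. -/
def fibHom : (ι → Matrix κ κ ℂ) →⋆ₐ[ℂ] Matrix (κ × ι) (κ × ι) ℂ where
  toFun M := Matrix.blockDiagonal M
  map_one' := Matrix.blockDiagonal_one
  map_mul' p q := Matrix.blockDiagonal_mul p q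
  map_zero' := Matrix.blockDiagonal_zero
  map_add' p q := Matrix.blockDiagonal_add p q
  commutes' z := by
    simp only [Algebra.algebraMap_eq_smul_one, Matrix.blockDiagonal_smul, Matrix.blockDiagonal_one]
  map_star' p := (Matrix.blockDiagonal_conjTranspose p).symm

theorem fibHom_apply (M : ι → Matrix κ κ ℂ) (k l : κ) (i j : ι) :
    fibHom M (k, i) (l, j) = if i = j then M i k l else 0 := by
  simp [fibHom, Matrix.blockDiagonal_apply]

/-- Block diagonal matrices, block index first, as a star homomorphism. -/
def blkHom : (κ → Matrix ι ι ℂ) →⋆ₐ[ℂ] Matrix (κ × ι) (κ × ι) ℂ :=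
  (reindexHom (Equiv.prodComm ι κ)).comp fibHom

theorem blkHom_apply (M : κ → Matrix ι ι ℂ) (k l : κ) (i j : ι) :
    blkHom M (k, i) (l, j) = if k = l then M k i j else 0 := by
  simp [blkHom, reindexHom_apply, fibHom_apply]

theorem blkHom_injective : Function.Injective (blkHom (ι := ι) (κ := κ)) := by
  intro M N h
  funext k; ext i j
  have := congrFun (congrFun h (k, i)) (k, j)
  simpa [blkHom_apply] using this

theorem norm_blkHom (M : κ → Matrix ι ι ℂ) : ‖blkHom M‖ = ‖M‖ :=
  NonUnitalStarAlgHom.norm_map (blkHom (ι := ι) (κ := κ)) blkHom_injective M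

theorem det_blkHom (M : κ → Matrix ι ι ℂ) : (blkHom M).det = ∏ k, (M k).det := by
  rw [← Matrix.det_blockDiagonal]
  exact Matrix.det_reindex_self (Equiv.prodComm ι κ) (Matrix.blockDiagonal M)

theorem norm_single_block_le (k l : κ) (B : Matrix ι ι ℂ) :
    ‖(Matrix.of fun p q : κ × ι => if p.1 = k ∧ q.1 = l then B p.2 q.2 else 0)‖ ≤ ‖B‖ := by
  set A := (Matrix.of fun p q : κ × ι => if p.1 = k ∧ q.1 = l then B p.2 q.2 else 0) with hA
  have h : A * star A = blkHom (fun m => if m = k then B * star B else 0) := by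
    ext ⟨p, i⟩ ⟨q, j⟩
    rw [blkHom_apply, Matrix.mul_apply, Fintype.sum_prod_type]
    simp only [hA, Matrix.star_apply, Matrix.of_apply]
    rw [Finset.sum_eq_single l]
    · by_cases hp : p = k <;> by_cases hq : q = k <;>
        simp [hp, hq, Matrix.mul_apply, Ne.symm]
    · intro b _ hb; simp [hb]
    · simp
  have h2 : ‖A‖ * ‖A‖ ≤ ‖B‖ * ‖B‖ := by
    rw [← CStarRing.norm_self_mul_star, h, norm_blkHom]
    refine (pi_norm_le_iff_of_nonneg (by positivity)).2 fun m => ?_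
    split_ifs
    · rw [CStarRing.norm_self_mul_star]
    · simp; positivity
  nlinarith [norm_nonneg A, norm_nonneg B]

theorem norm_le_sum_blocks (A : Matrix (κ × ι) (κ × ι) ℂ) (B : κ → κ → Matrix ι ι ℂ)
    (hB : ∀ k l i j, A (k, i) (l, j) = B k l i j) : ‖A‖ ≤ ∑ k, ∑ l, ‖B k l‖ := by
  have : A = ∑ k, ∑ l, Matrix.of fun p q : κ × ι =>
      if p.1 = k ∧ q.1 = l then B k l p.2 q.2 else 0 := by
    ext ⟨p, i⟩ ⟨q, j⟩
    simp only [Matrix.sum_apply, Matrix.of_apply, hB]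
    rw [Finset.sum_eq_single p (by intro b _ hb; simp [Ne.symm hb]) (by simp),
      Finset.sum_eq_single q (by intro b _ hb; simp [Ne.symm hb]) (by simp)]
    simp
  rw [this]
  refine (norm_sum_le _ _).trans (Finset.sum_le_sum fun k _ => (norm_sum_le _ _).trans
    (Finset.sum_le_sum fun l _ => norm_single_block_le k l _))

end Norms

section LogDet

variable {ι κ : Type*} [Fintype ι] [DecidableEq ι] [Fintype κ] [DecidableEq κ]

theorem sub_eq_sub_of_exp_eq {f g : ℝ → ℂ} (hf : ContinuousOn f (Set.Icc 0 1))
    (hg : ContinuousOn g (Set.Icc 0 1))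
    (h : ∀ t ∈ Set.Icc (0 : ℝ) 1, Complex.exp (f t) = Complex.exp (g t)) :
    f 1 - f 0 = g 1 - g 0 := by
  have h0 : (0 : ℝ) ∈ Set.Icc (0 : ℝ) 1 := by simp
  have h1 : (1 : ℝ) ∈ Set.Icc (0 : ℝ) 1 := by simp
  have hexp : Complex.exp (f 0 - g 0) = 1 := by
    rw [Complex.exp_sub, h 0 h0, div_self (Complex.exp_ne_zero _)]
  have := Complex.isCoveringMap_exp.eqOn_of_comp_eqOn isPreconnected_Icc hf
    (show ContinuousOn (fun t => g t + (f 0 - g 0)) _ from hg.add continuousOn_const) (fun t ht => by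
      simp only [Function.comp_apply, Subtype.mk.injEq]
      rw [Complex.exp_add, hexp, mul_one, h t ht]) h0 (by ring) h1
  simp only at this
  rw [this]; ring

theorem det_ne_zero_of_norm_sub_one_lt {A : Matrix ι ι ℂ} (hA : ‖A - 1‖ < 1) : A.det ≠ 0 := by
  have := (Units.oneSub (1 - A) (by rwa [norm_sub_rev])).isUnit
  rw [Units.val_oneSub, sub_sub_cancel] at this
  exact ((Matrix.isUnit_iff_isUnit_det A).1 this).ne_zero

theorem exists_logDet (ι : Type*) [Fintype ι] [DecidableEq ι] :
    ∃ L : Matrix ι ι ℂ → ℂ, ContinuousOn L (Metric.ball 1 1) ∧ L 1 = 0 ∧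
      ∀ A, ‖A - 1‖ < 1 → Complex.exp (L A) = A.det := by
  have hne : (1 : Matrix ι ι ℂ) ∈ Metric.ball (1 : Matrix ι ι ℂ) 1 := by simp
  have : ContractibleSpace (Metric.ball (1 : Matrix ι ι ℂ) 1) :=
    (convex_ball (1 : Matrix ι ι ℂ) 1).contractibleSpace ⟨1, hne⟩
  have : LocallyPathConnectedSpace (Metric.ball (1 : Matrix ι ι ℂ) 1) :=
    Metric.isOpen_ball.locallyPathConnectedSpace
  have hc : Continuous fun A : Metric.ball (1 : Matrix ι ι ℂ) 1 => A.1.det :=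
    continuous_subtype_val.matrix_det
  obtain ⟨F, ⟨hF0, hF⟩, -⟩ := Complex.isCoveringMapOn_exp.existsUnique_continuousMap_lifts
    (⟨_, hc⟩ : C(Metric.ball (1 : Matrix ι ι ℂ) 1, ℂ)) (a₀ := ⟨1, hne⟩) (e₀ := 0) (by simp)
    (fun A => det_ne_zero_of_norm_sub_one_lt (by
      have := A.2; rwa [Metric.mem_ball, dist_eq_norm] at this))
  classical
  refine ⟨fun A => if h : A ∈ Metric.ball (1 : Matrix ι ι ℂ) 1 then F ⟨A, h⟩ else 0, ?_, ?_, ?_⟩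
  · rw [continuousOn_iff_continuous_domRestrict]
    convert F.continuous using 1
    funext A
    simp [Set.domRestrict]
  · simpa using hF0
  · intro A hA
    have hA' : A ∈ Metric.ball (1 : Matrix ι ι ℂ) 1 := by simpa [dist_eq_norm] using hA
    simp only
    rw [dif_pos hA']
    exact congrFun hF ⟨A, hA'⟩

/-- The continuous logarithm of the determinant on the open unit ball around `1` that vanishes
at `1`. -/
def logDet (A : Matrix ι ι ℂ) : ℂ := (exists_logDet ι).choose A

theorem continuousOn_logDet : ContinuousOn (logDet (ι := ι)) (Metric.ball 1 1) :=
  (exists_logDet ι).choose_spec.1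

theorem logDet_one : logDet (1 : Matrix ι ι ℂ) = 0 := (exists_logDet ι).choose_spec.2.1

theorem exp_logDet {A : Matrix ι ι ℂ} (hA : ‖A - 1‖ < 1) : Complex.exp (logDet A) = A.det :=
  (exists_logDet ι).choose_spec.2.2 A hA

theorem logDet_sub_logDet_of_path {γ : ℝ → Matrix ι ι ℂ} {h : ℝ → ℂ}
    (hγ : ContinuousOn γ (Set.Icc 0 1)) (hball : ∀ t ∈ Set.Icc (0 : ℝ) 1, ‖γ t - 1‖ < 1)
    (hh : ContinuousOn h (Set.Icc 0 1))
    (hexp : ∀ t ∈ Set.Icc (0 : ℝ) 1, Complex.exp (h t) = (γ t).det) :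
    logDet (γ 1) - logDet (γ 0) = h 1 - h 0 := by
  refine sub_eq_sub_of_exp_eq (f := fun t => logDet (γ t)) ?_ hh ?_
  · exact continuousOn_logDet.comp hγ fun t ht => by simpa [dist_eq_norm] using hball t ht
  · intro t ht
    rw [exp_logDet (hball t ht), hexp t ht]

/-- The affine path from `1` to `A`. -/
def linPath (A : Matrix ι ι ℂ) (t : ℝ) : Matrix ι ι ℂ := 1 + (t : ℂ) • (A - 1)

theorem continuous_linPath (A : Matrix ι ι ℂ) : Continuous (linPath A) := by
  unfold linPath; fun_prop

theorem linPath_zero (A : Matrix ι ι ℂ) : linPath A 0 = 1 := by simp [linPath]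

theorem linPath_one (A : Matrix ι ι ℂ) : linPath A 1 = A := by simp [linPath]

theorem norm_linPath_sub_one_le (A : Matrix ι ι ℂ) {t : ℝ} (ht : t ∈ Set.Icc (0 : ℝ) 1) :
    ‖linPath A t - 1‖ ≤ ‖A - 1‖ := by
  rw [linPath, add_sub_cancel_left, norm_smul]
  refine mul_le_of_le_one_left (norm_nonneg _) ?_
  simp [abs_of_nonneg ht.1, ht.2]

theorem continuousOn_logDet_linPath {A : Matrix ι ι ℂ} (hA : ‖A - 1‖ < 1) :
    ContinuousOn (fun t => logDet (linPath A t)) (Set.Icc 0 1) :=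
  continuousOn_logDet.comp (continuous_linPath A).continuousOn fun t ht => by
    simpa [dist_eq_norm] using (norm_linPath_sub_one_le A ht).trans_lt hA

theorem exp_logDet_linPath {A : Matrix ι ι ℂ} (hA : ‖A - 1‖ < 1) {t : ℝ}
    (ht : t ∈ Set.Icc (0 : ℝ) 1) : Complex.exp (logDet (linPath A t)) = (linPath A t).det :=
  exp_logDet ((norm_linPath_sub_one_le A ht).trans_lt hA)

theorem norm_mul_sub_one_le (A B : Matrix ι ι ℂ) :
    ‖A * B - 1‖ ≤ ‖A - 1‖ + ‖B - 1‖ + ‖A - 1‖ * ‖B - 1‖ := by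
  have : A * B - 1 = (A - 1) + (B - 1) + (A - 1) * (B - 1) := by noncomm_ring
  rw [this]
  exact (norm_add_le _ _).trans (add_le_add (norm_add_le _ _) (norm_mul_le _ _))

theorem logDet_mul {A B : Matrix ι ι ℂ} (h : ‖A - 1‖ + ‖B - 1‖ + ‖A - 1‖ * ‖B - 1‖ < 1) :
    logDet (A * B) = logDet A + logDet B := by
  have hA0 := norm_nonneg (A - 1)
  have hB0 := norm_nonneg (B - 1)
  have hA : ‖A - 1‖ < 1 := by nlinarith
  have hB : ‖B - 1‖ < 1 := by nlinarith
  have := logDet_sub_logDet_of_path (γ := fun t => A * linPath B t)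
    (h := fun t => logDet A + logDet (linPath B t))
    (continuous_const.mul (continuous_linPath B)).continuousOn (fun t ht => by
      have := norm_linPath_sub_one_le B ht
      refine (norm_mul_sub_one_le _ _).trans_lt (lt_of_le_of_lt ?_ h)
      gcongr)
    (continuousOn_const.add (continuousOn_logDet_linPath hB)) (fun t ht => by
      rw [Complex.exp_add, exp_logDet hA, exp_logDet_linPath hB ht, Matrix.det_mul])
  simp only [linPath_zero, linPath_one, mul_one, logDet_one, add_zero] at this
  linear_combination this

theorem logDet_eq_neg_of_mul_eq_one {A B : Matrix ι ι ℂ} (hAB : A * B = 1)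
    (h : ‖A - 1‖ + ‖B - 1‖ + ‖A - 1‖ * ‖B - 1‖ < 1) : logDet B = -logDet A := by
  have := logDet_mul h
  rw [hAB, logDet_one] at this
  linear_combination -this

theorem norm_conj_sub_one {U : Matrix ι ι ℂ} (hU : U ∈ unitary (Matrix ι ι ℂ))
    (A : Matrix ι ι ℂ) : ‖U * A * star U - 1‖ = ‖A - 1‖ := by
  have : U * A * star U - 1 = U * (A - 1) * star U := by
    rw [mul_sub, sub_mul, mul_one, (Unitary.mem_iff.1 hU).2]
  rw [this, norm_mul_unitary (Unitary.star_mem hU), norm_unitary_mul hU]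

theorem logDet_conj {U : Matrix ι ι ℂ} (hU : U ∈ unitary (Matrix ι ι ℂ))
    {A : Matrix ι ι ℂ} (hA : ‖A - 1‖ < 1) : logDet (U * A * star U) = logDet A := by
  have := logDet_sub_logDet_of_path (γ := fun t => U * linPath A t * star U)
    (h := fun t => logDet (linPath A t))
    ((continuous_const.mul (continuous_linPath A)).mul continuous_const).continuousOn
    (fun t ht => by
      rw [norm_conj_sub_one hU]
      exact (norm_linPath_sub_one_le A ht).trans_lt hA)
    (continuousOn_logDet_linPath hA) (fun t ht => by
      rw [exp_logDet_linPath hA ht, Matrix.det_mul, Matrix.det_mul, mul_comm, ← mul_assoc,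
        ← Matrix.det_mul, (Unitary.mem_iff.1 hU).1]
      simp)
  simpa [linPath_zero, linPath_one, logDet_one, (Unitary.mem_iff.1 hU).2] using this

theorem logDet_blkHom {M : κ → Matrix ι ι ℂ} (h : ∀ k, ‖M k - 1‖ < 1) :
    logDet (blkHom M) = ∑ k, logDet (M k) := by
  have hM : ‖M - 1‖ < 1 := (pi_norm_lt_iff one_pos).2 h
  have hlin : ∀ t, linPath (blkHom M) t = blkHom fun k => linPath (M k) t := by
    intro t
    have : (fun k => linPath (M k) t) = 1 + (t : ℂ) • (M - 1) := rfl
    rw [this, linPath, map_add, map_smul, map_sub, map_one]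
  have hball : ‖blkHom M - 1‖ < 1 := by
    rw [← map_one blkHom, ← map_sub, norm_blkHom]; exact hM
  have := logDet_sub_logDet_of_path (γ := linPath (blkHom M))
    (h := fun t => ∑ k, logDet (linPath (M k) t))
    (continuous_linPath _).continuousOn
    (fun t ht => (norm_linPath_sub_one_le _ ht).trans_lt hball)
    (continuousOn_finsetSum _ fun k _ => continuousOn_logDet_linPath (h k)) (fun t ht => by
      rw [Complex.exp_sum, hlin, det_blkHom]
      exact Finset.prod_congr rfl fun k _ => exp_logDet_linPath (h k) ht)
  simpa [linPath_zero, linPath_one, logDet_one] using this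

theorem norm_exp_mul_I_sub_one_le (x : ℝ) : ‖Complex.exp (x * Complex.I) - 1‖ ≤ |x| := by
  rw [mul_comm]; simpa using Real.norm_exp_I_mul_ofReal_sub_one_le (x := x)

theorem logDet_diagonal_exp {a : ι → ℝ} (ha : ∀ i, |a i| < 1) :
    logDet (Matrix.diagonal fun i => Complex.exp (a i * Complex.I)) =
      (∑ i, (a i : ℂ)) * Complex.I := by
  have := logDet_sub_logDet_of_path
    (γ := fun t => Matrix.diagonal fun i => Complex.exp ((t * a i : ℝ) * Complex.I))
    (h := fun t => (∑ i, ((t * a i : ℝ) : ℂ)) * Complex.I)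
    (Continuous.continuousOn (Continuous.matrix_diagonal (by fun_prop))) (fun t ht => by
      rw [← Matrix.diagonal_one, Matrix.diagonal_sub, Matrix.l2_opNorm_diagonal]
      refine (pi_norm_lt_iff one_pos).2 fun i =>
        (norm_exp_mul_I_sub_one_le _).trans_lt ((le_of_eq (abs_mul _ _)).trans_lt ?_)
      rw [abs_of_nonneg ht.1]
      exact (mul_le_of_le_one_left (abs_nonneg _) ht.2).trans_lt (ha i))
    (Continuous.continuousOn (by fun_prop)) (fun t ht => by
      rw [Matrix.det_diagonal, Finset.sum_mul, Complex.exp_sum])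
  simpa [logDet_one] using this

end LogDet

section Polar

variable {ι κ : Type*} [Fintype ι] [DecidableEq ι] [Fintype κ] [DecidableEq κ]

theorem abs_sub_one_le_of_mem_spectrum {H : Matrix ι ι ℂ} {x : ℝ} (hx : x ∈ spectrum ℝ H) :
    |x - 1| ≤ ‖H - 1‖ := by
  have : x - 1 ∈ spectrum ℝ (H - algebraMap ℝ _ 1) := by
    rw [← spectrum.sub_singleton_eq]
    exact Set.sub_mem_sub hx rfl
  have h := spectrum.norm_le_norm_mul_of_mem this
  rw [map_one, Real.norm_eq_abs] at h
  exact h.trans (mul_le_of_le_one_right (norm_nonneg _) norm_one_matrix_le)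

theorem exists_unitary_of_norm_star_mul_self_sub_one_le {X : Matrix ι ι ℂ} {r : ℝ}
    (hX : ‖star X * X - 1‖ ≤ r) (hr : r < 1) :
    ∃ U ∈ unitary (Matrix ι ι ℂ), ‖U - X‖ ≤ r ∧ ∀ A ∈ unitary (Matrix ι ι ℂ),
      ∀ B ∈ unitary (Matrix ι ι ℂ), A * X = X * B → A * U = U * B := by
  set H := star X * X with hH
  have hsa : IsSelfAdjoint H := IsSelfAdjoint.star_mul_self X
  have hr0 : 0 ≤ r := (norm_nonneg _).trans hX
  have hpos : ∀ x ∈ spectrum ℝ H, 0 < x ∧ |x - 1| ≤ r := fun x hx => by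
    have := (abs_sub_one_le_of_mem_spectrum hx).trans hX
    exact ⟨by linarith [neg_abs_le (x - 1)], this⟩
  have hc1 : ContinuousOn (fun x : ℝ => (√x)⁻¹) (spectrum ℝ H) :=
    Real.continuous_sqrt.continuousOn.inv₀ fun x hx => (Real.sqrt_pos.2 (hpos x hx).1).ne'
  have hc2 : ContinuousOn (fun x : ℝ => √x) (spectrum ℝ H) := Real.continuous_sqrt.continuousOn
  set P := cfc (fun x : ℝ => (√x)⁻¹) H with hP
  set Q := cfc (fun x : ℝ => √x) H with hQ
  have hPsa : star P = P := (IsSelfAdjoint.cfc (f := fun x : ℝ => (√x)⁻¹) (a := H)).star_eq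
  have hPQ : P * Q = 1 := by
    rw [hP, hQ, ← cfc_mul _ _ H hc1 hc2, ← cfc_one ℝ H]
    refine cfc_congr fun x hx => ?_
    exact inv_mul_cancel₀ (Real.sqrt_pos.2 (hpos x hx).1).ne'
  have hQQ : Q * Q = H := by
    rw [hQ, ← cfc_mul _ _ H hc2 hc2]
    conv_rhs => rw [← cfc_id ℝ H]
    exact cfc_congr fun x hx => Real.mul_self_sqrt (hpos x hx).1.le
  have hQP : Q * P = 1 := mul_eq_one_comm.1 hPQ
  have hU1 : star (X * P) * (X * P) = 1 := by
    calc star (X * P) * (X * P) = P * (star X * X) * P := by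
          rw [star_mul, hPsa]; simp only [mul_assoc]
      _ = (P * Q) * (Q * P) := by rw [← hH, ← hQQ]; simp only [mul_assoc]
      _ = 1 := by rw [hPQ, hQP, one_mul]
  have hU : X * P ∈ unitary (Matrix ι ι ℂ) := Unitary.mem_iff.2 ⟨hU1, mul_eq_one_comm.1 hU1⟩
  refine ⟨X * P, hU, ?_, fun A hA B hB hAB => ?_⟩
  · have : X * P - X = (X * P) * (1 - Q) := by
      rw [mul_sub, mul_one, mul_assoc X P Q, hPQ, mul_one]
    rw [this, norm_unitary_mul hU, ← cfc_one ℝ H, hQ,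
      ← cfc_sub (1 : ℝ → ℝ) _ H continuousOn_const hc2]
    refine norm_cfc_le hr0 fun x hx => ?_
    obtain ⟨hx0, hx1⟩ := hpos x hx
    refine le_trans ?_ hx1
    have h1 := Real.sqrt_nonneg x
    have h2 : x - 1 = (√x - 1) * (√x + 1) := by nlinarith [Real.mul_self_sqrt hx0.le]
    rw [h2, abs_mul, Real.norm_eq_abs, Pi.one_apply, abs_sub_comm]
    exact le_mul_of_one_le_right (abs_nonneg _) (by rw [abs_of_nonneg] <;> linarith)
  · have hHB : H * B = B * H := by
      have h1 : star B * H * B = H := by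
        calc star B * H * B = star (X * B) * (X * B) := by
              rw [star_mul, hH]; simp only [mul_assoc]
          _ = star X * (star A * A) * X := by rw [← hAB, star_mul]; simp only [mul_assoc]
          _ = H := by rw [(Unitary.mem_iff.1 hA).1, mul_one]
      calc H * B = B * star B * (H * B) := by rw [(Unitary.mem_iff.1 hB).2, one_mul]
        _ = B * (star B * H * B) := by simp only [mul_assoc]
        _ = B * H := by rw [h1]
    have : P * B = B * P := Commute.cfc_real hHB _
    rw [← mul_assoc, hAB, mul_assoc, mul_assoc, this]

open scoped MatrixOrder in
theorem norm_star_mul_self_sub_one_le {X Y : Matrix ι ι ℂ} {δ : ℝ} (hX : ‖X‖ ≤ 1) (hY : ‖Y‖ ≤ 1)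
    (h : ‖Y * X - 1‖ ≤ δ) : ‖star X * X - 1‖ ≤ 2 * δ + δ ^ 2 := by
  have hc : ∀ Z : Matrix ι ι ℂ, ‖Z‖ ≤ 1 → star Z * Z ≤ 1 := fun Z hZ => by
    rw [← CStarAlgebra.norm_le_one_iff_of_nonneg (star Z * Z), CStarRing.norm_star_mul_self]
    nlinarith [norm_nonneg Z]
  have h1 : star (Y * X) * (Y * X) ≤ star X * X := by
    have := star_left_conjugate_le_conjugate (hc Y hY) X
    rw [star_mul]
    simpa only [mul_assoc, mul_one, one_mul] using this
  have h2 : 1 - star X * X ≤ 1 - star (Y * X) * (Y * X) := sub_le_sub_left h1 1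
  have h3 := CStarAlgebra.norm_le_norm_of_nonneg_of_le (sub_nonneg.2 (hc X hX)) h2
  rw [norm_sub_rev]
  refine h3.trans ?_
  set W := Y * X - 1 with hW
  have : 1 - star (Y * X) * (Y * X) = -(W + star W + star W * W) := by
    rw [show Y * X = W + 1 by rw [hW]; abel, star_add, star_one]; noncomm_ring
  rw [this, norm_neg]
  have hδ : 0 ≤ δ := (norm_nonneg _).trans h
  calc ‖W + star W + star W * W‖ ≤ ‖W‖ + ‖star W‖ + ‖star W‖ * ‖W‖ :=
        (norm_add_le _ _).trans (add_le_add (norm_add_le _ _) (norm_mul_le _ _))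
    _ ≤ δ + δ + δ * δ := by rw [norm_star]; gcongr
    _ = _ := by ring

theorem norm_star_mul_self_sub_one_le_of_norm_sub_le {X U : Matrix ι ι ℂ}
    (hU : U ∈ unitary (Matrix ι ι ℂ)) {r : ℝ} (h : ‖X - U‖ ≤ r) :
    ‖star X * X - 1‖ ≤ 2 * r + r ^ 2 := by
  set W := X - U with hW
  have : star X * X - 1 = star W * U + star U * W + star W * W := by
    rw [show X = W + U by rw [hW]; abel, star_add, ← (Unitary.mem_iff.1 hU).1]; noncomm_ring
  rw [this]
  have hr : 0 ≤ r := (norm_nonneg _).trans h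
  calc _ ≤ ‖star W * U‖ + ‖star U * W‖ + ‖star W‖ * ‖W‖ :=
        (norm_add_le _ _).trans (add_le_add (norm_add_le _ _) (norm_mul_le _ _))
    _ ≤ r + r + r * r := by
        rw [norm_mul_unitary hU, norm_unitary_mul (Unitary.star_mem hU), norm_star]; gcongr
    _ = _ := by ring

/-- An approximate intertwiner between two unitaries of order `N` is close to an exact unitary
intertwiner. -/
theorem exists_unitary_intertwiner {N : ℕ} (hN : 0 < N) {P Q X : Matrix ι ι ℂ}
    (hP : P ∈ unitary (Matrix ι ι ℂ)) (hQ : Q ∈ unitary (Matrix ι ι ℂ))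
    (hX : X ∈ unitary (Matrix ι ι ℂ)) (hPN : P ^ N = 1) (hQN : Q ^ N = 1) {η : ℝ}
    (h : ‖P * X - X * Q‖ ≤ η) (hη : N * η < 1 / 4) :
    ∃ U ∈ unitary (Matrix ι ι ℂ), ‖U - X‖ ≤ 4 * (N * η) ∧ P * U = U * Q := by
  have hη0 : 0 ≤ η := (norm_nonneg _).trans h
  have hpow : ∀ t : ℕ, ‖P ^ t * X * star Q ^ t - X‖ ≤ t * η := by
    intro t
    induction t with
    | zero => simp
    | succ t ih =>
      have e : P ^ (t + 1) * X * star Q ^ (t + 1) - X =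
          P ^ t * ((P * X - X * Q) * star Q) * star Q ^ t + (P ^ t * X * star Q ^ t - X) := by
        have : (P * X - X * Q) * star Q = P * X * star Q - X := by
          rw [sub_mul, mul_assoc X, (Unitary.mem_iff.1 hQ).2, mul_one]
        rw [this, pow_succ, pow_succ']
        noncomm_ring
      rw [e]
      refine (norm_add_le _ _).trans ?_
      rw [norm_mul_unitary (pow_mem (Unitary.star_mem hQ) t), norm_unitary_mul (pow_mem hP t),
        norm_mul_unitary (Unitary.star_mem hQ)]
      push_cast
      linarith
  set S : Matrix ι ι ℂ := (N : ℂ)⁻¹ • ∑ t ∈ Finset.range N, P ^ t * X * star Q ^ t with hS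
  have hN' : (N : ℂ) ≠ 0 := by exact_mod_cast hN.ne'
  have hSX : ‖S - X‖ ≤ N * η := by
    have e : S - X = (N : ℂ)⁻¹ • ∑ t ∈ Finset.range N, (P ^ t * X * star Q ^ t - X) := by
      rw [Finset.sum_sub_distrib, smul_sub, ← hS, Finset.sum_const, Finset.card_range,
        ← Nat.cast_smul_eq_nsmul ℂ, smul_smul, inv_mul_cancel₀ hN', one_smul]
    rw [e, norm_smul]
    have : ‖∑ t ∈ Finset.range N, (P ^ t * X * star Q ^ t - X)‖ ≤ N * (N * η) := by
      refine (norm_sum_le _ _).trans ?_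
      calc _ ≤ ∑ t ∈ Finset.range N, N * η := Finset.sum_le_sum fun t ht => (hpow t).trans (by
            have := (Finset.mem_range.1 ht).le; gcongr)
        _ = _ := by simp
    rw [norm_inv, Complex.norm_natCast, inv_mul_le_iff₀ (by exact_mod_cast hN)]
    exact this
  have hPS : P * S = S * Q := by
    have hQs : star Q * Q = 1 := (Unitary.mem_iff.1 hQ).1
    have hQNs : star Q ^ N = 1 := by rw [← star_pow, hQN, star_one]
    have e : P * S * star Q = S := by
      rw [hS, Matrix.mul_smul, Matrix.smul_mul, Finset.mul_sum, Finset.sum_mul]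
      congr 1
      have : ∀ t, P * (P ^ t * X * star Q ^ t) * star Q =
          P ^ (t + 1) * X * star Q ^ (t + 1) := fun t => by
        rw [pow_succ', pow_succ]; noncomm_ring
      simp only [this]
      have h1 := Finset.sum_range_succ (fun t => P ^ t * X * star Q ^ t) N
      rw [Finset.sum_range_succ' (fun t => P ^ t * X * star Q ^ t) N] at h1
      simpa [hPN, hQNs] using h1
    calc P * S = P * S * (star Q * Q) := by rw [hQs, mul_one]
      _ = (P * S * star Q) * Q := by simp only [mul_assoc]
      _ = S * Q := by rw [e]
  have hNη : 0 ≤ N * η := by positivity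
  obtain ⟨U, hU, hUS, hUc⟩ := exists_unitary_of_norm_star_mul_self_sub_one_le
    (norm_star_mul_self_sub_one_le_of_norm_sub_le hX hSX) (by nlinarith)
  refine ⟨U, hU, ?_, hUc P hP Q hQ hPS⟩
  calc ‖U - X‖ = ‖(U - S) + (S - X)‖ := by congr 1; abel
    _ ≤ _ := (norm_add_le _ _).trans (add_le_add hUS hSX)
    _ ≤ _ := by nlinarith

theorem exists_diagonalization {V : Matrix ι ι ℂ} (hV : V ∈ unitary (Matrix ι ι ℂ)) :
    ∃ O ∈ unitary (Matrix ι ι ℂ), ∃ v : ι → ℂ, (∀ i, ‖v i‖ = 1) ∧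
      V = O * Matrix.diagonal v * star O := by
  have hfin : ∀ f : ℂ → ℂ, ContinuousOn f (spectrum ℂ V) := fun f =>
    V.finite_spectrum.continuousOn f
  have hn : IsStarNormal V := isStarNormal_of_mem_unitary hV
  set A := cfc (fun z : ℂ => (Complex.arg z : ℂ)) V with hA
  have hsa : A.IsHermitian := IsSelfAdjoint.cfc_arg V
  have hexp : V = NormedSpace.exp (Complex.I • A) := by
    have h1 : Complex.I • A = cfc (fun z : ℂ => Complex.I * (Complex.arg z : ℂ)) V := by
      rw [hA, ← cfc_const_mul _ _ V (hfin _)]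
    rw [h1, ← CFC.exp_eq_normedSpace_exp (𝕜 := ℂ) (cfc_predicate _ V),
      ← cfc_comp' _ _ V (by
        rw [← Complex.exp_eq_exp_ℂ]; exact Complex.continuous_exp.continuousOn) (hfin _) hn]
    conv_lhs => rw [← cfc_id ℂ V]
    refine cfc_congr fun z hz => ?_
    have hz1 := spectrum.norm_eq_one_of_unitary hV hz
    have := Complex.norm_mul_exp_arg_mul_I z
    rw [hz1] at this
    rw [← Complex.exp_eq_exp_ℂ, mul_comm Complex.I]
    simpa using this.symm
  have hO : hsa.eigenvectorUnitary.1 ∈ unitary (Matrix ι ι ℂ) :=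
    hsa.eigenvectorUnitary.2
  set O : Matrix ι ι ℂ := hsa.eigenvectorUnitary.1 with hOdef
  have hspec : A = O * Matrix.diagonal (fun i => (hsa.eigenvalues i : ℂ)) * star O := by
    have := hsa.spectral_theorem
    rw [Unitary.conjStarAlgAut_apply] at this
    exact this
  have hinv : star O = O⁻¹ := (Matrix.inv_eq_right_inv (Unitary.mem_iff.1 hO).2).symm
  refine ⟨O, hO, fun i => Complex.exp (hsa.eigenvalues i * Complex.I),
    fun i => Complex.norm_exp_ofReal_mul_I _, ?_⟩
  have h2 : Complex.I • A = O * Matrix.diagonal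
      (fun i => (hsa.eigenvalues i * Complex.I : ℂ)) * O⁻¹ := by
    rw [← hinv]
    conv_lhs => rw [hspec]
    rw [← Matrix.smul_mul, ← Matrix.mul_smul, ← Matrix.diagonal_smul]
    congr 3
    ext i
    simp [mul_comm]
  rw [hexp, h2, Matrix.exp_conj O _ (Unitary.toUnits ⟨O, hO⟩).isUnit, Matrix.exp_diagonal, hinv]
  congr 3
  ext i
  rw [Pi.coe_exp, Complex.exp_eq_exp_ℂ]

theorem sum_eq_of_intertwine {M : Type*} [AddCommMonoid M] {X : Matrix ι ι ℂ}
    (hX : IsUnit X) {d d' : ι → ℂ} (h : Matrix.diagonal d * X = X * Matrix.diagonal d')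
    (g : ℂ → M) : ∑ i, g (d i) = ∑ i, g (d' i) := by
  obtain ⟨u, rfl⟩ := hX
  have h1 : (Matrix.diagonal d).charpoly = (Matrix.diagonal d').charpoly := by
    rw [← Matrix.charpoly_units_conj u (Matrix.diagonal d'), ← h, mul_assoc, ← Matrix.coe_units_inv,
      Units.mul_inv, mul_one]
  rw [Matrix.charpoly_diagonal, Matrix.charpoly_diagonal] at h1
  have h2 : ∀ d : ι → ℂ, (∏ i, (Polynomial.X - Polynomial.C (d i))).roots =
      Finset.univ.val.map d := fun d => by
    rw [← Polynomial.roots_multiset_prod_X_sub_C (Finset.univ.val.map d), Multiset.map_map]; rfl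
  have h3 := congrArg Polynomial.roots h1
  rw [h2, h2] at h3
  have h4 := congrArg (fun s => (s.map g).sum) h3
  simpa [Multiset.map_map] using h4

end Polar

section Perturbation

variable {ι κ : Type*} [Fintype ι] [DecidableEq ι] [Fintype κ] [DecidableEq κ]

theorem norm_inv_sub_one_le {X : Matrix ι ι ℂ} (hX : ‖X - 1‖ ≤ 1 / 100) :
    X * X⁻¹ = 1 ∧ ‖X⁻¹ - 1‖ ≤ 1 / 99 := by
  have hu : IsUnit X.det := (det_ne_zero_of_norm_sub_one_lt (hX.trans_lt (by norm_num))).isUnit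
  have h1 : X⁻¹ * X = 1 := Matrix.nonsing_inv_mul X hu
  refine ⟨Matrix.mul_nonsing_inv X hu, ?_⟩
  have h2 : X⁻¹ - 1 = -((X⁻¹ - 1) * (X - 1)) - (X - 1) := by
    have : (X⁻¹ - 1) * (X - 1) = X⁻¹ * X - X⁻¹ - X + 1 := by noncomm_ring
    rw [this, h1]; abel
  have h3 : ‖X⁻¹ - 1‖ ≤ ‖X⁻¹ - 1‖ * (1 / 100) + 1 / 100 := by
    conv_lhs => rw [h2]
    refine (norm_sub_le _ _).trans (add_le_add ?_ hX)
    rw [norm_neg]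
    exact (norm_mul_le _ _).trans (by gcongr)
  linarith

theorem norm_mul_sub_one_le_of_le {A B : Matrix ι ι ℂ} {a b c : ℝ} (hA : ‖A - 1‖ ≤ a)
    (hB : ‖B - 1‖ ≤ b) (h : a + b + a * b ≤ c) : ‖A * B - 1‖ ≤ c := by
  have ha : 0 ≤ a := (norm_nonneg _).trans hA
  refine (norm_mul_sub_one_le A B).trans (le_trans ?_ h)
  gcongr

theorem logDet_mul_of_le {A B : Matrix ι ι ℂ} {a b : ℝ} (hA : ‖A - 1‖ ≤ a) (hB : ‖B - 1‖ ≤ b)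
    (h : a + b + a * b < 1) : logDet (A * B) = logDet A + logDet B := by
  have ha : 0 ≤ a := (norm_nonneg _).trans hA
  refine logDet_mul (lt_of_le_of_lt ?_ h)
  gcongr

theorem logDet_inv_of_le {A B : Matrix ι ι ℂ} {a b : ℝ} (hAB : A * B = 1) (hA : ‖A - 1‖ ≤ a)
    (hB : ‖B - 1‖ ≤ b) (h : a + b + a * b < 1) : logDet B = -logDet A := by
  have ha : 0 ≤ a := (norm_nonneg _).trans hA
  refine logDet_eq_neg_of_mul_eq_one hAB (lt_of_le_of_lt ?_ h)
  gcongr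

/-- The logarithm of the determinant of a commutator is unchanged under perturbing the entries. -/
theorem logDet_commutator_eq {U C A D : Matrix ι ι ℂ} (hU : U ∈ unitary (Matrix ι ι ℂ))
    (hC : C ∈ unitary (Matrix ι ι ℂ)) (hA : ‖A - U‖ ≤ 1 / 100) (hD : ‖D - C‖ ≤ 1 / 100)
    (hUC : ‖U * C - C * U‖ ≤ 1 / 10) :
    logDet (A * D * A⁻¹ * D⁻¹) = logDet (U * C * star U * star C) := by
  obtain ⟨hU1, hU2⟩ := Unitary.mem_iff.1 hU
  obtain ⟨hC1, hC2⟩ := Unitary.mem_iff.1 hC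
  obtain ⟨X, rfl⟩ : ∃ X, A = U * X := ⟨star U * A, by rw [← mul_assoc, hU2, one_mul]⟩
  obtain ⟨Y, rfl⟩ : ∃ Y, D = C * Y := ⟨star C * D, by rw [← mul_assoc, hC2, one_mul]⟩
  have hX : ‖X - 1‖ ≤ 1 / 100 := by
    rw [← norm_unitary_mul hU, mul_sub, mul_one]; exact hA
  have hY : ‖Y - 1‖ ≤ 1 / 100 := by
    rw [← norm_unitary_mul hC, mul_sub, mul_one]; exact hD
  obtain ⟨hX1, hX2⟩ := norm_inv_sub_one_le hX
  obtain ⟨hY1, hY2⟩ := norm_inv_sub_one_le hY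
  have hUi : U⁻¹ = star U := Matrix.inv_eq_right_inv hU2
  have hCi : C⁻¹ = star C := Matrix.inv_eq_right_inv hC2
  have hK : ‖U * C * star U * star C - 1‖ ≤ 1 / 10 := by
    have : U * C * star U * star C - 1 = (U * C - C * U) * star U * star C := by
      rw [sub_mul, sub_mul, mul_assoc C U, hU2, mul_one, hC2]
    rw [this, norm_mul_unitary (Unitary.star_mem hC), norm_mul_unitary (Unitary.star_mem hU)]
    exact hUC
  obtain ⟨G, hG⟩ : ∃ G, G = C * (Y * X⁻¹) * star C := ⟨_, rfl⟩
  have hYX : ‖Y * X⁻¹ - 1‖ ≤ 1 / 40 := norm_mul_sub_one_le_of_le hY hX2 (by norm_num)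
  have hG1 : ‖G - 1‖ ≤ 1 / 40 := by rw [hG, norm_conj_sub_one hC]; exact hYX
  have hXG : ‖X * G - 1‖ ≤ 1 / 20 := norm_mul_sub_one_le_of_le hX hG1 (by norm_num)
  have lG : logDet G = logDet Y + logDet X⁻¹ := by
    rw [hG, logDet_conj hC (hYX.trans_lt (by norm_num)),
      logDet_mul_of_le hY hX2 (by norm_num)]
  have lX : logDet X⁻¹ = -logDet X := logDet_inv_of_le hX1 hX hX2 (by norm_num)
  have lY : logDet Y⁻¹ = -logDet Y := logDet_inv_of_le hY1 hY hY2 (by norm_num)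
  have l1 : logDet (U * (X * G) * star U) = logDet Y := by
    rw [logDet_conj hU (hXG.trans_lt (by norm_num)), logDet_mul_of_le hX hG1 (by norm_num), lG, lX]
    ring
  have n1 : ‖U * (X * G) * star U - 1‖ ≤ 1 / 20 := by rw [norm_conj_sub_one hU]; exact hXG
  have l3 : logDet (C * Y⁻¹ * star C) = -logDet Y := by
    rw [logDet_conj hC (hY2.trans_lt (by norm_num)), lY]
  have n3 : ‖C * Y⁻¹ * star C - 1‖ ≤ 1 / 99 := by rw [norm_conj_sub_one hC]; exact hY2
  obtain ⟨K, hKdef⟩ : ∃ K, K = U * C * star U * star C := ⟨_, rfl⟩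
  rw [← hKdef] at hK ⊢
  have n12 : ‖U * (X * G) * star U * K - 1‖ ≤ 1 / 5 :=
    norm_mul_sub_one_le_of_le n1 hK (by norm_num)
  have hUU : ∀ Z, star U * (U * Z) = Z := fun Z => by rw [← mul_assoc, hU1, one_mul]
  have hCC : ∀ Z, star C * (C * Z) = Z := fun Z => by rw [← mul_assoc, hC1, one_mul]
  have e : U * X * (C * Y) * (U * X)⁻¹ * (C * Y)⁻¹ =
      U * (X * G) * star U * K * (C * Y⁻¹ * star C) := by
    rw [Matrix.mul_inv_rev, Matrix.mul_inv_rev, hUi, hCi, hG, hKdef]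
    simp only [mul_assoc, hUU, hCC]
  rw [e, logDet_mul_of_le n12 n3 (by norm_num), logDet_mul_of_le n1 hK (by norm_num), l1, l3]
  ring

end Perturbation

section Cut

variable {ι : Type*} [Fintype ι] [DecidableEq ι]

theorem exists_perm_eq_comp {α : Type*} [Fintype α] {b f : α → ℝ} (hb : ∀ i, b i = 0 ∨ b i = 1)
    (hf : ∀ i, f i = 0 ∨ f i = 1) (h : ∑ i, b i = ∑ i, f i) : ∃ σ : Equiv.Perm α, f = b ∘ σ := by
  classical
  have hs : ∀ b : α → ℝ, (∀ i, b i = 0 ∨ b i = 1) →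
      ∑ i, b i = (Fintype.card {i // b i = 1} : ℝ) := fun b hb => by
    rw [Fintype.card_subtype, ← Finset.sum_boole]
    exact Finset.sum_congr rfl fun i _ => by rcases hb i with h | h <;> simp [h]
  rw [hs b hb, hs f hf] at h
  have e : {i // f i = 1} ≃ {i // b i = 1} := Fintype.equivOfCardEq (by exact_mod_cast h.symm)
  refine ⟨e.extendSubtype, funext fun i => ?_⟩
  by_cases hi : f i = 1
  · exact hi.trans (e.extendSubtype_mem i hi).symm
  · have h1 := e.extendSubtype_not_mem i hi
    rw [(hf i).resolve_right hi]
    exact ((hb _).resolve_right h1).symm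

theorem exists_comp_perm {α : Type*} [Fintype α] {b f : α → ℝ} (hb : ∀ i, b i = 0 ∨ b i = 1)
    (hf : ∀ i, f i = 0 ∨ f i = 1) :
    ∃ σ : Equiv.Perm α, ∑ i, b (σ i) = ∑ i, f i → b ∘ σ = f := by
  by_cases h : ∑ i, b i = ∑ i, f i
  · obtain ⟨σ, hσ⟩ := exists_perm_eq_comp hb hf h
    exact ⟨σ, fun _ => hσ.symm⟩
  · exact ⟨1, fun h' => (h h').elim⟩

variable (p : ι → Prop) [DecidablePred p]

/-- Block diagonal matrices with respect to a predicate and its complement. -/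
def splitHom : (Matrix {i // p i} {i // p i} ℂ × Matrix {i // ¬p i} {i // ¬p i} ℂ) →⋆ₐ[ℂ]
    Matrix ι ι ℂ :=
  (reindexHom (Equiv.sumCompl p)).comp fromBlocksHom

theorem norm_splitHom (A : Matrix {i // p i} {i // p i} ℂ)
    (B : Matrix {i // ¬p i} {i // ¬p i} ℂ) : ‖splitHom p (A, B)‖ = max ‖A‖ ‖B‖ := by
  rw [← norm_fromBlocks_diagonal]
  exact norm_reindex _ _

theorem splitHom_diagonal (f : {i // p i} → ℂ) (g : {i // ¬p i} → ℂ) :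
    splitHom p (Matrix.diagonal f, Matrix.diagonal g) =
      Matrix.diagonal fun i => if h : p i then f ⟨i, h⟩ else g ⟨i, h⟩ := by
  change Matrix.reindex _ _ (Matrix.fromBlocks (Matrix.diagonal f) 0 0 (Matrix.diagonal g)) = _
  rw [Matrix.fromBlocks_diagonal, Matrix.reindex_apply, Matrix.submatrix_diagonal_equiv]
  congr 1
  funext i
  by_cases h : p i <;> simp [h]

theorem splitHom_zero_submatrix (X : Matrix ι ι ℂ) :
    splitHom p (0, X.submatrix Subtype.val Subtype.val) =
      (1 - Matrix.diagonal fun i => if p i then 1 else 0) * X *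
        (1 - Matrix.diagonal fun i => if p i then 1 else 0) := by
  have : (1 - Matrix.diagonal fun i => if p i then (1 : ℂ) else 0) =
      Matrix.diagonal fun i => if p i then (0 : ℂ) else 1 := by
    rw [← Matrix.diagonal_one, Matrix.diagonal_sub]
    congr 1; funext i; split_ifs <;> simp
  rw [this]
  change Matrix.reindex _ _ (Matrix.fromBlocks 0 0 0 (X.submatrix Subtype.val Subtype.val)) = _
  ext i j
  by_cases h : p i <;> by_cases h' : p j <;>
    simp [h, h', Matrix.fromBlocks_apply₁₁]

theorem exists_cut {f : ι → ℝ} (hf1 : ∀ i, |f i| ≤ 1) (hf : ∀ i, ¬p i → f i = 0 ∨ f i = 1)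
    {U E T : Matrix ι ι ℂ} (hU : U ∈ unitary (Matrix ι ι ℂ)) {η : ℝ}
    (hE : E = Matrix.diagonal fun i => if p i then 1 else 0)
    (hT : T = Matrix.diagonal fun i => (f i : ℂ))
    (h1 : ‖E * (star U * T * U) - E * T‖ ≤ η)
    (h2 : ‖star U * (T - T * T) * U - (T - T * T)‖ ≤ η) :
    ∃ (g : ι → ℝ) (Z : Matrix ι ι ℂ), (∀ i, p i → g i = f i) ∧ (∀ i, ¬p i → g i = 0 ∨ g i = 1) ∧
      Z ∈ unitary (Matrix ι ι ℂ) ∧ E * Z = E ∧ Z * E = E ∧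
      ‖Z * Matrix.diagonal (fun i => (g i : ℂ)) * star Z - star U * T * U‖ ≤ 6 * η ∧
      (∑ i, g i = ∑ i, f i → g = f) := by
  obtain ⟨hU1, hU2⟩ := Unitary.mem_iff.1 hU
  set T' := star U * T * U with hT'
  have hEsa : star E = E := by
    rw [hE, Matrix.star_eq_conjTranspose, Matrix.diagonal_conjTranspose]
    congr 1; funext i; simp [apply_ite]
  have hTsa : star T = T := by
    rw [hT, Matrix.star_eq_conjTranspose, Matrix.diagonal_conjTranspose]
    congr 1; funext i; simp
  have hT'sa : star T' = T' := by
    rw [hT', star_mul, star_mul, star_star, hTsa, mul_assoc]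
  have hEE : E * E = E := by
    rw [hE, Matrix.diagonal_mul_diagonal]
    congr 1; funext i; simp
  have hET : E * T = T * E := by
    rw [hE, hT, Matrix.diagonal_mul_diagonal, Matrix.diagonal_mul_diagonal]
    congr 1; funext i; ring
  have hE1 : ‖E‖ ≤ 1 := hE ▸ norm_diagonal_le zero_le_one fun i => by split_ifs <;> simp
  have hF1 : ‖1 - E‖ ≤ 1 := by
    rw [hE, ← Matrix.diagonal_one, Matrix.diagonal_sub]
    exact norm_diagonal_le zero_le_one fun i => by split_ifs <;> simp
  have hT1 : ‖T‖ ≤ 1 := hT ▸ norm_diagonal_le zero_le_one fun i => by simpa using hf1 i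
  have hT'1 : ‖T'‖ ≤ 1 := by
    rwa [hT', norm_mul_unitary hU, norm_unitary_mul (Unitary.star_mem hU)]
  have hEF : E * (1 - E) = 0 := by rw [mul_sub, mul_one, hEE, sub_self]
  have hFE : (1 - E) * E = 0 := by rw [sub_mul, one_mul, hEE, sub_self]
  have hoff : ‖E * T' * (1 - E)‖ ≤ η := by
    have : E * T' * (1 - E) = (E * T' - E * T) * (1 - E) := by
      rw [sub_mul _ _ (1 - E), hET, mul_assoc T, hEF, mul_zero, sub_zero]
    rw [this]
    exact (norm_mul_le_right_of_le_one hF1).trans h1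
  have hoff' : ‖(1 - E) * T' * E‖ ≤ η := by
    have : (1 - E) * T' * E = star (E * T' * (1 - E)) := by
      simp only [star_mul, star_sub, star_one, hEsa, hT'sa, mul_assoc]
    rwa [this, norm_star]
  set B := T'.submatrix (Subtype.val : {i // ¬p i} → ι) Subtype.val with hB
  have hBE : splitHom p (0, B) = (1 - E) * T' * (1 - E) := by
    rw [hE]; exact splitHom_zero_submatrix p T'
  have hBsa : B.IsHermitian := by
    have : T'.IsHermitian := hT'sa
    exact this.submatrix _
  have hBB : ‖B - B * B‖ ≤ 2 * η := by
    have e1 : ‖B - B * B‖ = ‖splitHom p (0, B - B * B)‖ := by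
      rw [norm_splitHom, norm_zero, max_eq_right (norm_nonneg _)]
    have e2 : splitHom p (0, B - B * B) =
        (1 - E) * T' * (1 - E) - (1 - E) * T' * (1 - E) * ((1 - E) * T' * (1 - E)) := by
      rw [← hBE, ← map_mul, ← map_sub]; simp
    have e3 : (1 - E) * T' * (1 - E) - (1 - E) * T' * (1 - E) * ((1 - E) * T' * (1 - E)) =
        (1 - E) * (star U * (T - T * T) * U - (T - T * T)) * (1 - E) +
          (1 - E) * T' * E * (T' * (1 - E)) := by
      have e4 : (1 - E) * (T - T * T) = 0 := by
        rw [hE, hT, ← Matrix.diagonal_one, Matrix.diagonal_mul_diagonal, Matrix.diagonal_sub,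
          Matrix.diagonal_sub, Matrix.diagonal_mul_diagonal, ← Matrix.diagonal_zero]
        congr 1; funext i
        by_cases h : p i
        · simp [h]
        · rcases hf i h with h' | h' <;> simp [h']
      have e5 : star U * (T - T * T) * U = T' - T' * T' := by
        have : T' * T' = star U * (T * (U * star U) * T) * U := by
          rw [hT']; simp only [mul_assoc]
        rw [this, hU2, mul_one, hT']; noncomm_ring
      have e6 : (1 - E) * (1 - E) = 1 - E := by rw [mul_sub, hFE, mul_one, sub_zero]
      have e7 : (1 - E) * T' * (1 - E) * ((1 - E) * T' * (1 - E)) =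
          (1 - E) * T' * (1 - E) * T' * (1 - E) := by
        calc _ = (1 - E) * T' * ((1 - E) * (1 - E)) * T' * (1 - E) := by simp only [mul_assoc]
          _ = _ := by rw [e6]
      rw [e7, e5, mul_sub (1 - E), e4, sub_zero]
      noncomm_ring
    rw [e1, e2, e3]
    refine (norm_add_le _ _).trans ?_
    have n1 : ‖(1 - E) * (star U * (T - T * T) * U - (T - T * T)) * (1 - E)‖ ≤ η :=
      (norm_mul_le_right_of_le_one hF1).trans ((norm_mul_le_left_of_le_one hF1).trans h2)
    have n2 : ‖(1 - E) * T' * E * (T' * (1 - E))‖ ≤ η :=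
      (norm_mul_le_right_of_le_one ((norm_mul_le_left_of_le_one hT'1).trans hF1)).trans hoff'
    linarith
  set O : Matrix {i // ¬p i} {i // ¬p i} ℂ := hBsa.eigenvectorUnitary.1 with hO
  have hOu : O ∈ unitary (Matrix {i // ¬p i} {i // ¬p i} ℂ) := hBsa.eigenvectorUnitary.2
  obtain ⟨hO1, hO2⟩ := Unitary.mem_iff.1 hOu
  set β := hBsa.eigenvalues with hβ
  have hspec : B = O * Matrix.diagonal (fun i => (β i : ℂ)) * star O := by
    have := hBsa.spectral_theorem
    rw [Unitary.conjStarAlgAut_apply] at this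
    exact this
  have hβ2 : ∀ i, |β i - β i * β i| ≤ 2 * η := by
    have e : B - B * B = O * Matrix.diagonal (fun i => (β i - β i * β i : ℂ)) * star O := by
      have : Matrix.diagonal (fun i => (β i - β i * β i : ℂ)) =
          Matrix.diagonal (fun i => (β i : ℂ)) -
            Matrix.diagonal (fun i => (β i : ℂ)) * Matrix.diagonal (fun i => (β i : ℂ)) := by
        rw [Matrix.diagonal_mul_diagonal, Matrix.diagonal_sub]
      rw [this]
      set D := Matrix.diagonal (fun i => (β i : ℂ))
      have : B * B = O * (D * (star O * O) * D) * star O := by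
        conv_lhs => rw [hspec]
        simp only [mul_assoc]
      rw [this, hO1, mul_one]
      conv_lhs => rw [hspec]
      noncomm_ring
    rw [e, norm_mul_unitary (Unitary.star_mem hOu), norm_unitary_mul hOu,
      Matrix.l2_opNorm_diagonal] at hBB
    intro i
    have := (norm_le_pi_norm (fun i => (β i - β i * β i : ℂ)) i).trans hBB
    rw [← Real.norm_eq_abs]
    rw [← Complex.norm_real]
    push_cast
    exact this
  set b : {i // ¬p i} → ℝ := fun i => if 1 / 2 ≤ β i then 1 else 0 with hb
  have hb01 : ∀ i, b i = 0 ∨ b i = 1 := fun i => by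
    simp only [hb]; split_ifs <;> simp
  have hbβ : ∀ i, |b i - β i| ≤ 4 * η := fun i => by
    have h := hβ2 i
    have : |b i - β i| ≤ 2 * |β i - β i * β i| := by
      have e : β i - β i * β i = β i * (1 - β i) := by ring
      rw [e, abs_mul]
      simp only [hb]
      split_ifs with h'
      · have : 1 / 2 ≤ |β i| := h'.trans (le_abs_self _)
        nlinarith [abs_nonneg (1 - β i)]
      · have : 1 / 2 ≤ |1 - β i| := le_trans (by linarith) (le_abs_self _)
        rw [zero_sub, abs_neg]
        nlinarith [abs_nonneg (β i)]
    linarith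
  obtain ⟨σ, hσ⟩ := exists_comp_perm (f := fun i : {i // ¬p i} => f i) hb01
    (fun i => hf i i.2)
  set W := O.submatrix id σ with hW
  have hWs : star W = (star O).submatrix σ id := by
    rw [hW, Matrix.star_eq_conjTranspose, Matrix.conjTranspose_submatrix,
      Matrix.star_eq_conjTranspose]
  have hWd : ∀ d : {i // ¬p i} → ℂ, W * Matrix.diagonal (d ∘ σ) * star W =
      O * Matrix.diagonal d * star O := fun d => by
    have : Matrix.diagonal (d ∘ σ) = (Matrix.diagonal d).submatrix σ σ :=
      (Matrix.submatrix_diagonal_equiv d σ).symm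
    rw [this, hWs, hW, Matrix.submatrix_mul_equiv, Matrix.submatrix_mul_equiv,
      Matrix.submatrix_id_id]
  have hWu : W ∈ unitary (Matrix {i // ¬p i} {i // ¬p i} ℂ) := by
    have : W * star W = 1 := by
      have := hWd 1
      have e : ((1 : {i // ¬p i} → ℂ) ∘ σ) = 1 := rfl
      have e' : Matrix.diagonal (1 : {i // ¬p i} → ℂ) = 1 := Matrix.diagonal_one
      rw [e, e', mul_one, mul_one, hO2] at this
      exact this
    exact Unitary.mem_iff.2 ⟨mul_eq_one_comm.1 this, this⟩
  have hEs : E = splitHom p (1, 0) := by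
    rw [← Matrix.diagonal_one, ← Matrix.diagonal_zero, splitHom_diagonal, hE]
    congr 1
  refine ⟨fun i => if h : p i then f i else b (σ ⟨i, h⟩), splitHom p (1, W), fun i hi => dif_pos hi,
    fun i hi => by simpa [hi] using hb01 _, ?_, ?_, ?_, ?_, fun hsum => ?_⟩
  · obtain ⟨w1, w2⟩ := Unitary.mem_iff.1 hWu
    refine Unitary.mem_iff.2 ⟨?_, ?_⟩
    · rw [← map_star, ← map_mul, ← map_one (splitHom p)]
      congr 1
      exact Prod.ext (by simp) w1
    · rw [← map_star, ← map_mul, ← map_one (splitHom p)]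
      congr 1
      exact Prod.ext (by simp) w2
  · rw [hEs, ← map_mul]; simp
  · rw [hEs, ← map_mul]; simp
  · have e1 : (Matrix.diagonal fun i => ((if h : p i then f i else b (σ ⟨i, h⟩) : ℝ) : ℂ)) =
        splitHom p (Matrix.diagonal fun i => (f i : ℂ), Matrix.diagonal fun i => (b (σ i) : ℂ)) := by
      rw [splitHom_diagonal]
      congr 1; funext i; split_ifs <;> rfl
    have e2 : splitHom p (1, W) * splitHom p (Matrix.diagonal fun i => (f i : ℂ),
        Matrix.diagonal fun i => (b (σ i) : ℂ)) * star (splitHom p (1, W)) =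
        splitHom p (Matrix.diagonal fun i => (f i : ℂ),
          O * Matrix.diagonal (fun i => (b i : ℂ)) * star O) := by
      rw [← map_star, ← map_mul, ← map_mul, ← hWd]
      congr 1
      exact Prod.ext (by simp) rfl
    have e3 : splitHom p (Matrix.diagonal fun i => (f i : ℂ), B) =
        E * T + (1 - E) * T' * (1 - E) := by
      have : E * T = splitHom p (Matrix.diagonal fun i => (f i : ℂ), 0) := by
        rw [← Matrix.diagonal_zero, splitHom_diagonal, hE, hT, Matrix.diagonal_mul_diagonal]
        congr 1; funext i; split_ifs <;> simp
      rw [← hBE, this, ← map_add]; simp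
    have e4 : splitHom p (Matrix.diagonal fun i => (f i : ℂ), B) - T' =
        -(E * T' - E * T) - (1 - E) * T' * E := by
      rw [e3]; noncomm_ring
    have n1 : ‖splitHom p (Matrix.diagonal fun i => (f i : ℂ), B) - T'‖ ≤ 2 * η := by
      rw [e4]
      refine (norm_sub_le _ _).trans ?_
      rw [norm_neg]; linarith
    have hη : 0 ≤ η := (norm_nonneg _).trans h1
    have n2 : ‖splitHom p (Matrix.diagonal fun i => (f i : ℂ),
          O * Matrix.diagonal (fun i => (b i : ℂ)) * star O) -
        splitHom p (Matrix.diagonal fun i => (f i : ℂ), B)‖ ≤ 4 * η := by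
      rw [← map_sub, Prod.mk_sub_mk, sub_self, norm_splitHom, norm_zero,
        max_eq_right (norm_nonneg _)]
      conv_lhs => rw [hspec]
      rw [← sub_mul, ← mul_sub, norm_mul_unitary (Unitary.star_mem hOu), norm_unitary_mul hOu,
        Matrix.diagonal_sub]
      refine norm_diagonal_le (by linarith) fun i => ?_
      rw [← Complex.ofReal_sub, Complex.norm_real]
      exact hbβ i
    rw [e1, e2]
    calc _ ≤ _ := norm_sub_le_norm_sub_add_norm_sub _
          (splitHom p (Matrix.diagonal fun i => (f i : ℂ), B)) _
      _ ≤ _ := by linarith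
  · have key : ∀ F : ι → ℝ, ∑ i, F i = ∑ i : {i // p i}, F i + ∑ i : {i // ¬p i}, F i := fun F => by
      rw [← (Equiv.sumCompl p).sum_comp, Fintype.sum_sum_type]; rfl
    rw [key, key f] at hsum
    have h3 : ∑ i : {i // p i}, (if h : p i.1 then f i.1 else b (σ ⟨i.1, h⟩)) =
        ∑ i : {i // p i}, f i := Finset.sum_congr rfl fun i _ => dif_pos i.2
    have h4 : ∑ i : {i // ¬p i}, (if h : p i.1 then f i.1 else b (σ ⟨i.1, h⟩)) =
        ∑ i : {i // ¬p i}, b (σ i) := Finset.sum_congr rfl fun i _ => dif_neg i.2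
    rw [h3, h4] at hsum
    have h5 := hσ (add_left_cancel hsum)
    funext i
    split_ifs with h
    · rfl
    · exact congrFun h5 ⟨i, h⟩

end Cut

section CircleFunctions

theorem norm_commutator_fourier_le {T : ℝ} {ι : Type*} [Fintype ι] [DecidableEq ι]
    (U : Matrix ι ι ℂ) (x : ι → AddCircle T) (k : ℤ) :
    ‖U * Matrix.diagonal (fun i => fourier k (x i)) -
        Matrix.diagonal (fun i => fourier k (x i)) * U‖ ≤
      |k| * ‖U * Matrix.diagonal (fun i => fourier 1 (x i)) -
        Matrix.diagonal (fun i => fourier 1 (x i)) * U‖ := by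
  set e : ℤ → Matrix ι ι ℂ := fun k => Matrix.diagonal fun i => fourier k (x i) with he
  have hmul : ∀ k l, e (k + l) = e k * e l := fun k l => by
    simp only [he, Matrix.diagonal_mul_diagonal, fourier_add]
  have he0 : e 0 = 1 := by simp [he]
  have hn : ∀ k, ‖e k‖ ≤ 1 := fun k => norm_diagonal_le zero_le_one fun i => by
    rw [fourier_apply, Circle.norm_coe]
  set c := ‖U * e 1 - e 1 * U‖ with hc
  have hneg : ‖U * e (-1) - e (-1) * U‖ ≤ c := by
    have h1 : e (-1) * e 1 = 1 := by rw [← hmul, neg_add_cancel, he0]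
    have h2 : e 1 * e (-1) = 1 := by rw [← hmul, add_neg_cancel, he0]
    have : U * e (-1) - e (-1) * U = -(e (-1) * (U * e 1 - e 1 * U) * e (-1)) := by
      have a1 : e (-1) * (U * e 1) * e (-1) = e (-1) * U * (e 1 * e (-1)) := by
        simp only [mul_assoc]
      have a2 : e (-1) * (e 1 * U) * e (-1) = (e (-1) * e 1) * U * e (-1) := by
        simp only [mul_assoc]
      rw [mul_sub, sub_mul, a1, a2, h1, h2, mul_one, one_mul, neg_sub]
    rw [this, norm_neg]
    exact (norm_mul_le_right_of_le_one (hn _)).trans (norm_mul_le_left_of_le_one (hn _))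
  have hstep : ∀ k l, ‖U * e l - e l * U‖ ≤ c →
      ‖U * e (k + l) - e (k + l) * U‖ ≤ ‖U * e k - e k * U‖ + c := fun k l hl => by
    have : U * e (k + l) - e (k + l) * U =
        (U * e k - e k * U) * e l + e k * (U * e l - e l * U) := by
      rw [hmul]; noncomm_ring
    rw [this]
    exact (norm_add_le _ _).trans (add_le_add (norm_mul_le_right_of_le_one (hn _))
      ((norm_mul_le_left_of_le_one (hn _)).trans hl))
  change ‖U * e k - e k * U‖ ≤ |k| * c
  have hnat : ∀ m : ℕ, ‖U * e m - e m * U‖ ≤ m * c ∧ ‖U * e (-m) - e (-m) * U‖ ≤ m * c := by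
    intro m
    induction m with
    | zero => simp [he0]
    | succ m ih =>
      push_cast
      rw [neg_add]
      exact ⟨(hstep m 1 le_rfl).trans (by linarith [ih.1]),
        (hstep (-m) (-1) hneg).trans (by linarith [ih.2])⟩
  obtain ⟨m, rfl | rfl⟩ := k.eq_nat_or_neg
  · simpa using (hnat m).1
  · simpa using (hnat m).2

theorem exists_commutator_bound {T : ℝ} [Fact (0 < T)] (F : C(AddCircle T, ℂ)) {η : ℝ}
    (hη : 0 < η) : ∃ δ > 0, ∀ (ι : Type) [Fintype ι] [DecidableEq ι],
      ∀ U ∈ unitary (Matrix ι ι ℂ), ∀ x : ι → AddCircle T,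
        ‖U * Matrix.diagonal (fun i => fourier 1 (x i)) -
          Matrix.diagonal (fun i => fourier 1 (x i)) * U‖ ≤ δ →
        ‖U * Matrix.diagonal (fun i => F (x i)) - Matrix.diagonal (fun i => F (x i)) * U‖ ≤ η := by
  have key : ∀ G ∈ Submodule.span ℂ (Set.range (fourier (T := T))), ∃ K : ℝ, 0 ≤ K ∧
      ∀ (ι : Type) [Fintype ι] [DecidableEq ι] (U : Matrix ι ι ℂ) (x : ι → AddCircle T),
        ‖U * Matrix.diagonal (fun i => G (x i)) - Matrix.diagonal (fun i => G (x i)) * U‖ ≤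
          K * ‖U * Matrix.diagonal (fun i => fourier 1 (x i)) -
            Matrix.diagonal (fun i => fourier 1 (x i)) * U‖ := by
    intro G hG
    induction hG using Submodule.span_induction with
    | mem G hG =>
      obtain ⟨k, rfl⟩ := hG
      exact ⟨|(k : ℝ)|, abs_nonneg _, fun ι _ _ U x => by
        simpa using norm_commutator_fourier_le U x k⟩
    | zero => exact ⟨0, le_rfl, fun ι _ _ U x => by simp⟩
    | add G H _ _ hG hH =>
      obtain ⟨K, hK, hG⟩ := hG
      obtain ⟨L, hL, hH⟩ := hH
      refine ⟨K + L, add_nonneg hK hL, fun ι _ _ U x => ?_⟩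
      have : Matrix.diagonal (fun i => (G + H) (x i)) =
          Matrix.diagonal (fun i => G (x i)) + Matrix.diagonal (fun i => H (x i)) := by
        rw [Matrix.diagonal_add]; rfl
      rw [this, mul_add, add_mul, add_sub_add_comm, add_mul K L]
      exact (norm_add_le _ _).trans (add_le_add (hG ι U x) (hH ι U x))
    | smul a G _ hG =>
      obtain ⟨K, hK, hG⟩ := hG
      refine ⟨‖a‖ * K, by positivity, fun ι _ _ U x => ?_⟩
      have : Matrix.diagonal (fun i => (a • G) (x i)) = a • Matrix.diagonal (fun i => G (x i)) := by
        rw [← Matrix.diagonal_smul]; rfl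
      rw [this, Matrix.mul_smul, Matrix.smul_mul, ← smul_sub, norm_smul, mul_assoc]
      exact mul_le_mul_of_nonneg_left (hG ι U x) (norm_nonneg _)
  have hF : F ∈ (Submodule.span ℂ (Set.range (fourier (T := T)))).topologicalClosure := by
    rw [span_fourier_closure_eq_top]; trivial
  rw [← SetLike.mem_coe, Submodule.topologicalClosure_coe, Metric.mem_closure_iff] at hF
  obtain ⟨G, hG, hFG⟩ := hF (η / 4) (by positivity)
  obtain ⟨K, hK, hKG⟩ := key G hG
  refine ⟨η / (2 * (K + 1)), by positivity, fun ι _ _ U hU x hδ => ?_⟩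
  set dF := Matrix.diagonal (fun i => F (x i))
  set dG := Matrix.diagonal (fun i => G (x i))
  have hd : ‖dF - dG‖ ≤ η / 4 := by
    rw [Matrix.diagonal_sub]
    refine norm_diagonal_le (by positivity) fun i => ?_
    rw [← dist_eq_norm]
    exact (ContinuousMap.dist_apply_le_dist _).trans hFG.le
  have e : U * dF - dF * U = U * (dF - dG) + (U * dG - dG * U) - (dF - dG) * U := by noncomm_ring
  have h2 : ‖U * dG - dG * U‖ ≤ η / 2 := (hKG ι U x).trans (by
    calc _ ≤ K * (η / (2 * (K + 1))) := mul_le_mul_of_nonneg_left hδ hK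
      _ = η / 2 * (K / (K + 1)) := by field_simp
      _ ≤ η / 2 * 1 := by gcongr; rw [div_le_one] <;> linarith
      _ = _ := mul_one _)
  rw [e]
  refine (norm_sub_le _ _).trans ((add_le_add_left (norm_add_le _ _) _).trans ?_)
  rw [norm_unitary_mul hU, norm_mul_unitary hU]
  linarith

/-- The position of `x` relative to the grid point `j`, on a circle of circumference `N`. -/
def cellPos {N : ℕ} (x : ℝ) (j : ZMod N) : ℝ := (((⌊x⌋ : ℤ) : ZMod N) - j).val + Int.fract x

theorem coe_cellPos {N : ℕ} [NeZero N] (x : ℝ) (j : ZMod N) :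
    ((cellPos x j : ℝ) : AddCircle (N : ℝ)) = ((x - j.val : ℝ) : AddCircle (N : ℝ)) := by
  rw [← sub_eq_zero, ← AddCircle.coe_sub, AddCircle.coe_eq_zero_iff]
  have h1 : (((⌊x⌋ : ℤ) : ZMod N) - j) = ((⌊x⌋ - (j.val : ℤ) : ℤ) : ZMod N) := by
    push_cast
    rw [ZMod.natCast_zmod_val]
  have h2 : (((((⌊x⌋ : ℤ) : ZMod N) - j).val : ℕ) : ℤ) = (⌊x⌋ - (j.val : ℤ)) % N := by
    rw [h1, ZMod.val_intCast]
  have h3 : (((((⌊x⌋ : ℤ) : ZMod N) - j).val : ℕ) : ℝ) =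
      ⌊x⌋ - j.val - N * (((⌊x⌋ - (j.val : ℤ)) / (N : ℤ) : ℤ) : ℝ) := by
    have := Int.emod_add_mul_ediv (⌊x⌋ - (j.val : ℤ)) N
    rw [← h2] at this
    have h4 := congrArg (Int.cast : ℤ → ℝ) this
    push_cast at h4
    linarith
  refine ⟨-((⌊x⌋ - (j.val : ℤ)) / (N : ℤ)), ?_⟩
  rw [cellPos, h3, zsmul_eq_mul]
  have := Int.floor_add_fract x
  push_cast
  linarith

theorem cellPos_mem {N : ℕ} [NeZero N] (x : ℝ) (j : ZMod N) :
    cellPos x j ∈ Set.Ico (0 : ℝ) N := by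
  have h1 : ((((⌊x⌋ : ℤ) : ZMod N) - j).val : ℝ) + 1 ≤ N := by
    exact_mod_cast ZMod.val_lt (((⌊x⌋ : ℤ) : ZMod N) - j)
  have h2 := Int.fract_lt_one x
  have h3 := Int.fract_nonneg x
  unfold cellPos
  constructor
  · positivity
  · linarith

theorem exists_profile_bound {N : ℕ} [NeZero N] {G : ℝ → ℝ} (hG : Continuous G)
    (h0 : G 0 = G N) {η : ℝ} (hη : 0 < η) : ∃ δ > 0, ∀ (ι : Type) [Fintype ι] [DecidableEq ι],
      ∀ U ∈ unitary (Matrix ι ι ℂ), ∀ x : ι → ℝ,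
        ‖U * Matrix.diagonal (fun i => Complex.exp ((2 * Real.pi / N * x i : ℝ) * Complex.I)) -
          Matrix.diagonal (fun i => Complex.exp ((2 * Real.pi / N * x i : ℝ) * Complex.I)) * U‖ ≤
          δ → ∀ j : ZMod N,
        ‖U * Matrix.diagonal (fun i => (G (cellPos (x i) j) : ℂ)) -
          Matrix.diagonal (fun i => (G (cellPos (x i) j) : ℂ)) * U‖ ≤ η := by
  have hN : (0 : ℝ) < N := by exact_mod_cast NeZero.pos N
  have : Fact ((0 : ℝ) < N) := ⟨hN⟩
  let F : C(AddCircle (N : ℝ), ℂ) := ⟨AddCircle.liftIco (N : ℝ) 0 fun y => (G y : ℂ),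
    AddCircle.liftIco_zero_continuous (by rw [h0]) (by fun_prop)⟩
  obtain ⟨δ, hδ, h⟩ := exists_commutator_bound F hη
  refine ⟨δ, hδ, fun ι _ _ U hU x hx j => ?_⟩
  have := h ι U hU (fun i => ((x i - j.val : ℝ) : AddCircle (N : ℝ))) (by
    have e : (Matrix.diagonal fun i => fourier 1 ((x i - j.val : ℝ) : AddCircle (N : ℝ))) =
        Complex.exp ((-(2 * Real.pi / N * j.val) : ℝ) * Complex.I) • Matrix.diagonal (fun i =>
          Complex.exp ((2 * Real.pi / N * x i : ℝ) * Complex.I)) := by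
      rw [← Matrix.diagonal_smul]
      congr 1; funext i
      rw [fourier_coe_apply, Pi.smul_apply, smul_eq_mul, ← Complex.exp_add]
      congr 1
      push_cast
      ring
    rw [e, Matrix.mul_smul, Matrix.smul_mul, ← smul_sub, norm_smul, Complex.norm_exp_ofReal_mul_I,
      one_mul]
    exact hx)
  have hFG : ∀ i, F ((x i - j.val : ℝ) : AddCircle (N : ℝ)) = (G (cellPos (x i) j) : ℂ) :=
    fun i => by
      rw [← coe_cellPos]
      exact AddCircle.liftIco_zero_coe_apply (f := fun y => (G y : ℂ)) (cellPos_mem (x i) j)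
  simpa only [hFG] using this

end CircleFunctions

section FibreRotation

variable {J : Type*} [DecidableEq J]

/-- The real reflection of `ℂ^(Option J)` that mixes `none` with `some p`, with weight `r`. -/
def rot (p : J) (r : ℝ) : Matrix (Option J) (Option J) ℂ := Matrix.of fun k l =>
  match k, l with
  | none, none => (√r : ℂ)
  | none, some j => if j = p then (√(1 - r) : ℂ) else 0
  | some j, none => if j = p then (√(1 - r) : ℂ) else 0
  | some j, some l => if j = l then (if j = p then -(√r : ℂ) else 1) else 0

theorem star_rot (p : J) (r : ℝ) : star (rot p r) = rot p r := by
  ext k l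
  rw [Matrix.star_apply]
  rcases k with _ | k <;> rcases l with _ | l <;> simp only [rot, Matrix.of_apply]
  · simp
  · split_ifs <;> simp
  · split_ifs <;> simp
  · by_cases h : k = l
    · subst h
      split_ifs <;> simp
    · simp [h, Ne.symm h]

variable [Fintype J]

theorem rot_mul_diagonal_mul_rot {p : J} {r : ℝ} (h0 : 0 ≤ r) (h1 : r ≤ 1) (μ : Option J → ℂ)
    (k l : Option J) : (rot p r * Matrix.diagonal μ * rot p r) k l =
      match k, l with
      | none, none => r * μ none + (1 - r) * μ (some p)
      | none, some j => if j = p then (√r * √(1 - r)) * (μ none - μ (some p)) else 0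
      | some j, none => if j = p then (√r * √(1 - r)) * (μ none - μ (some p)) else 0
      | some j, some l => if j = l then
          (if j = p then (1 - r) * μ none + r * μ (some p) else μ (some j)) else 0 := by
  have e1 : (√r : ℂ) * √r = r := by exact_mod_cast Real.mul_self_sqrt h0
  have e2 : (√(1 - r) : ℂ) * √(1 - r) = 1 - r := by
    exact_mod_cast Real.mul_self_sqrt (sub_nonneg.2 h1)
  rw [Matrix.mul_apply, Fintype.sum_option]
  simp only [Matrix.mul_diagonal]
  rcases k with _ | k <;> rcases l with _ | l <;>
    simp only [rot, Matrix.of_apply, mul_ite, ite_mul, mul_zero, zero_mul,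
      Finset.sum_ite_eq', Finset.mem_univ, if_true]
  · linear_combination μ none * e1 + μ (some p) * e2
  · split_ifs with h
    · subst h; ring
    · ring
  · split_ifs with h
    · subst h; ring
    · ring
  · by_cases h : k = l
    · subst h
      by_cases hk : k = p
      · subst hk
        simp
        linear_combination μ none * e2 + μ (some k) * e1
      · simp [hk]
    · by_cases hk : k = p
      · subst hk
        simp [h, Ne.symm h]
      · simp [h, hk]

theorem rot_mul_rot {p : J} {r : ℝ} (h0 : 0 ≤ r) (h1 : r ≤ 1) : rot p r * rot p r = 1 := by
  have := rot_mul_diagonal_mul_rot (p := p) h0 h1 (fun _ => 1)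
  ext k l
  have h := this k l
  rw [Matrix.diagonal_one, mul_one] at h
  rw [h]
  rcases k with _ | k <;> rcases l with _ | l <;> simp [Matrix.one_apply]

end FibreRotation

theorem norm_blkHom_mul_fibHom_sub_le {κ ι : Type*} [Fintype κ] [DecidableEq κ] [Fintype ι]
    [DecidableEq ι] (M : κ → Matrix ι ι ℂ) (P Q : ι → Matrix κ κ ℂ) :
    ‖blkHom M * fibHom Q - fibHom P * blkHom M‖ ≤
      ∑ k, ∑ l, ‖M k * Matrix.diagonal (fun i => Q i k l) -
        Matrix.diagonal (fun i => P i k l) * M l‖ := by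
  refine norm_le_sum_blocks _ (fun k l => M k * Matrix.diagonal (fun i => Q i k l) -
        Matrix.diagonal (fun i => P i k l) * M l) fun k l i j => ?_
  rw [Matrix.sub_apply, Matrix.sub_apply, Matrix.mul_diagonal, Matrix.diagonal_mul,
    Matrix.mul_apply, Matrix.mul_apply, Fintype.sum_prod_type, Fintype.sum_prod_type]
  simp [blkHom_apply, fibHom_apply]

theorem fibHom_diagonal {κ ι : Type*} [Fintype κ] [DecidableEq κ] [Fintype ι]
    [DecidableEq ι] (μ : κ × ι → ℂ) :
    fibHom (fun i => Matrix.diagonal fun k => μ (k, i)) = Matrix.diagonal μ := by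
  ext ⟨k, i⟩ ⟨l, j⟩
  rw [fibHom_apply, Matrix.diagonal_apply, Matrix.diagonal_apply]
  simp only [Prod.mk.injEq]
  split_ifs <;> simp_all

theorem blkHom_diagonal {κ ι : Type*} [Fintype κ] [DecidableEq κ] [Fintype ι]
    [DecidableEq ι] (μ : κ × ι → ℂ) :
    blkHom (fun k => Matrix.diagonal fun i => μ (k, i)) = Matrix.diagonal μ := by
  ext ⟨k, i⟩ ⟨l, j⟩
  rw [blkHom_apply, Matrix.diagonal_apply, Matrix.diagonal_apply]
  simp only [Prod.mk.injEq]
  split_ifs <;> simp_all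

theorem norm_pow_sub_pow_le {ι : Type*} [Fintype ι] [DecidableEq ι] {A B : Matrix ι ι ℂ}
    (hA : ‖A‖ ≤ 1) (hB : ‖B‖ ≤ 1) (k : ℕ) : ‖A ^ k - B ^ k‖ ≤ k * ‖A - B‖ := by
  have hp : ∀ k, ‖A ^ k‖ ≤ 1 := fun k => by
    induction k with
    | zero => rw [pow_zero]; exact norm_one_matrix_le
    | succ k ih => rw [pow_succ]; exact (norm_mul_le_left_of_le_one ih).trans hA
  induction k with
  | zero => simp
  | succ k ih =>
    have : A ^ (k + 1) - B ^ (k + 1) = A ^ k * (A - B) + (A ^ k - B ^ k) * B := by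
      rw [pow_succ, pow_succ]; noncomm_ring
    rw [this]
    refine (norm_add_le _ _).trans ?_
    have h1 := norm_mul_le_left_of_le_one (B := A - B) (hp k)
    have h2 := norm_mul_le_right_of_le_one (A := A ^ k - B ^ k) hB
    push_cast
    linarith

section Cells

variable {N : ℕ}

/-- The cell of the circle of circumference `N` that contains `x`. -/
def cell (N : ℕ) (x : ℝ) : ZMod N := ((⌊x⌋ : ℤ) : ZMod N)

/-- The piecewise linear function that equals `Int.fract x` on the cell `j`, `1` on the next cell
and `0` on all others. -/
def step (x : ℝ) (j : ZMod N) : ℝ :=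
  if cell N x = j then Int.fract x else if cell N x = j + 1 then 1 else 0

theorem abs_step_le (x : ℝ) (j : ZMod N) : |step x j| ≤ 1 := by
  unfold step
  split_ifs
  · rw [abs_of_nonneg (Int.fract_nonneg x)]; exact (Int.fract_lt_one x).le
  · simp
  · simp

/-- A continuous trapezoid agreeing with `step` except on the second cell after `j`. -/
def trapezoid (y : ℝ) : ℝ := max 0 (min 1 (min y (3 - y)))

/-- The overlap profile `√(y(1 - y))`, supported on the unit interval. -/
def hump (y : ℝ) : ℝ := √(y * (1 - y))

/-- The tent function supported on `[0, 2]`. -/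
def tent (y : ℝ) : ℝ := max 0 (min y (2 - y))

theorem add_natCast_ne {a b : ℕ} (hab : a < b) (hb : b < N) (j : ZMod N) :
    j + (a : ZMod N) ≠ j + (b : ZMod N) := by
  intro h
  have h1 := add_left_cancel h
  have := congrArg ZMod.val h1
  rw [ZMod.val_natCast_of_lt (hab.trans hb), ZMod.val_natCast_of_lt hb] at this
  omega

theorem cellPos_cases [NeZero N] (hN : 4 ≤ N) (x : ℝ) (j : ZMod N) :
    (cell N x = j ∧ cellPos x j = Int.fract x) ∨
    (cell N x = j + 1 ∧ cellPos x j = 1 + Int.fract x) ∨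
    (cell N x = j + 2 ∧ cellPos x j = 2 + Int.fract x) ∨
    (cell N x ≠ j ∧ cell N x ≠ j + 1 ∧ cell N x ≠ j + 2 ∧ 3 ≤ cellPos x j) := by
  have hv : ∀ m : ℕ, m < N → ((cell N x - j).val = m ↔ cell N x = j + (m : ZMod N)) := fun m hm => by
    rw [← sub_eq_iff_eq_add']
    constructor
    · intro h
      rw [← h, ZMod.natCast_zmod_val]
    · intro h
      rw [h, ZMod.val_natCast_of_lt hm]
  have h0 := hv 0 (by omega)
  have h1 := hv 1 (by omega)
  have h2 := hv 2 (by omega)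
  push_cast at h0 h1 h2
  rw [add_zero] at h0
  have hpos : cellPos x j = (cell N x - j).val + Int.fract x := rfl
  by_cases c0 : (cell N x - j).val = 0
  · left; refine ⟨h0.1 c0, ?_⟩; rw [hpos, c0]; simp
  by_cases c1 : (cell N x - j).val = 1
  · right; left; refine ⟨h1.1 c1, ?_⟩; rw [hpos, c1]; simp
  by_cases c2 : (cell N x - j).val = 2
  · right; right; left; refine ⟨h2.1 c2, ?_⟩; rw [hpos, c2]; simp
  · right; right; right
    refine ⟨fun h => c0 (h0.2 h), fun h => c1 (h1.2 h), fun h => c2 (h2.2 h), ?_⟩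
    rw [hpos]
    have : (3 : ℝ) ≤ (cell N x - j).val := by
      have : 3 ≤ (cell N x - j).val := by omega
      exact_mod_cast this
    linarith [Int.fract_nonneg x]

theorem add_one_ne [NeZero N] (hN : 4 ≤ N) (j : ZMod N) : j + 1 ≠ j := by
  have := add_natCast_ne (a := 0) (b := 1) (by omega) (by omega : 1 < N) j
  simpa using this

theorem add_two_ne [NeZero N] (hN : 4 ≤ N) (j : ZMod N) : j + 2 ≠ j := by
  have := add_natCast_ne (a := 0) (b := 2) (by omega) (by omega : 2 < N) j
  simpa [eq_comm] using this

theorem add_two_ne_add_one [NeZero N] (hN : 4 ≤ N) (j : ZMod N) : j + 2 ≠ j + 1 := by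
  have := add_natCast_ne (a := 1) (b := 2) (by omega) (by omega : 2 < N) j
  push_cast at this
  exact this.symm

theorem add_three_ne [NeZero N] (hN : 4 ≤ N) (j : ZMod N) : j + 1 + 2 ≠ j := by
  have := add_natCast_ne (a := 0) (b := 3) (by omega) (by omega : 3 < N) j
  intro h
  apply this
  push_cast
  rw [add_zero]
  conv_lhs => rw [← h]
  ring

theorem hump_cellPos [NeZero N] (hN : 4 ≤ N) (x : ℝ) (j : ZMod N) : hump (cellPos x j) =
    if cell N x = j then √(Int.fract x) * √(1 - Int.fract x) else 0 := by
  have r0 := Int.fract_nonneg x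
  have r1 := Int.fract_lt_one x
  rcases cellPos_cases hN x j with ⟨h, e⟩ | ⟨h, e⟩ | ⟨h, e⟩ | ⟨h, -, -, e⟩
  · rw [if_pos h, e, hump, Real.sqrt_mul r0]
  · rw [if_neg (by rw [h]; exact add_one_ne hN j), e, hump, Real.sqrt_eq_zero']; nlinarith
  · rw [if_neg (by rw [h]; exact add_two_ne hN j), e, hump, Real.sqrt_eq_zero']; nlinarith
  · rw [if_neg h, hump, Real.sqrt_eq_zero']; nlinarith

theorem tent_cellPos [NeZero N] (hN : 4 ≤ N) (x : ℝ) (j : ZMod N) : tent (cellPos x j) =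
    if cell N x = j then Int.fract x else if cell N x = j + 1 then 1 - Int.fract x else 0 := by
  have r0 := Int.fract_nonneg x
  have r1 := Int.fract_lt_one x
  rcases cellPos_cases hN x j with ⟨h, e⟩ | ⟨h, e⟩ | ⟨h, e⟩ | ⟨h, h', -, e⟩
  · rw [if_pos h, e, tent, min_eq_left (by linarith), max_eq_right r0]
  · rw [if_neg (by rw [h]; exact add_one_ne hN j), if_pos h, e, tent,
      min_eq_right (by linarith), max_eq_right (by linarith)]; ring
  · rw [if_neg (by rw [h]; exact add_two_ne hN j),
      if_neg (by rw [h]; exact add_two_ne_add_one hN j), e, tent, min_eq_right (by linarith),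
      max_eq_left (by linarith)]
  · rw [if_neg h, if_neg h', tent, min_eq_right (by linarith), max_eq_left (by linarith)]

theorem trapezoid_cellPos [NeZero N] (hN : 4 ≤ N) (x : ℝ) (j : ZMod N) :
    trapezoid (cellPos x j) =
      if cell N x = j + 2 then 1 - Int.fract x else step x j := by
  have r0 := Int.fract_nonneg x
  have r1 := Int.fract_lt_one x
  rcases cellPos_cases hN x j with ⟨h, e⟩ | ⟨h, e⟩ | ⟨h, e⟩ | ⟨h, h', h'', e⟩
  · rw [if_neg (by rw [h]; exact (add_two_ne hN j).symm), step, if_pos h, e, trapezoid,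
      min_eq_left (a := Int.fract x) (by linarith), min_eq_right (by linarith), max_eq_right r0]
  · rw [if_neg (by rw [h]; exact (add_two_ne_add_one hN j).symm), step,
      if_neg (by rw [h]; exact add_one_ne hN j), if_pos h, e, trapezoid,
      min_eq_left (by rw [le_min_iff]; constructor <;> linarith), max_eq_right (by linarith)]
  · rw [if_pos h, e, trapezoid, min_eq_right (a := 2 + Int.fract x) (by linarith),
      min_eq_right (by linarith), max_eq_right (by linarith)]; ring
  · rw [if_neg h'', step, if_neg h, if_neg h', trapezoid, max_eq_left]
    exact (min_le_right _ _).trans ((min_le_right _ _).trans (by linarith))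

theorem trapezoid_cellPos_add_one_of_cell_eq [NeZero N] (hN : 4 ≤ N) {x : ℝ} {j : ZMod N}
    (h : cell N x = j) : trapezoid (cellPos x (j + 1)) = 0 := by
  rw [trapezoid_cellPos hN, if_neg (by rw [h]; exact (add_three_ne hN j).symm), step,
    if_neg (by rw [h]; exact (add_one_ne hN j).symm),
    if_neg (by rw [h, add_assoc, one_add_one_eq_two]; exact (add_two_ne hN j).symm)]

theorem trapezoid_cellPos_add_one_of_cell_eq_add_two [NeZero N] (hN : 4 ≤ N) {x : ℝ} {j : ZMod N}
    (h : cell N x = j + 2) : trapezoid (cellPos x (j + 1)) = 1 := by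
  have h' : cell N x = j + 1 + 1 := by rw [h, add_assoc, one_add_one_eq_two]
  rw [trapezoid_cellPos hN, if_neg (by rw [h']; exact (add_two_ne_add_one hN (j + 1)).symm), step,
    if_neg (by rw [h']; exact add_one_ne hN _), if_pos h']

theorem sum_tent [NeZero N] (hN : 4 ≤ N) (x : ℝ) (lam : ZMod N → ℂ) :
    ∑ j, lam j * (tent (cellPos x j) : ℂ) =
      Int.fract x * lam (cell N x) + (1 - Int.fract x) * lam (cell N x - 1) := by
  have : ∀ j, lam j * (tent (cellPos x j) : ℂ) =
      (if j = cell N x then Int.fract x * lam (cell N x) else 0) +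
      (if j = cell N x - 1 then (1 - Int.fract x) * lam (cell N x - 1) else 0) := fun j => by
    rw [tent_cellPos hN]
    by_cases h : cell N x = j
    · have h' : j ≠ cell N x - 1 := by
        rw [← h, Ne, eq_sub_iff_add_eq]; exact add_one_ne hN _
      rw [if_pos h, if_pos h.symm, if_neg h', h]; ring
    · rw [if_neg h, if_neg (Ne.symm h)]
      by_cases h' : cell N x = j + 1
      · rw [if_pos h', if_pos (eq_sub_of_add_eq h'.symm), h']
        push_cast
        rw [add_sub_cancel_right]
        ring
      · rw [if_neg h', if_neg fun e => h' (eq_sub_iff_add_eq.1 e).symm]; simp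
  simp only [this, Finset.sum_add_distrib, Finset.sum_ite_eq', Finset.mem_univ, if_true]

theorem trapezoid_zero_eq (hN : 4 ≤ N) : trapezoid 0 = trapezoid N := by
  have : (4 : ℝ) ≤ N := by exact_mod_cast hN
  rw [trapezoid, trapezoid, max_eq_left, max_eq_left]
  · exact (min_le_right _ _).trans ((min_le_right _ _).trans (by linarith))
  · exact (min_le_right _ _).trans (min_le_left _ _)

theorem hump_zero_eq (hN : 4 ≤ N) : hump 0 = hump N := by
  have : (4 : ℝ) ≤ N := by exact_mod_cast hN
  rw [hump, hump, zero_mul, Real.sqrt_zero, eq_comm, Real.sqrt_eq_zero']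
  nlinarith

theorem tent_zero_eq (hN : 4 ≤ N) : tent 0 = tent N := by
  have : (4 : ℝ) ≤ N := by exact_mod_cast hN
  rw [tent, tent, max_eq_left (min_le_left _ _), max_eq_left]
  exact (min_le_right _ _).trans (by linarith)

/-- The eigenvalue label of each fibre direction, for a point in the cell `p`. -/
def label (p : ZMod N) (f : ZMod N → ℝ) : Option (ZMod N) → ZMod N
  | none => p
  | some j => if j = p then j - 1 else if f j = 1 then j - 1 else j

/-- The fibre of the block matrix with eigenvalues `lam` of the labels. -/
def fibre [NeZero N] (x : ℝ) (f : ZMod N → ℝ) (lam : ZMod N → ℂ) :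
    Matrix (Option (ZMod N)) (Option (ZMod N)) ℂ :=
  rot (cell N x) (Int.fract x) * Matrix.diagonal (fun k => lam (label (cell N x) f k)) *
    rot (cell N x) (Int.fract x)

variable [NeZero N] {x : ℝ} {f : ZMod N → ℝ} (lam : ZMod N → ℂ)

theorem fibre_none_none (hN : 4 ≤ N) :
    fibre x f lam none none = ∑ j, lam j * (tent (cellPos x j) : ℂ) := by
  rw [fibre, rot_mul_diagonal_mul_rot (Int.fract_nonneg x) (Int.fract_lt_one x).le, sum_tent hN]
  simp [label]

theorem fibre_none_some (hN : 4 ≤ N) (j : ZMod N) :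
    fibre x f lam none (some j) = (hump (cellPos x j) : ℂ) * (lam j - lam (j - 1)) := by
  rw [fibre, rot_mul_diagonal_mul_rot (Int.fract_nonneg x) (Int.fract_lt_one x).le,
    hump_cellPos hN]
  simp only [label, if_true]
  by_cases h : cell N x = j
  · simp [h]
  · simp [h, Ne.symm h]

theorem fibre_some_none (hN : 4 ≤ N) (j : ZMod N) :
    fibre x f lam (some j) none = (hump (cellPos x j) : ℂ) * (lam j - lam (j - 1)) := by
  rw [← fibre_none_some lam hN, fibre,
    rot_mul_diagonal_mul_rot (Int.fract_nonneg x) (Int.fract_lt_one x).le,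
    rot_mul_diagonal_mul_rot (Int.fract_nonneg x) (Int.fract_lt_one x).le]

theorem fibre_some_some_ne {j l : ZMod N} (h : j ≠ l) :
    fibre x f lam (some j) (some l) = 0 := by
  rw [fibre, rot_mul_diagonal_mul_rot (Int.fract_nonneg x) (Int.fract_lt_one x).le]
  simp [h]

theorem fibre_some_some {j : ZMod N} (hf : cell N x = j → f j = Int.fract x)
    (hf' : cell N x ≠ j → f j = 0 ∨ f j = 1) :
    fibre x f lam (some j) (some j) = lam j - (lam j - lam (j - 1)) * (f j : ℂ) := by
  rw [fibre, rot_mul_diagonal_mul_rot (Int.fract_nonneg x) (Int.fract_lt_one x).le]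
  simp only [label, if_true]
  by_cases h : cell N x = j
  · subst h
    simp only [if_true, hf rfl]
    ring
  · rw [if_neg (Ne.symm h), if_neg (Ne.symm h)]
    rcases hf' h with e | e <;> simp [e]

end Cells

section CutStep

variable {N : ℕ} [NeZero N] {ι : Type*} [Fintype ι] [DecidableEq ι]

/-- The diagonal matrix with entries `G (cellPos (x i) j)`. -/
def profile (G : ℝ → ℝ) (x : ι → ℝ) (j : ZMod N) : Matrix ι ι ℂ :=
  Matrix.diagonal fun i => (G (cellPos (x i) j) : ℂ)

/-- The projection onto the points in the cell `j`. -/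
def cellProj (x : ι → ℝ) (j : ZMod N) : Matrix ι ι ℂ :=
  Matrix.diagonal fun i => if cell N (x i) = j then 1 else 0

theorem norm_star_mul_mul_sub_le {U A : Matrix ι ι ℂ} (hU : U ∈ unitary (Matrix ι ι ℂ)) :
    ‖star U * A * U - A‖ = ‖U * A - A * U‖ := by
  have : U * (star U * A * U - A) = -(U * A - A * U) := by
    have : U * (star U * A * U) = (U * star U) * A * U := by simp only [mul_assoc]
    rw [mul_sub, this, (Unitary.mem_iff.1 hU).2, one_mul, neg_sub]
  rw [← norm_unitary_mul hU, this, norm_neg]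

theorem exists_cut_step (hN : 4 ≤ N) {U : Matrix ι ι ℂ} (hU : U ∈ unitary (Matrix ι ι ℂ))
    (x : ι → ℝ) {η : ℝ}
    (ht : ∀ j : ZMod N, ‖U * profile trapezoid x j - profile trapezoid x j * U‖ ≤ η)
    (hh : ∀ j : ZMod N, ‖U * profile hump x j - profile hump x j * U‖ ≤ η) (j : ZMod N) :
    ∃ (g : ι → ℝ) (Z : Matrix ι ι ℂ), (∀ i, cell N (x i) = j → g i = step (x i) j) ∧
      (∀ i, cell N (x i) ≠ j → g i = 0 ∨ g i = 1) ∧ Z ∈ unitary (Matrix ι ι ℂ) ∧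
      cellProj x j * Z = cellProj x j ∧ Z * cellProj x j = cellProj x j ∧
      ‖Z * Matrix.diagonal (fun i => (g i : ℂ)) * star Z -
        star U * Matrix.diagonal (fun i => (step (x i) j : ℂ)) * U‖ ≤ 12 * η ∧
      (∑ i, g i = ∑ i, step (x i) j → g = fun i => step (x i) j) := by
  have hUs : star U ∈ unitary (Matrix ι ι ℂ) := Unitary.star_mem hU
  set E : Matrix ι ι ℂ := cellProj x j with hE
  set T : Matrix ι ι ℂ := Matrix.diagonal (fun i => (step (x i) j : ℂ)) with hT
  set H := profile trapezoid x j with hH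
  set χ := profile trapezoid x (j + 1) with hχ
  set Y := profile hump x j with hY
  have hEn : ‖E‖ ≤ 1 := norm_diagonal_le zero_le_one fun i => by split_ifs <;> simp
  have hYn : ‖Y‖ ≤ 1 := norm_diagonal_le zero_le_one fun i => by
    rw [Complex.norm_real, Real.norm_eq_abs, hump_cellPos hN]
    have h0 := Real.sqrt_nonneg (Int.fract (x i))
    have h1 := Real.sqrt_nonneg (1 - Int.fract (x i))
    have h2 : √(Int.fract (x i)) ≤ 1 := Real.sqrt_le_one.2 (Int.fract_lt_one _).le
    have h3 : √(1 - Int.fract (x i)) ≤ 1 :=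
      Real.sqrt_le_one.2 (by linarith [Int.fract_nonneg (x i)])
    split_ifs
    · rw [abs_of_nonneg (mul_nonneg h0 h1)]
      exact mul_le_one₀ h2 h1 h3
    · simp
  have hDn : ‖T - H‖ ≤ 1 := by
    rw [hT, hH, profile, Matrix.diagonal_sub]
    refine norm_diagonal_le zero_le_one fun i => ?_
    rw [← Complex.ofReal_sub, Complex.norm_real, Real.norm_eq_abs, trapezoid_cellPos hN]
    split_ifs with h
    · rw [step, if_neg (by rw [h]; exact add_two_ne hN j),
        if_neg (by rw [h]; exact add_two_ne_add_one hN j), zero_sub, abs_neg,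
        abs_of_nonneg (by linarith [Int.fract_lt_one (x i)])]
      linarith [Int.fract_nonneg (x i)]
    · simp
  have hχD : χ * (T - H) = T - H := by
    rw [hT, hH, hχ, profile, profile, Matrix.diagonal_sub, Matrix.diagonal_mul_diagonal]
    congr 1
    funext i
    by_cases h : cell N (x i) = j + 2
    · rw [trapezoid_cellPos_add_one_of_cell_eq_add_two hN h]; simp
    · rw [trapezoid_cellPos hN (x i) j, if_neg h]; simp
  have hEχ : E * χ = 0 := by
    rw [hE, hχ, profile, cellProj, Matrix.diagonal_mul_diagonal, ← Matrix.diagonal_zero]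
    congr 1
    funext i
    by_cases h : cell N (x i) = j
    · rw [trapezoid_cellPos_add_one_of_cell_eq hN h]; simp
    · simp [h]
  have hYY : T - T * T = Y * Y := by
    rw [hT, hY, profile, Matrix.diagonal_mul_diagonal, Matrix.diagonal_mul_diagonal,
      Matrix.diagonal_sub]
    congr 1
    funext i
    rw [hump_cellPos hN, step]
    by_cases h : cell N (x i) = j
    · simp only [h, if_true]
      have h0 := Real.mul_self_sqrt (Int.fract_nonneg (x i))
      have h1 := Real.mul_self_sqrt (sub_nonneg.2 (Int.fract_lt_one (x i)).le)
      norm_cast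
      calc _ = Int.fract (x i) * (1 - Int.fract (x i)) := by ring
        _ = (√(Int.fract (x i)) * √(Int.fract (x i))) *
            (√(1 - Int.fract (x i)) * √(1 - Int.fract (x i))) := by rw [h0, h1]
        _ = _ := by ring
    · simp only [h, if_false]
      split_ifs <;> simp
  have b1 : ‖E * (star U * T * U) - E * T‖ ≤ 2 * η := by
    have e : E * (star U * T * U) - E * T =
        E * (star U * H * U - H) + E * ((star U * χ * U - χ) * (star U * (T - H) * U)) := by
      have a1 : (star U * χ * U) * (star U * (T - H) * U) = star U * (T - H) * U := by
        calc (star U * χ * U) * (star U * (T - H) * U)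
            = star U * χ * (U * star U) * (T - H) * U := by simp only [mul_assoc]
          _ = star U * (χ * (T - H)) * U := by
            rw [(Unitary.mem_iff.1 hU).2, mul_one, mul_assoc (star U) χ]
          _ = _ := by rw [hχD]
      have a2 : E * (χ * (star U * (T - H) * U)) = 0 := by rw [← mul_assoc, hEχ, zero_mul]
      have a3 : E * (T - H) = 0 := by rw [← hχD, ← mul_assoc, hEχ, zero_mul]
      have a4 : E * T = E * H := by rw [← sub_eq_zero, ← mul_sub, a3]
      rw [sub_mul, a1, mul_sub E _ (χ * _), a2, a4]
      noncomm_ring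
    rw [e]
    refine (norm_add_le _ _).trans ?_
    have n1 : ‖E * (star U * H * U - H)‖ ≤ η :=
      (norm_mul_le_left_of_le_one hEn).trans ((norm_star_mul_mul_sub_le hU).trans_le (ht j))
    have n2 : ‖E * ((star U * χ * U - χ) * (star U * (T - H) * U))‖ ≤ η := by
      refine (norm_mul_le_left_of_le_one hEn).trans ((norm_mul_le_right_of_le_one ?_).trans
        ((norm_star_mul_mul_sub_le hU).trans_le (ht (j + 1))))
      rw [norm_mul_unitary hU, norm_unitary_mul hUs]
      exact hDn
    linarith
  have b2 : ‖star U * (T - T * T) * U - (T - T * T)‖ ≤ 2 * η := by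
    rw [norm_star_mul_mul_sub_le hU, hYY]
    have e : U * (Y * Y) - Y * Y * U = (U * Y - Y * U) * Y + Y * (U * Y - Y * U) := by
      noncomm_ring
    rw [e]
    refine (norm_add_le _ _).trans ?_
    have n1 := (norm_mul_le_right_of_le_one (A := U * Y - Y * U) hYn).trans (hh j)
    have n2 := (norm_mul_le_left_of_le_one (B := U * Y - Y * U) hYn).trans (hh j)
    linarith
  obtain ⟨g, Z, h1, h2, h3, h4, h5, h6, h7⟩ :=
    exists_cut (fun i => cell N (x i) = j) (f := fun i => step (x i) j)
      (fun i => abs_step_le _ _) (fun i hi => by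
        simp only [step, if_neg hi]; split_ifs <;> simp) hU hE hT b1 b2
  exact ⟨g, Z, h1, h2, h3, h4, h5, h6.trans (by linarith), h7⟩

end CutStep

section BlockEstimate

variable {N : ℕ} [NeZero N] {ι : Type*} [Fintype ι] [DecidableEq ι]

/-- The diagonal blocks `U` and `U * Z j`. -/
def cutBlocks (U : Matrix ι ι ℂ) (Z : ZMod N → Matrix ι ι ℂ) : Option (ZMod N) → Matrix ι ι ℂ
  | none => U
  | some j => U * Z j

theorem norm_sum_smul_commutator_le {κ : Type*} [Fintype κ] {U : Matrix ι ι ℂ}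
    {P : κ → Matrix ι ι ℂ} {c : κ → ℂ} (hc : ∀ j, ‖c j‖ = 1) {η : ℝ}
    (h : ∀ j, ‖U * P j - P j * U‖ ≤ η) :
    ‖U * ∑ j, c j • P j - (∑ j, c j • P j) * U‖ ≤ Fintype.card κ * η := by
  have : U * ∑ j, c j • P j - (∑ j, c j • P j) * U = ∑ j, c j • (U * P j - P j * U) := by
    rw [Finset.mul_sum, Finset.sum_mul, ← Finset.sum_sub_distrib]
    refine Finset.sum_congr rfl fun j _ => ?_
    rw [Matrix.mul_smul, Matrix.smul_mul, smul_sub]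
  rw [this]
  refine (norm_sum_le _ _).trans ((Finset.sum_le_sum (g := fun _ => η) fun j _ => ?_).trans_eq ?_)
  · rw [norm_smul, hc, one_mul]; exact h j
  · rw [Finset.sum_const, Finset.card_univ, nsmul_eq_mul]

theorem norm_cutBlocks_mul_fibre_sub_le (hN : 4 ≤ N) {U : Matrix ι ι ℂ}
    (hU : U ∈ unitary (Matrix ι ι ℂ)) (x : ι → ℝ) {η : ℝ} (hη : 0 ≤ η)
    (hh : ∀ j : ZMod N, ‖U * profile hump x j - profile hump x j * U‖ ≤ η)
    (htent : ∀ j : ZMod N, ‖U * profile tent x j - profile tent x j * U‖ ≤ η)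
    {g : ZMod N → ι → ℝ} {Z : ZMod N → Matrix ι ι ℂ}
    (hg : ∀ j i, cell N (x i) = j → g j i = step (x i) j)
    (hg' : ∀ j i, cell N (x i) ≠ j → g j i = 0 ∨ g j i = 1)
    (hZ : ∀ j, Z j ∈ unitary (Matrix ι ι ℂ))
    (hEZ : ∀ j, cellProj x j * Z j = cellProj x j) (hZE : ∀ j, Z j * cellProj x j = cellProj x j)
    (hcut : ∀ j, ‖Z j * Matrix.diagonal (fun i => (g j i : ℂ)) * star (Z j) -
        star U * Matrix.diagonal (fun i => (step (x i) j : ℂ)) * U‖ ≤ 12 * η)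
    {lam : ZMod N → ℂ} (hlam : ∀ j, ‖lam j‖ = 1) :
    ‖blkHom (cutBlocks U Z) * fibHom (fun i => fibre (x i) (fun j => g j i) lam) -
      fibHom (fun i => fibre (x i) (step (x i)) lam) * blkHom (cutBlocks U Z)‖ ≤
        (N + 1) ^ 2 * ((N + 24) * η) := by
  have hcard : Fintype.card (Option (ZMod N)) = N + 1 := by
    rw [Fintype.card_option, ZMod.card]
  have hsub : ∀ j, ‖lam j - lam (j - 1)‖ ≤ 2 := fun j =>
    (norm_sub_le _ _).trans (by rw [hlam, hlam]; norm_num)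
  have hYE : ∀ j : ZMod N, profile hump x j = profile hump x j * cellProj x j ∧
      profile hump x j = cellProj x j * profile hump x j := fun j => by
    rw [profile, cellProj, Matrix.diagonal_mul_diagonal, Matrix.diagonal_mul_diagonal]
    constructor <;> congr 1 <;> funext i <;> rw [hump_cellPos hN] <;> split_ifs <;> simp
  have hYZ : ∀ j : ZMod N, profile hump x j * Z j = profile hump x j := fun j => by
    rw [(hYE j).1, mul_assoc, hEZ]
  have hZY : ∀ j : ZMod N, Z j * profile hump x j = profile hump x j := fun j => by
    rw [(hYE j).2, ← mul_assoc, hZE]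
  have hN0 : (0 : ℝ) ≤ N := Nat.cast_nonneg N
  have hentry : ∀ k l : Option (ZMod N),
      ‖cutBlocks U Z k * Matrix.diagonal (fun i => fibre (x i) (fun j => g j i) lam k l) -
        Matrix.diagonal (fun i => fibre (x i) (step (x i)) lam k l) * cutBlocks U Z l‖ ≤
        (N + 24) * η := by
    have hhump : ∀ j : ZMod N, (Matrix.diagonal fun i =>
        (hump (cellPos (x i) j) : ℂ) * (lam j - lam (j - 1))) =
          (lam j - lam (j - 1)) • profile hump x j := fun j => by
      rw [profile, ← Matrix.diagonal_smul]
      congr 1; funext i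
      rw [Pi.smul_apply, smul_eq_mul, mul_comm]
    have h2 : ∀ (j : ZMod N), ‖(lam j - lam (j - 1)) • (U * profile hump x j -
        profile hump x j * U)‖ ≤ (N + 24) * η := fun j => by
      rw [norm_smul]
      calc _ ≤ 2 * η := mul_le_mul (hsub j) (hh j) (norm_nonneg _) zero_le_two
        _ ≤ _ := by gcongr; linarith
    rintro (_ | k) (_ | l)
    · have e : (Matrix.diagonal fun i => ∑ j, lam j * (tent (cellPos (x i) j) : ℂ)) =
          ∑ j, lam j • profile tent x j := by
        ext i i'
        rw [Matrix.sum_apply, Matrix.diagonal_apply]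
        simp only [profile, Matrix.smul_apply, Matrix.diagonal_apply, smul_eq_mul]
        split_ifs <;> simp
      simp only [fibre_none_none lam hN, cutBlocks]
      rw [e]
      refine (norm_sum_smul_commutator_le hlam htent).trans ?_
      rw [ZMod.card]
      gcongr
      linarith
    · simp only [fibre_none_some lam hN, cutBlocks]
      rw [hhump]
      have e : U * ((lam l - lam (l - 1)) • profile hump x l) -
          (lam l - lam (l - 1)) • profile hump x l * (U * Z l) =
          ((lam l - lam (l - 1)) • (U * profile hump x l - profile hump x l * U)) * Z l := by
        rw [Matrix.smul_mul (lam l - lam (l - 1)) (_ - _), sub_mul, mul_assoc U, hYZ,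
          Matrix.mul_smul, Matrix.smul_mul, ← smul_sub, mul_assoc]
      rw [e, norm_mul_unitary (hZ l)]
      exact h2 l
    · simp only [fibre_some_none lam hN, cutBlocks]
      rw [hhump, Matrix.mul_smul, Matrix.smul_mul, ← smul_sub, mul_assoc, hZY]
      exact h2 k
    · by_cases hkl : k = l
      · subst hkl
        have e1 : (Matrix.diagonal fun i => fibre (x i) (fun j => g j i) lam (some k) (some k)) =
            lam k • (1 : Matrix ι ι ℂ) -
              (lam k - lam (k - 1)) • Matrix.diagonal (fun i => (g k i : ℂ)) := by
          rw [← Matrix.diagonal_one, ← Matrix.diagonal_smul, ← Matrix.diagonal_smul,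
            Matrix.diagonal_sub]
          congr 1; funext i
          rw [fibre_some_some lam (fun h => (hg k i h).trans (if_pos h)) (hg' k i)]
          simp
        have e2 : (Matrix.diagonal fun i => fibre (x i) (step (x i)) lam (some k) (some k)) =
            lam k • (1 : Matrix ι ι ℂ) -
              (lam k - lam (k - 1)) • Matrix.diagonal (fun i => (step (x i) k : ℂ)) := by
          rw [← Matrix.diagonal_one, ← Matrix.diagonal_smul, ← Matrix.diagonal_smul,
            Matrix.diagonal_sub]
          congr 1; funext i
          rw [fibre_some_some lam (fun h => if_pos h) (fun h => by
            rw [step, if_neg h]; split_ifs <;> simp)]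
          simp
        rw [e1, e2]
        simp only [cutBlocks]
        set G := Matrix.diagonal (fun i => (g k i : ℂ))
        set F := Matrix.diagonal (fun i => (step (x i) k : ℂ))
        have e3 : U * Z k * (lam k • (1 : Matrix ι ι ℂ) - (lam k - lam (k - 1)) • G) -
            (lam k • (1 : Matrix ι ι ℂ) - (lam k - lam (k - 1)) • F) * (U * Z k) =
            -((lam k - lam (k - 1)) • (U * (Z k * G * star (Z k) - star U * F * U) * Z k)) := by
          have a1 : U * (Z k * G * star (Z k)) * Z k = U * Z k * G := by
            calc _ = U * Z k * G * (star (Z k) * Z k) := by simp only [mul_assoc]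
              _ = _ := by rw [(Unitary.mem_iff.1 (hZ k)).1, mul_one]
          have a2 : U * (star U * F * U) * Z k = F * (U * Z k) := by
            calc _ = (U * star U) * F * (U * Z k) := by simp only [mul_assoc]
              _ = _ := by rw [(Unitary.mem_iff.1 hU).2, one_mul]
          rw [mul_sub U, sub_mul _ _ (Z k), a1, a2, mul_sub, sub_mul, Matrix.mul_smul,
            Matrix.smul_mul, mul_one, one_mul, Matrix.mul_smul, Matrix.smul_mul, smul_sub]
          abel
        rw [e3, norm_neg, norm_smul, norm_mul_unitary (hZ k), norm_unitary_mul hU]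
        calc _ ≤ 2 * (12 * η) := mul_le_mul (hsub k) (hcut k) (norm_nonneg _) zero_le_two
          _ ≤ _ := by nlinarith
      · simp only [fibre_some_some_ne lam hkl]
        simp
        positivity
  refine (norm_blkHom_mul_fibHom_sub_le _ _ _).trans ?_
  refine (Finset.sum_le_sum fun k _ => Finset.sum_le_sum fun l _ => hentry k l).trans_eq ?_
  simp only [Finset.sum_const, Finset.card_univ, hcard, nsmul_eq_mul]
  push_cast
  ring

end BlockEstimate

section Flux

variable {N : ℕ} {ι : Type*} [Fintype ι] [DecidableEq ι]

theorem apply_label_sub {p j : ZMod N} {f g : ZMod N → ℝ} (hp : j = p → g j = f j)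
    (hf : p ≠ j → f j = 0 ∨ f j = 1) (hg : p ≠ j → g j = 0 ∨ g j = 1) (γ : ZMod N → ℝ) :
    γ (label p g (some j)) - γ (label p f (some j)) = -(γ j - γ (j - 1)) * (g j - f j) := by
  simp only [label]
  by_cases h : j = p
  · rw [if_pos h, if_pos h, hp h]; simp
  · rw [if_neg h, if_neg h]
    rcases hf (Ne.symm h) with e | e <;> rcases hg (Ne.symm h) with e' | e' <;>
      simp [e, e']

variable [NeZero N]

/-- The direct sum over the points `x i` of the fibre rotations. -/
def totalRot (N : ℕ) [NeZero N] (x : ι → ℝ) :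
    Matrix (Option (ZMod N) × ι) (Option (ZMod N) × ι) ℂ :=
  fibHom fun i => rot (cell N (x i)) (Int.fract (x i))

theorem star_totalRot (x : ι → ℝ) : star (totalRot N x) = totalRot N x := by
  rw [totalRot, ← map_star]
  congr 1; funext i
  rw [Pi.star_apply, star_rot]

theorem totalRot_mul_self (x : ι → ℝ) : totalRot N x * totalRot N x = 1 := by
  rw [totalRot, ← map_mul, ← map_one fibHom]
  congr 1; funext i
  rw [Pi.mul_apply, rot_mul_rot (Int.fract_nonneg _) (Int.fract_lt_one _).le, Pi.one_apply]

theorem totalRot_mem_unitary (x : ι → ℝ) : totalRot N x ∈ unitary _ := by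
  rw [Unitary.mem_iff, star_totalRot, totalRot_mul_self]
  exact ⟨rfl, rfl⟩

theorem fibHom_fibre (x : ι → ℝ) (f : ι → ZMod N → ℝ) (μ : ι → ZMod N → ℂ) :
    fibHom (fun i => fibre (x i) (f i) (μ i)) = totalRot N x *
      Matrix.diagonal (fun p : Option (ZMod N) × ι =>
        μ p.2 (label (cell N (x p.2)) (f p.2) p.1)) * totalRot N x := by
  rw [← fibHom_diagonal, totalRot, ← map_mul, ← map_mul]
  rfl

theorem toCircle_sub_one (j : ZMod N) : (ZMod.toCircle (j - 1) : ℂ) =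
    ZMod.toCircle j * Complex.exp ((-(2 * Real.pi / N) : ℝ) * Complex.I) := by
  rw [sub_eq_add_neg, AddChar.map_add_eq_mul, Circle.coe_mul]
  congr 1
  have := ZMod.toCircle_intCast (N := N) (-1)
  push_cast at this
  rw [this]
  congr 1
  push_cast
  ring

theorem toCircle_label_mul_star {p j : ZMod N} {f g : ZMod N → ℝ} (hp : j = p → g j = f j)
    (hf : p ≠ j → f j = 0 ∨ f j = 1) (hg : p ≠ j → g j = 0 ∨ g j = 1) :
    (ZMod.toCircle (label p f (some j)) : ℂ) * star (ZMod.toCircle (label p g (some j)) : ℂ) =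
      Complex.exp ((2 * Real.pi / N * (g j - f j) : ℝ) * Complex.I) := by
  have hc : ∀ z : Circle, (z : ℂ) * star (z : ℂ) = 1 := fun z => by
    rw [← starRingEnd_apply, Complex.mul_conj', Circle.norm_coe]; simp
  have hlab : ∀ f : ZMod N → ℝ, (f j = 0 ∨ f j = 1) →
      (ZMod.toCircle (if f j = 1 then j - 1 else j) : ℂ) =
        ZMod.toCircle j * Complex.exp ((-(2 * Real.pi / N) * f j : ℝ) * Complex.I) := by
    rintro f (e | e)
    · simp [e]
    · rw [if_pos e, e, toCircle_sub_one, mul_one]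
  have hstar : ∀ t : ℝ, star (Complex.exp ((t : ℝ) * Complex.I)) =
      Complex.exp ((-t : ℝ) * Complex.I) := fun t => by
    rw [← starRingEnd_apply, ← Complex.exp_conj]
    simp
  simp only [label]
  by_cases h : j = p
  · rw [if_pos h, if_pos h, hc, hp h]; simp
  · rw [if_neg h, if_neg h, hlab f (hf (Ne.symm h)), hlab g (hg (Ne.symm h)), star_mul, hstar]
    have : ∀ a b c d : ℂ, a * b * (c * d) = a * d * (b * c) := fun a b c d => by ring
    rw [this, hc, one_mul, ← Complex.exp_add]
    congr 1
    push_cast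
    ring

theorem sum_eq_of_fibre_intertwine (hN : 7 ≤ N) (x : ι → ℝ) {g : ZMod N → ι → ℝ}
    (hg : ∀ j i, cell N (x i) = j → g j i = step (x i) j)
    (hg' : ∀ j i, cell N (x i) ≠ j → g j i = 0 ∨ g j i = 1)
    {P Q X : Matrix (Option (ZMod N) × ι) (Option (ZMod N) × ι) ℂ}
    (hP : P = fibHom (fun i => fibre (x i) (step (x i)) (fun j => (ZMod.toCircle j : ℂ))))
    (hQ : Q = fibHom (fun i => fibre (x i) (fun j => g j i) (fun j => (ZMod.toCircle j : ℂ))))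
    (hX : X ∈ unitary _) (hPX : P * X = X * Q)
    (hlog : logDet (X * P * star X * star P) = 0) (j : ZMod N) :
    ∑ i, g j i = ∑ i, step (x i) j := by
  have hNpos : (0 : ℝ) < N := by exact_mod_cast NeZero.pos N
  set lam : ZMod N → ℂ := fun j => (ZMod.toCircle j : ℂ) with hlam
  set R := totalRot N x with hR
  have hRR : R * R = 1 := totalRot_mul_self x
  have hRs : star R = R := star_totalRot x
  have hRu : R ∈ unitary _ := totalRot_mem_unitary x
  set dP : Option (ZMod N) × ι → ℂ := fun p => lam (label (cell N (x p.2)) (step (x p.2)) p.1)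
    with hdP
  set dQ : Option (ZMod N) × ι → ℂ :=
    fun p => lam (label (cell N (x p.2)) (fun j => g j p.2) p.1) with hdQ
  have hP' : P = R * Matrix.diagonal dP * R := by rw [hP, fibHom_fibre]
  have hQ' : Q = R * Matrix.diagonal dQ * R := by rw [hQ, fibHom_fibre]
  have hstep : ∀ j i, cell N (x i) ≠ j → step (x i) j = 0 ∨ step (x i) j = 1 := fun j i h => by
    rw [step, if_neg h]; split_ifs <;> simp
  have hinj : Function.Injective lam := fun a b h =>
    ZMod.injective_toCircle (Circle.coe_injective h)
  have hsum : ∀ γ : ZMod N → ℝ, ∑ j, (γ j - γ (j - 1)) * ∑ i, (g j i - step (x i) j) = 0 := by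
    intro γ
    have h1 : Matrix.diagonal dP * (R * X * R) = R * X * R * Matrix.diagonal dQ := by
      have : R * (P * X) * R = R * (X * Q) * R := by rw [hPX]
      rw [hP', hQ'] at this
      calc Matrix.diagonal dP * (R * X * R) = (R * R) * Matrix.diagonal dP * (R * X * R) := by
            rw [hRR, one_mul]
        _ = R * (R * Matrix.diagonal dP * R * X) * R := by simp only [mul_assoc]
        _ = R * (X * (R * Matrix.diagonal dQ * R)) * R := this
        _ = R * X * R * Matrix.diagonal dQ * (R * R) := by simp only [mul_assoc]
        _ = _ := by rw [hRR, mul_one]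
    have h2 : IsUnit (R * X * R) :=
      (Unitary.toUnits ⟨R * X * R, mul_mem (mul_mem hRu hX) hRu⟩).isUnit
    have h3 := sum_eq_of_intertwine h2 h1 (Function.extend lam γ 0)
    simp only [hdP, hdQ, hinj.extend_apply] at h3
    rw [← sub_eq_zero, ← Finset.sum_sub_distrib, Fintype.sum_prod_type, Fintype.sum_option] at h3
    simp only [label, sub_self, Finset.sum_const_zero, zero_add] at h3
    rw [← h3]
    refine Finset.sum_congr rfl fun j _ => ?_
    rw [Finset.mul_sum]
    refine Finset.sum_congr rfl fun i _ => ?_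
    have := apply_label_sub (p := cell N (x i)) (j := j) (f := step (x i)) (g := fun j => g j i)
      (fun h => hg j i h.symm) (hstep j i) (hg' j i) γ
    simp only [label] at this
    linarith
  have hconst : ∀ m : ZMod N, ∑ i, (g (m + 1) i - step (x i) (m + 1)) =
      ∑ i, (g m i - step (x i) m) := fun m => by
    have := hsum (Pi.single m 1)
    simp only [Pi.single_apply, sub_mul, ite_mul, one_mul, zero_mul, sub_eq_iff_eq_add] at this
    rw [Finset.sum_sub_distrib] at this
    simp only [Finset.sum_ite_eq', Finset.mem_univ, if_true] at this
    exact (sub_eq_zero.1 this).symm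
  have hall : ∀ m : ℕ, ∑ i, (g (j + (m : ZMod N)) i -
      step (x i) (j + (m : ZMod N))) = ∑ i, (g j i - step (x i) j) := by
    intro m
    induction m with
    | zero => simp
    | succ m ih => push_cast; rw [← add_assoc, hconst, ih]
  have hall' : ∀ m, ∑ i, (g m i - step (x i) m) = ∑ i, (g j i - step (x i) j) := fun m => by
    rw [← hall (m - j).val, ZMod.natCast_zmod_val, add_sub_cancel]
  set a : Option (ZMod N) × ι → ℝ := fun p => match p.1 with
    | none => 0
    | some j => 2 * Real.pi / N * (g j p.2 - step (x p.2) j) with ha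
  have hPQ : P * star Q = R * Matrix.diagonal (fun p => Complex.exp (a p * Complex.I)) * star R := by
    have h1 : Matrix.diagonal dP * star (Matrix.diagonal dQ) =
        Matrix.diagonal (fun p => Complex.exp (a p * Complex.I)) := by
      rw [Matrix.star_eq_conjTranspose, Matrix.diagonal_conjTranspose,
        Matrix.diagonal_mul_diagonal]
      congr 1
      funext ⟨k, i⟩
      rw [Pi.star_apply]
      rcases k with _ | j
      · simp only [hdP, hdQ, label, ha, hlam]
        rw [← starRingEnd_apply, Complex.mul_conj', Circle.norm_coe]; simp
      · exact toCircle_label_mul_star (fun h => hg j i h.symm) (hstep j i) (hg' j i)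
    rw [hP', hQ', star_mul, star_mul, hRs, ← h1]
    calc _ = R * Matrix.diagonal dP * (R * R) * star (Matrix.diagonal dQ) * R := by
          simp only [mul_assoc]
      _ = _ := by rw [hRR, mul_one, mul_assoc R]
  have hsmall : 2 * Real.pi / N < 1 := by
    have : (7 : ℝ) ≤ N := by exact_mod_cast hN
    rw [div_lt_one hNpos]
    linarith [Real.pi_lt_d2]
  have ha0 : ∀ p, |a p| ≤ 2 * Real.pi / N := by
    have hpi := Real.pi_pos
    rintro ⟨_ | j, i⟩
    · simp only [ha, abs_zero]; positivity
    · simp only [ha]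
      rw [abs_mul, abs_of_pos (by positivity)]
      refine mul_le_of_le_one_right (by positivity) ?_
      by_cases h : cell N (x i) = j
      · rw [hg j i h]; simp
      · rcases hstep j i h with e | e <;> rcases hg' j i h with e' | e' <;> rw [e, e'] <;> simp
  have ha1 : ∀ p, |a p| < 1 := fun p => (ha0 p).trans_lt hsmall
  have hX1 : X * P * star X * star P = X * (P * star Q) * star X := by
    have := congrArg star hPX
    rw [star_mul, star_mul] at this
    rw [mul_assoc, this]
    simp only [mul_assoc]
  have hdiag : ‖Matrix.diagonal (fun p => Complex.exp (a p * Complex.I)) - 1‖ < 1 := by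
    have hpi := Real.pi_pos
    rw [← Matrix.diagonal_one, Matrix.diagonal_sub]
    exact (norm_diagonal_le (by positivity) fun p =>
      (norm_exp_mul_I_sub_one_le (a p)).trans (ha0 p)).trans_lt hsmall
  rw [hX1, hPQ, logDet_conj hX (by rwa [norm_conj_sub_one hRu]), logDet_conj hRu hdiag,
    logDet_diagonal_exp ha1] at hlog
  have h5 : ∑ p, a p = 0 := by
    have := (mul_eq_zero.1 hlog).resolve_right Complex.I_ne_zero
    exact_mod_cast this
  rw [Fintype.sum_prod_type, Fintype.sum_option] at h5
  simp only [ha, Finset.sum_const_zero, zero_add, ← Finset.mul_sum, hall', Finset.sum_const,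
    Finset.card_univ, ZMod.card, nsmul_eq_mul] at h5
  have h6 : ∑ i, (g j i - step (x i) j) = 0 := by
    have hpi := Real.pi_pos
    have h7 : 2 * Real.pi / N * N ≠ 0 := by positivity
    rw [← mul_assoc] at h5
    exact (mul_eq_zero.1 h5).resolve_left h7
  rw [← sub_eq_zero, ← Finset.sum_sub_distrib, h6]

end Flux

section FibreRoots

variable {N : ℕ}

/-- A root `v` rotated so that its `n`-th power moves to the grid point `j`. -/
def gridRoot (n : ℕ) (v : ℂ) (x : ℝ) (j : ZMod N) : ℂ :=
  v * Complex.exp ((2 * Real.pi / N * (⌊x⌋ - (cell N x - j).val - x) / n : ℝ) * Complex.I)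

theorem norm_gridRoot {n : ℕ} {v : ℂ} (hv : ‖v‖ = 1) (x : ℝ) (j : ZMod N) :
    ‖gridRoot n v x j‖ = 1 := by
  rw [gridRoot, norm_mul, hv, Complex.norm_exp_ofReal_mul_I, one_mul]

theorem norm_gridRoot_sub_le {n : ℕ} (hn : 1 ≤ n) {v : ℂ} (hv : ‖v‖ = 1) (x : ℝ) {j : ZMod N}
    {d : ℕ} (hd : d < N) (hj : cell N x = j + d) :
    ‖gridRoot n v x j - v‖ ≤ 2 * Real.pi / N * (d + 1) := by
  have hval : (cell N x - j).val = d := by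
    rw [hj, add_sub_cancel_left, ZMod.val_natCast_of_lt hd]
  have e : gridRoot n v x j - v = v * (Complex.exp ((2 * Real.pi / N * (⌊x⌋ - d - x) / n : ℝ) *
      Complex.I) - 1) := by rw [gridRoot, hval]; ring
  rw [e, norm_mul, hv, one_mul]
  refine (norm_exp_mul_I_sub_one_le _).trans ?_
  have hn' : (1 : ℝ) ≤ n := by exact_mod_cast hn
  have hpi := Real.pi_pos
  rw [abs_div, abs_mul, abs_of_nonneg (by positivity : 0 ≤ 2 * Real.pi / N), Nat.abs_cast]
  refine (div_le_self (by positivity) hn').trans ?_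
  gcongr
  have h1 := Int.floor_add_fract x
  have h2 := Int.fract_nonneg x
  have h3 := Int.fract_lt_one x
  have h4 : (0 : ℝ) ≤ d := Nat.cast_nonneg d
  rw [abs_le]
  constructor <;> linarith

variable [NeZero N] {ι : Type*} [Fintype ι] [DecidableEq ι]

/-- The diagonal blocks of `v` together with its rotated roots at the grid points. -/
def rootBlocks (n : ℕ) (v : ι → ℂ) (x : ι → ℝ) : Option (ZMod N) → Matrix ι ι ℂ
  | none => Matrix.diagonal v
  | some j => Matrix.diagonal fun i => gridRoot n (v i) (x i) j

theorem fibHom_fibre_pow (x : ι → ℝ) (f : ι → ZMod N → ℝ) (μ : ι → ZMod N → ℂ) (m : ℕ) :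
    fibHom (fun i => fibre (x i) (f i) (μ i)) ^ m =
      fibHom (fun i => fibre (x i) (f i) fun j => μ i j ^ m) := by
  rw [fibHom_fibre, fibHom_fibre]
  induction m with
  | zero =>
    simp only [pow_zero]
    rw [Matrix.diagonal_one, mul_one, totalRot_mul_self]
  | succ m ih =>
    rw [pow_succ, ih]
    have h : ∀ A B : Matrix (Option (ZMod N) × ι) (Option (ZMod N) × ι) ℂ,
        totalRot N x * A * totalRot N x * (totalRot N x * B * totalRot N x) =
          totalRot N x * (A * B) * totalRot N x := fun A B => by
      calc _ = totalRot N x * A * (totalRot N x * totalRot N x) * B * totalRot N x := by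
            simp only [mul_assoc]
        _ = _ := by rw [totalRot_mul_self, mul_one, mul_assoc (totalRot N x)]
    rw [h, Matrix.diagonal_mul_diagonal]
    simp only [pow_succ]

theorem fibHom_fibre_mem_unitary (x : ι → ℝ) (f : ι → ZMod N → ℝ) {μ : ι → ZMod N → ℂ}
    (hμ : ∀ i j, ‖μ i j‖ = 1) : fibHom (fun i => fibre (x i) (f i) (μ i)) ∈ unitary _ := by
  rw [fibHom_fibre]
  exact mul_mem (mul_mem (totalRot_mem_unitary x) (diagonal_mem_unitary fun p => hμ _ _))
    (totalRot_mem_unitary x)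

theorem gridRoot_pow {n : ℕ} (hn : 1 ≤ n) {v : ℂ} {x : ℝ}
    (hx : Complex.exp ((2 * Real.pi / N * x : ℝ) * Complex.I) = v ^ n) (j : ZMod N) :
    gridRoot n v x j ^ n = ZMod.toCircle j := by
  have hj : j = ((⌊x⌋ - ((cell N x - j).val : ℤ) : ℤ) : ZMod N) := by
    push_cast
    rw [ZMod.natCast_zmod_val, cell, sub_sub_cancel]
  have hn' : (n : ℂ) ≠ 0 := by exact_mod_cast (by omega : n ≠ 0)
  rw [gridRoot, mul_pow, ← hx, ← Complex.exp_nat_mul, ← Complex.exp_add]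
  conv_rhs => rw [hj]
  rw [ZMod.toCircle_intCast]
  congr 1
  push_cast
  field_simp
  ring

theorem norm_fibre_gridRoot_sub_le (hN : 7 ≤ N) {n : ℕ} (hn : 1 ≤ n) {v : ι → ℂ}
    (hv : ∀ i, ‖v i‖ = 1) (x : ι → ℝ) :
    ‖fibHom (fun i => fibre (x i) (step (x i)) fun j : ZMod N => gridRoot n (v i) (x i) j) -
      blkHom (rootBlocks n v x)‖ ≤ 6 * (2 * Real.pi / N) := by
  have hτ : 0 ≤ 2 * Real.pi / N := by have := Real.pi_pos; positivity
  have hN4 : 4 ≤ N := by omega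
  set D₀ : Option (ZMod N) × ι → ℂ := fun p => gridRoot n (v p.2) (x p.2)
    (label (cell N (x p.2)) (step (x p.2)) p.1) with hD₀
  set D₁ : Option (ZMod N) × ι → ℂ := fun p => match p.1 with
    | none => v p.2
    | some j => if j = cell N (x p.2) then v p.2 else gridRoot n (v p.2) (x p.2) j with hD₁
  set D₂ : Option (ZMod N) × ι → ℂ := fun p => match p.1 with
    | none => v p.2
    | some j => gridRoot n (v p.2) (x p.2) j with hD₂
  have hR := totalRot_mem_unitary (N := N) x
  have e0 : fibHom (fun i => fibre (x i) (step (x i)) fun j : ZMod N => gridRoot n (v i) (x i) j) =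
      totalRot N x * Matrix.diagonal D₀ * totalRot N x := by rw [fibHom_fibre]
  have e1 : totalRot N x * Matrix.diagonal D₁ * totalRot N x = Matrix.diagonal D₁ := by
    rw [← fibHom_diagonal, totalRot, ← map_mul, ← map_mul]
    congr 1
    funext i
    ext k l
    rw [Pi.mul_apply, Pi.mul_apply,
      rot_mul_diagonal_mul_rot (Int.fract_nonneg _) (Int.fract_lt_one _).le]
    rcases k with _ | k <;> rcases l with _ | l
    · simp [hD₁]; ring
    · simp [hD₁]
    · simp [hD₁]
    · rw [Matrix.diagonal_apply]
      simp only [hD₁, Option.some.injEq, if_true]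
      split_ifs
      · ring
      · rfl
      · rfl
  have e2 : blkHom (rootBlocks n v x) = Matrix.diagonal D₂ := by
    rw [← blkHom_diagonal]
    congr 1
    funext k
    rcases k with _ | k <;> rfl
  have d0 : ∀ i, cell N (x i) = cell N (x i) + (0 : ℕ) := fun i => by simp
  have n1 : ‖Matrix.diagonal D₀ - Matrix.diagonal D₁‖ ≤ 5 * (2 * Real.pi / N) := by
    rw [Matrix.diagonal_sub]
    refine norm_diagonal_le (by positivity) fun p => ?_
    obtain ⟨_ | j, i⟩ := p
    · simp only [hD₀, hD₁, label]
      refine (norm_gridRoot_sub_le hn (hv i) (x i) (d := 0) (by omega) (d0 i)).trans ?_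
      push_cast; nlinarith
    · simp only [hD₀, hD₁, label]
      by_cases h : j = cell N (x i)
      · rw [if_pos h, if_pos h]
        refine (norm_gridRoot_sub_le hn (hv i) (x i) (d := 1) (by omega) ?_).trans ?_
        · rw [h]; push_cast; ring
        · push_cast; nlinarith
      · rw [if_neg h, if_neg h]
        by_cases h' : step (x i) j = 1
        · rw [if_pos h']
          have hc : cell N (x i) = j + 1 := by
            by_contra hne
            rw [step, if_neg (Ne.symm h), if_neg hne] at h'
            exact zero_ne_one h'
          have a1 := norm_gridRoot_sub_le hn (hv i) (x i) (j := j - 1) (d := 2) (by omega)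
            (by rw [hc]; push_cast; ring)
          have a2 := norm_gridRoot_sub_le hn (hv i) (x i) (j := j) (d := 1) (by omega)
            (by rw [hc]; push_cast; ring)
          have a3 := norm_sub_le_norm_sub_add_norm_sub (gridRoot n (v i) (x i) (j - 1)) (v i)
            (gridRoot n (v i) (x i) j)
          rw [norm_sub_rev (v i)] at a3
          push_cast at a1 a2
          linarith
        · rw [if_neg h', sub_self, norm_zero]; positivity
  have n2 : ‖Matrix.diagonal D₁ - Matrix.diagonal D₂‖ ≤ 2 * Real.pi / N := by
    rw [Matrix.diagonal_sub]
    refine norm_diagonal_le hτ fun p => ?_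
    obtain ⟨_ | j, i⟩ := p
    · simp only [hD₁, hD₂, sub_self, norm_zero]; exact hτ
    · simp only [hD₁, hD₂]
      by_cases h : j = cell N (x i)
      · rw [if_pos h, norm_sub_rev]
        refine (norm_gridRoot_sub_le hn (hv i) (x i) (d := 0) (by omega) ?_).trans ?_
        · rw [h]; simp
        · simp
      · rw [if_neg h, sub_self, norm_zero]; exact hτ
  rw [e0, e2]
  calc _ ≤ ‖totalRot N x * Matrix.diagonal D₀ * totalRot N x - Matrix.diagonal D₁‖ +
        ‖Matrix.diagonal D₁ - Matrix.diagonal D₂‖ := norm_sub_le_norm_sub_add_norm_sub _ _ _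
    _ = ‖Matrix.diagonal D₀ - Matrix.diagonal D₁‖ +
        ‖Matrix.diagonal D₁ - Matrix.diagonal D₂‖ := by
      rw [← norm_unitary_mul hR (Matrix.diagonal D₀ - _), ← norm_mul_unitary hR (_ * (_ - _)),
        mul_sub, sub_mul, e1]
    _ ≤ _ := by linarith

end FibreRoots

theorem inv_eq_star_of_mem_unitary {ι : Type*} [Fintype ι] [DecidableEq ι] {U : Matrix ι ι ℂ}
    (hU : U ∈ unitary (Matrix ι ι ℂ)) : U⁻¹ = star U :=
  Matrix.inv_eq_right_inv (Unitary.mem_iff.1 hU).2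

theorem blkHom_mem_unitary {κ ι : Type*} [Fintype κ] [DecidableEq κ] [Fintype ι] [DecidableEq ι]
    {M : κ → Matrix ι ι ℂ} (hM : ∀ k, M k ∈ unitary (Matrix ι ι ℂ)) :
    blkHom M ∈ unitary (Matrix (κ × ι) (κ × ι) ℂ) := by
  rw [Unitary.mem_iff, ← map_star, ← map_mul, ← map_mul, ← map_one blkHom]
  constructor <;> congr 1 <;> funext k
  · exact (Unitary.mem_iff.1 (hM k)).1
  · exact (Unitary.mem_iff.1 (hM k)).2

section Completion

variable {N : ℕ} [NeZero N] {ι : Type*} [Fintype ι] [DecidableEq ι]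

theorem rootBlocks_mem_unitary (n : ℕ) {v : ι → ℂ} (hv : ∀ i, ‖v i‖ = 1) (x : ι → ℝ)
    (k : Option (ZMod N)) : rootBlocks n v x k ∈ unitary (Matrix ι ι ℂ) := by
  rcases k with _ | j
  · exact diagonal_mem_unitary hv
  · exact diagonal_mem_unitary fun i => norm_gridRoot (hv i) _ _

theorem rootBlocks_some_pow {n : ℕ} (hn : 1 ≤ n) {v : ι → ℂ} {x : ι → ℝ}
    (hx : ∀ i, Complex.exp ((2 * Real.pi / N * x i : ℝ) * Complex.I) = v i ^ n) (j : ZMod N) :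
    rootBlocks n v x (some j) ^ n = (ZMod.toCircle j : ℂ) • (1 : Matrix ι ι ℂ) := by
  rw [rootBlocks, Matrix.diagonal_pow, ← Matrix.diagonal_one, ← Matrix.diagonal_smul]
  congr 1
  funext i
  simp [gridRoot_pow hn (hx i)]

/-- Unitary blocks near `U` and near the roots of `v` on the grid can be perturbed to an exact
solution once the winding invariant vanishes. -/
theorem exists_block_solution (hN : 7 ≤ N) {n : ℕ} (hn : 1 ≤ n)
    (hNn : n * (6 * (2 * Real.pi / N)) ≤ 1 / 100) {U : Matrix ι ι ℂ}
    (hU : U ∈ unitary (Matrix ι ι ℂ)) {v : ι → ℂ} (hv : ∀ i, ‖v i‖ = 1) {x : ι → ℝ}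
    (hx : ∀ i, Complex.exp ((2 * Real.pi / N * x i : ℝ) * Complex.I) = v i ^ n)
    (hUC : ‖U * Matrix.diagonal (fun i => v i ^ n) - Matrix.diagonal (fun i => v i ^ n) * U‖ ≤
      1 / 10)
    (hlog : logDet (U * Matrix.diagonal (fun i => v i ^ n) * star U *
      star (Matrix.diagonal fun i => v i ^ n)) = 0) {η : ℝ} (hη : 0 ≤ η)
    (hηN : 4 * (N * ((N + 1) ^ 2 * ((N + 24) * η))) ≤ 1 / 100)
    (ht : ∀ j : ZMod N, ‖U * profile trapezoid x j - profile trapezoid x j * U‖ ≤ η)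
    (hh : ∀ j : ZMod N, ‖U * profile hump x j - profile hump x j * U‖ ≤ η)
    (htent : ∀ j : ZMod N, ‖U * profile tent x j - profile tent x j * U‖ ≤ η) :
    ∃ Z : ZMod N → Matrix ι ι ℂ, (∀ j, Z j ∈ unitary (Matrix ι ι ℂ)) ∧
      ∃ U' ∈ unitary (Matrix (Option (ZMod N) × ι) (Option (ZMod N) × ι) ℂ),
      ∃ V' ∈ unitary (Matrix (Option (ZMod N) × ι) (Option (ZMod N) × ι) ℂ),
        U' * V' ^ n = V' ^ n * U' ∧
        ‖blkHom (cutBlocks U Z) - U'‖ ≤ 4 * (N * ((N + 1) ^ 2 * ((N + 24) * η))) ∧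
        ‖blkHom (rootBlocks (N := N) n v x) - V'‖ ≤ 6 * (2 * Real.pi / N) := by
  have hN4 : 4 ≤ N := by omega
  choose g Z hg hg' hZ hEZ hZE hcut heq using exists_cut_step hN4 hU x ht hh
  refine ⟨Z, hZ, ?_⟩
  let lam : ZMod N → ℂ := fun j => (ZMod.toCircle j : ℂ)
  have hlam : ∀ j, ‖lam j‖ = 1 := fun j => Circle.norm_coe _
  have hlamN : ∀ j, lam j ^ N = 1 := fun j => by
    rw [← Circle.coe_pow, ← AddChar.map_nsmul_eq_pow]; simp
  have hfN : ∀ f : ι → ZMod N → ℝ, fibHom (fun i => fibre (x i) (f i) lam) ^ N = 1 := fun f => by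
    rw [fibHom_fibre_pow x f fun _ => lam]
    simp only [hlamN]
    rw [fibHom_fibre x f fun _ _ => (1 : ℂ), Matrix.diagonal_one, mul_one, totalRot_mul_self]
  have hfu : ∀ f : ι → ZMod N → ℝ, fibHom (fun i => fibre (x i) (f i) lam) ∈ unitary _ := fun f =>
    fibHom_fibre_mem_unitary x f fun _ j => hlam j
  have hest := norm_cutBlocks_mul_fibre_sub_le hN4 hU x hη hh htent hg hg' hZ hEZ hZE hcut hlam
  have hcb : ∀ k, cutBlocks U Z k ∈ unitary (Matrix ι ι ℂ) := by
    rintro (_ | j)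
    · exact hU
    · exact mul_mem hU (hZ j)
  have hX := blkHom_mem_unitary hcb
  obtain ⟨P, hP⟩ : ∃ P, P = fibHom (fun i => fibre (x i) (step (x i)) lam) := ⟨_, rfl⟩
  obtain ⟨Q, hQ⟩ : ∃ Q, Q = fibHom (fun i => fibre (x i) (fun j => g j i) lam) := ⟨_, rfl⟩
  obtain ⟨X, hXdef⟩ : ∃ X, X = blkHom (cutBlocks U Z) := ⟨_, rfl⟩
  have hPu : P ∈ unitary _ := by rw [hP]; exact hfu _
  rw [← hP, ← hQ, ← hXdef, norm_sub_rev] at hest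
  rw [← hXdef] at hX ⊢
  obtain ⟨U', hU', hUX, hPU⟩ := exists_unitary_intertwiner (by omega : 0 < N) hPu
    (by rw [hQ]; exact hfu _) hX (by rw [hP]; exact hfN _) (by rw [hQ]; exact hfN _) hest
    (by linarith)
  let V' := fibHom fun i => fibre (x i) (step (x i)) fun j : ZMod N => gridRoot n (v i) (x i) j
  have hV' : V' ∈ unitary _ := fibHom_fibre_mem_unitary x _ fun i j => norm_gridRoot (hv i) _ _
  have hV'n : V' ^ n = P := by
    rw [hP, fibHom_fibre_pow]
    simp only [gridRoot_pow hn (hx _)]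
    rfl
  have hVV' := norm_fibre_gridRoot_sub_le hN hn hv x
  have hD : ‖P - blkHom (rootBlocks (N := N) n v x) ^ n‖ ≤ 1 / 100 := by
    rw [← hV'n]
    exact (norm_pow_sub_pow_le (norm_le_one_of_unitary hV') (norm_le_one_of_unitary
      (blkHom_mem_unitary (rootBlocks_mem_unitary n hv x))) n).trans
      ((mul_le_mul_of_nonneg_left hVV' (Nat.cast_nonneg n)).trans hNn)
  have hBu : blkHom (rootBlocks (N := N) n v x) ^ n ∈ unitary _ :=
    pow_mem (blkHom_mem_unitary (rootBlocks_mem_unitary n hv x)) n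
  have hnone : rootBlocks (N := N) n v x none ^ n = Matrix.diagonal fun i => v i ^ n := by
    rw [rootBlocks, Matrix.diagonal_pow]; rfl
  have hcomm : ‖X * blkHom (rootBlocks (N := N) n v x) ^ n -
      blkHom (rootBlocks (N := N) n v x) ^ n * X‖ ≤ 1 / 10 := by
    rw [hXdef, ← map_pow, ← map_mul, ← map_mul, ← map_sub, norm_blkHom,
      pi_norm_le_iff_of_nonneg (by norm_num)]
    rintro (_ | j)
    · rw [Pi.sub_apply, Pi.mul_apply, Pi.mul_apply, Pi.pow_apply, hnone]
      exact hUC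
    · rw [Pi.sub_apply, Pi.mul_apply, Pi.mul_apply, Pi.pow_apply, rootBlocks_some_pow hn hx]
      simp
  have hlog0 : logDet (X * blkHom (rootBlocks (N := N) n v x) ^ n * star X *
      star (blkHom (rootBlocks (N := N) n v x) ^ n)) = 0 := by
    have hcu : ∀ j, cutBlocks U Z (some j) * rootBlocks (N := N) n v x (some j) ^ n *
        star (cutBlocks U Z (some j)) * star (rootBlocks (N := N) n v x (some j) ^ n) = 1 :=
      fun j => by
        have h1 := (Unitary.mem_iff.1 (hcb (some j))).2
        have h2 := (Unitary.mem_iff.1 (pow_mem (rootBlocks_mem_unitary (N := N) n hv x (some j))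
          n)).2
        rw [rootBlocks_some_pow hn hx] at h2 ⊢
        rw [Matrix.mul_smul, mul_one, Matrix.smul_mul, h1]
        exact h2
    have hCu : Matrix.diagonal (fun i => v i ^ n) ∈ unitary (Matrix ι ι ℂ) :=
      diagonal_mem_unitary fun i => by rw [norm_pow, hv, one_pow]
    rw [hXdef, ← map_pow, ← map_star, ← map_star, ← map_mul, ← map_mul, ← map_mul, logDet_blkHom]
    · rw [Fintype.sum_option]
      simp only [Pi.mul_apply, Pi.star_apply, Pi.pow_apply, hcu, logDet_one, hnone,
        Finset.sum_const_zero, add_zero]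
      exact hlog
    · rintro (_ | j)
      · simp only [Pi.mul_apply, Pi.star_apply, Pi.pow_apply, hnone, cutBlocks]
        have e : U * Matrix.diagonal (fun i => v i ^ n) * star U *
            star (Matrix.diagonal fun i => v i ^ n) - 1 =
            (U * Matrix.diagonal (fun i => v i ^ n) - Matrix.diagonal (fun i => v i ^ n) * U) *
              star U * star (Matrix.diagonal fun i => v i ^ n) := by
          rw [sub_mul, sub_mul, mul_assoc (Matrix.diagonal _) U, (Unitary.mem_iff.1 hU).2, mul_one,
            (Unitary.mem_iff.1 hCu).2]
        rw [e, norm_mul_unitary (Unitary.star_mem hCu), norm_mul_unitary (Unitary.star_mem hU)]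
        exact hUC.trans_lt (by norm_num)
      · simp only [Pi.mul_apply, Pi.star_apply, Pi.pow_apply, hcu, sub_self, norm_zero]
        exact one_pos
  have hlog1 := logDet_commutator_eq (A := U') (D := P) hX hBu (hUX.trans hηN) hD hcomm
  rw [hlog0, inv_eq_star_of_mem_unitary hU', inv_eq_star_of_mem_unitary hPu] at hlog1
  have hgstep : ∀ j, g j = fun i => step (x i) j := fun j =>
    heq j (sum_eq_of_fibre_intertwine hN x hg hg' hP hQ hU' hPU hlog1 j)
  have hPQ : P = Q := by
    rw [hP, hQ]
    congr 1
    funext i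
    congr 1
    funext j
    rw [hgstep]
  refine ⟨U', hU', V', hV', ?_, ?_, ?_⟩
  · rw [hV'n, hPU, hPQ]
  · rw [norm_sub_rev]; exact hUX
  · rw [norm_sub_rev]; exact hVV'

end Completion

section Assemble

variable {ι κ : Type*} [Fintype ι] [DecidableEq ι] [Fintype κ] [DecidableEq κ]

theorem reindexHom_blkHom_option (M : Option κ → Matrix ι ι ℂ) :
    reindexHom optionProdEquiv (blkHom M) =
      Matrix.fromBlocks (M none) 0 0 (blkHom fun k => M (some k)) := by
  ext (i | ⟨k, i⟩) (j | ⟨l, j⟩) <;>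
    simp [reindexHom_apply, optionProdEquiv, blkHom_apply]

theorem norm_commutator_sub_one {U C : Matrix ι ι ℂ} (hU : U ∈ unitary (Matrix ι ι ℂ))
    (hC : C ∈ unitary (Matrix ι ι ℂ)) : ‖U * C * star U * star C - 1‖ = ‖U * C - C * U‖ := by
  have : U * C * star U * star C - 1 = (U * C - C * U) * (star U * star C) := by
    rw [sub_mul]
    congr 1
    · noncomm_ring
    · rw [← star_mul, (Unitary.mem_iff.1 (mul_mem hC hU)).2]
  rw [this, norm_mul_unitary (mul_mem (Unitary.star_mem hU) (Unitary.star_mem hC))]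

theorem conj_mul_conj {O : Matrix ι ι ℂ} (hO : O ∈ unitary (Matrix ι ι ℂ)) (A B : Matrix ι ι ℂ) :
    O * A * star O * (O * B * star O) = O * (A * B) * star O := by
  rw [show O * A * star O * (O * B * star O) = O * A * (star O * O) * B * star O by noncomm_ring,
    (Unitary.mem_iff.1 hO).1]
  noncomm_ring

theorem conj_pow_unitary {O : Matrix ι ι ℂ} (hO : O ∈ unitary (Matrix ι ι ℂ)) (A : Matrix ι ι ℂ)
    (n : ℕ) : (O * A * star O) ^ n = O * A ^ n * star O := by
  induction n with
  | zero => simp [(Unitary.mem_iff.1 hO).2]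
  | succ k ih => rw [pow_succ, ih, conj_mul_conj hO, pow_succ]

end Assemble

theorem exists_diagonal_completion {n : ℕ} (hn : 1 ≤ n) {ε : ℝ} (hε : 0 < ε) :
    ∃ δ > 0, ∀ (ι : Type) [Fintype ι] [DecidableEq ι], ∀ U ∈ unitary (Matrix ι ι ℂ),
      ∀ v : ι → ℂ, (∀ i, ‖v i‖ = 1) →
      ‖U * Matrix.diagonal (fun i => v i ^ n) - Matrix.diagonal (fun i => v i ^ n) * U‖ ≤ δ →
      logDet (U * Matrix.diagonal (fun i => v i ^ n) * star U *
        star (Matrix.diagonal fun i => v i ^ n)) = 0 →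
      ∃ (κ : Type) (_ : Fintype κ) (_ : DecidableEq κ),
        ∃ W ∈ unitary (Matrix κ κ ℂ), ∃ D ∈ unitary (Matrix κ κ ℂ), W * D ^ n = D ^ n * W ∧
        ∃ U' ∈ unitary (Matrix (ι ⊕ κ) (ι ⊕ κ) ℂ), ∃ V' ∈ unitary (Matrix (ι ⊕ κ) (ι ⊕ κ) ℂ),
          U' * V' ^ n = V' ^ n * U' ∧ ‖Matrix.fromBlocks U 0 0 W - U'‖ ≤ ε ∧
          ‖Matrix.fromBlocks (Matrix.diagonal v) 0 0 D - V'‖ ≤ ε := by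
  obtain ⟨N, hN⟩ : ∃ N : ℕ, N = 4200 * n + ⌈42 / ε⌉₊ + 7 := ⟨_, rfl⟩
  have hN7 : 7 ≤ N := by omega
  have : NeZero N := ⟨by omega⟩
  have hN0 : (0 : ℝ) < N := by exact_mod_cast (by omega : 0 < N)
  have hNn : n * (6 * (2 * Real.pi / N)) ≤ 1 / 100 := by
    have h1 : 4200 * (n : ℝ) ≤ N := by exact_mod_cast (by omega : 4200 * n ≤ N)
    have : n * (6 * (2 * Real.pi / N)) = n * 12 * Real.pi / N := by ring
    rw [this, div_le_iff₀ hN0]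
    nlinarith [Real.pi_lt_d2, (Nat.cast_nonneg n : (0 : ℝ) ≤ n)]
  have hNε : 6 * (2 * Real.pi / N) ≤ ε := by
    have h1 : 42 / ε ≤ N := (Nat.le_ceil _).trans
      (by exact_mod_cast (by omega : ⌈42 / ε⌉₊ ≤ N))
    have : 6 * (2 * Real.pi / N) = 12 * Real.pi / N := by ring
    rw [div_le_iff₀ hε] at h1
    rw [this, div_le_iff₀ hN0]
    nlinarith [Real.pi_lt_d2]
  obtain ⟨P, hP⟩ : ∃ P : ℝ, P = 4 * (N * ((N + 1) ^ 2 * (N + 24))) := ⟨_, rfl⟩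
  have hP0 : 0 < P := by rw [hP]; positivity
  obtain ⟨η, hη⟩ : ∃ η : ℝ, η = min ε (1 / 100) / P := ⟨_, rfl⟩
  have hη0 : 0 < η := by rw [hη]; positivity
  have hPη : 4 * (N * ((N + 1) ^ 2 * ((N + 24) * η))) = min ε (1 / 100) := by
    rw [← mul_div_cancel₀ (min ε (1 / 100)) hP0.ne', ← hη, hP]; ring
  obtain ⟨δ₁, hδ₁, H₁⟩ := exists_profile_bound (N := N) (G := trapezoid)
    (by unfold trapezoid; fun_prop) (trapezoid_zero_eq (by omega)) hη0
  obtain ⟨δ₂, hδ₂, H₂⟩ := exists_profile_bound (N := N) (G := hump)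
    (by unfold hump; fun_prop) (hump_zero_eq (by omega)) hη0
  obtain ⟨δ₃, hδ₃, H₃⟩ := exists_profile_bound (N := N) (G := tent)
    (by unfold tent; fun_prop) (tent_zero_eq (by omega)) hη0
  refine ⟨min (min δ₁ δ₂) (min δ₃ (1 / 10)), by positivity, ?_⟩
  intro ι _ _ U hU v hv hUC hlog
  obtain ⟨⟨h₁, h₂⟩, h₃, h₄⟩ := (le_min_iff.1 hUC).imp le_min_iff.1 le_min_iff.1
  obtain ⟨x, hx⟩ : ∃ x : ι → ℝ, ∀ i,
      Complex.exp ((2 * Real.pi / N * x i : ℝ) * Complex.I) = v i ^ n := by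
    refine ⟨fun i => (v i ^ n).arg / (2 * Real.pi / N), fun i => ?_⟩
    rw [mul_div_cancel₀ _ (by positivity)]
    have := Complex.norm_mul_exp_arg_mul_I (v i ^ n)
    rwa [norm_pow, hv, one_pow, Complex.ofReal_one, one_mul] at this
  have hfun : (fun i => v i ^ n) =
    fun i => Complex.exp ((2 * Real.pi / N * x i : ℝ) * Complex.I) := funext fun i => (hx i).symm
  rw [hfun] at h₁ h₂ h₃
  obtain ⟨Z, hZ, U', hU', V', hV', hcomm, hUU, hVV⟩ := exists_block_solution hN7 hn hNn hU hv hx h₄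
    hlog hη0.le (hPη.le.trans (min_le_right _ _)) (H₁ ι U hU x h₁) (H₂ ι U hU x h₂)
    (H₃ ι U hU x h₃)
  refine ⟨ZMod N × ι, inferInstance, inferInstance, blkHom fun j => U * Z j,
    blkHom_mem_unitary fun j => mul_mem hU (hZ j), blkHom fun j => rootBlocks n v x (some j),
    blkHom_mem_unitary fun j => rootBlocks_mem_unitary n hv x _, ?_,
    reindexHom optionProdEquiv U', Unitary.map_mem _ hU',
    reindexHom optionProdEquiv V', Unitary.map_mem _ hV', ?_, ?_, ?_⟩
  · rw [← map_pow, ← map_mul, ← map_mul]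
    congr 1
    funext j
    simp only [Pi.mul_apply, Pi.pow_apply, rootBlocks_some_pow hn hx]
    simp
  · rw [← map_pow, ← map_mul, hcomm, map_mul]
  · rw [← show reindexHom optionProdEquiv (blkHom (cutBlocks U Z)) =
      Matrix.fromBlocks U 0 0 (blkHom fun j => U * Z j) from reindexHom_blkHom_option _,
      ← map_sub, reindexHom_apply, norm_reindex]
    exact hUU.trans (hPη.le.trans (min_le_left _ _))
  · rw [← show reindexHom optionProdEquiv (blkHom (rootBlocks (N := N) n v x)) =
      Matrix.fromBlocks (Matrix.diagonal v) 0 0 (blkHom fun j => rootBlocks n v x (some j)) from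
      reindexHom_blkHom_option _, ← map_sub, reindexHom_apply, norm_reindex]
    exact hVV.trans hNε

theorem exists_completion {n : ℕ} (hn : 1 ≤ n) {ε : ℝ} (hε : 0 < ε) :
    ∃ δ > 0, ∀ (ι : Type) [Fintype ι] [DecidableEq ι], ∀ U ∈ unitary (Matrix ι ι ℂ),
      ∀ V ∈ unitary (Matrix ι ι ℂ), ‖U * V ^ n - V ^ n * U‖ ≤ δ →
      logDet (U * V ^ n * star U * star (V ^ n)) = 0 →
      ∃ (κ : Type) (_ : Fintype κ) (_ : DecidableEq κ),
        ∃ W ∈ unitary (Matrix κ κ ℂ), ∃ D ∈ unitary (Matrix κ κ ℂ), W * D ^ n = D ^ n * W ∧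
        ∃ U' ∈ unitary (Matrix (ι ⊕ κ) (ι ⊕ κ) ℂ), ∃ V' ∈ unitary (Matrix (ι ⊕ κ) (ι ⊕ κ) ℂ),
          U' * V' ^ n = V' ^ n * U' ∧ ‖Matrix.fromBlocks U 0 0 W - U'‖ ≤ ε ∧
          ‖Matrix.fromBlocks V 0 0 D - V'‖ ≤ ε := by
  obtain ⟨δ, hδ, H⟩ := exists_diagonal_completion hn hε
  refine ⟨min δ (1 / 2), by positivity, ?_⟩
  intro ι _ _ U hU V hV hUV hlog
  obtain ⟨O, hO, v, hv, rfl⟩ := exists_diagonalization hV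
  have hO' := Unitary.star_mem hO
  have hsO : star O * O = 1 := (Unitary.mem_iff.1 hO).1
  have hOs : O * star O = 1 := (Unitary.mem_iff.1 hO).2
  have hpow : (O * Matrix.diagonal v * star O) ^ n =
      O * Matrix.diagonal (fun i => v i ^ n) * star O := by
    rw [conj_pow_unitary hO, Matrix.diagonal_pow]
    rfl
  obtain ⟨A, hA, rfl⟩ : ∃ A ∈ unitary (Matrix ι ι ℂ), U = O * A * star O :=
    ⟨star O * U * O, mul_mem (mul_mem hO' hU) hO, by
      rw [show O * (star O * U * O) * star O = (O * star O) * U * (O * star O) by noncomm_ring, hOs,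
        one_mul, mul_one]⟩
  have hC : Matrix.diagonal (fun i => v i ^ n) ∈ unitary (Matrix ι ι ℂ) :=
    diagonal_mem_unitary fun i => by rw [norm_pow, hv, one_pow]
  rw [hpow, conj_mul_conj hO, conj_mul_conj hO, ← sub_mul, ← mul_sub,
    norm_mul_unitary hO', norm_unitary_mul hO]
    at hUV
  have hstar (B : Matrix ι ι ℂ) : star (O * B * star O) = O * star B * star O := by
    simp [mul_assoc]
  rw [hpow, hstar, hstar, conj_mul_conj hO, conj_mul_conj hO, conj_mul_conj hO,
    logDet_conj hO] at hlog
  rotate_left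
  · rw [norm_commutator_sub_one hA hC]
    exact (hUV.trans (min_le_right _ _)).trans_lt (by norm_num)
  obtain ⟨κ, i₁, i₂, W, hW, D, hD, hWD, U', hU', V', hV', hcomm, hUU, hVV⟩ :=
    H ι A hA v hv (hUV.trans (min_le_left _ _)) hlog
  have hQ : fromBlocksHom (O, (1 : Matrix κ κ ℂ)) ∈ unitary (Matrix (ι ⊕ κ) (ι ⊕ κ) ℂ) :=
    Unitary.map_mem _ (by
      rw [Unitary.mem_iff]
      constructor <;> ext1 <;> simp [hOs, hsO])
  have hconj (B : Matrix ι ι ℂ) (E : Matrix κ κ ℂ) :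
      Matrix.fromBlocks (O * B * star O) 0 0 E = fromBlocksHom (O, (1 : Matrix κ κ ℂ)) *
        Matrix.fromBlocks B 0 0 E * star (fromBlocksHom (O, (1 : Matrix κ κ ℂ))) := by
    rw [← show fromBlocksHom (B, E) = Matrix.fromBlocks B 0 0 E from rfl, ← map_mul, ← map_star,
      ← map_mul]
    simp [fromBlocksHom]
  generalize fromBlocksHom (O, (1 : Matrix κ κ ℂ)) = Q at hQ hconj
  have hQ' := Unitary.star_mem hQ
  refine ⟨κ, i₁, i₂, W, hW, D, hD, hWD, Q * U' * star Q, mul_mem (mul_mem hQ hU') hQ',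
    Q * V' * star Q, mul_mem (mul_mem hQ hV') hQ', ?_, ?_, ?_⟩
  · rw [conj_pow_unitary hQ, conj_mul_conj hQ, conj_mul_conj hQ, hcomm]
  · rw [hconj, ← sub_mul, ← mul_sub, norm_mul_unitary hQ', norm_unitary_mul hQ]
    exact hUU
  · rw [hconj, ← sub_mul, ← mul_sub, norm_mul_unitary hQ', norm_unitary_mul hQ]
    exact hVV

section QuasiRep

variable {Γ : Type*} [Group Γ]

theorem IsQuasiRep.mono {T T' : Set Γ} {δ δ' : ℝ} {m : ℕ} {φ : Γ → Matrix (Fin m) (Fin m) ℂ}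
    (h : IsQuasiRep T δ φ) (hT : T' ⊆ T) (hδ : δ ≤ δ') : IsQuasiRep T' δ' φ :=
  ⟨h.1, h.2.1, fun s hs t ht => (h.2.2 s (hT hs) t (hT ht)).trans_le hδ⟩

/-- The block sum, as a star homomorphism. -/
def blockSumHom (m k : ℕ) : (Matrix (Fin m) (Fin m) ℂ × Matrix (Fin k) (Fin k) ℂ) →⋆ₐ[ℂ]
    Matrix (Fin (m + k)) (Fin (m + k)) ℂ :=
  (reindexHom finSumFinEquiv).comp fromBlocksHom

theorem blockSumHom_apply {m k : ℕ} (x : Matrix (Fin m) (Fin m) ℂ) (y : Matrix (Fin k) (Fin k) ℂ) :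
    blockSumHom m k (x, y) = blockSum x y := rfl

theorem norm_blockSum {m k : ℕ} (x : Matrix (Fin m) (Fin m) ℂ) (y : Matrix (Fin k) (Fin k) ℂ) :
    ‖blockSum x y‖ = max ‖x‖ ‖y‖ := by
  rw [blockSum, norm_reindex, norm_fromBlocks_diagonal]

theorem IsQuasiRep.blockSum {T : Set Γ} {δ : ℝ} (hδ : 0 < δ) {m k : ℕ}
    {φ : Γ → Matrix (Fin m) (Fin m) ℂ} {θ : Γ → Matrix (Fin k) (Fin k) ℂ}
    (hφ : IsQuasiRep T δ φ) (hθ : IsUnitaryRep θ) :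
    IsQuasiRep T δ fun s => blockSum (φ s) (θ s) := by
  refine ⟨?_, fun x => ?_, fun s hs t ht => ?_⟩
  · simp only
    rw [hφ.1, hθ.1, ← blockSumHom_apply]
    exact map_one _
  · rw [norm_blockSum]
    exact max_le (hφ.2.1 x) (norm_le_one_of_unitary (hθ.2.2 x))
  · simp only [← blockSumHom_apply]
    rw [← map_mul, ← map_sub, Prod.mk_mul_mk, Prod.mk_sub_mk, blockSumHom_apply, norm_blockSum,
      hθ.2.1, sub_self, norm_zero]
    exact max_lt (hφ.2.2 s hs t ht) hδ

/-- A quasi-representation that is close to a representation on generators is close to it at any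
given element. -/
theorem exists_norm_sub_lt_of_closure_eq_top {G : Set Γ} (hG : Subgroup.closure G = ⊤) (s : Γ) :
    ∀ ε > 0, ∃ (T : Set Γ) (δ : ℝ), T.Finite ∧ 0 < δ ∧ ∀ (m : ℕ)
      (φ ρ : Γ → Matrix (Fin m) (Fin m) ℂ), IsQuasiRep T δ φ → IsUnitaryRep ρ →
      (∀ g ∈ G, ‖φ g - ρ g‖ < δ) → ‖φ s - ρ s‖ < ε := by
  have hs : s ∈ Subgroup.closure G := hG ▸ Subgroup.mem_top s
  induction hs using Subgroup.closure_induction with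
  | mem x hx => exact fun ε hε => ⟨∅, ε, Set.finite_empty, hε, fun m φ ρ _ _ h => h x hx⟩
  | one =>
    exact fun ε hε => ⟨∅, 1, Set.finite_empty, one_pos, fun m φ ρ hφ hρ _ => by
      rwa [hφ.1, hρ.1, sub_self, norm_zero]⟩
  | mul x y _ _ hx hy =>
    intro ε hε
    obtain ⟨T₁, δ₁, hT₁, hδ₁, H₁⟩ := hx (ε / 3) (by positivity)
    obtain ⟨T₂, δ₂, hT₂, hδ₂, H₂⟩ := hy (ε / 3) (by positivity)
    refine ⟨T₁ ∪ T₂ ∪ {x, y}, min (min δ₁ δ₂) (ε / 3), (hT₁.union hT₂).union (by simp),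
      by positivity, fun m φ ρ hφ hρ h => ?_⟩
    have h₁ := H₁ m φ ρ (hφ.mono (fun z hz => .inl (.inl hz))
      ((min_le_left _ _).trans (min_le_left _ _))) hρ fun g hg => (h g hg).trans_le
        ((min_le_left _ _).trans (min_le_left _ _))
    have h₂ := H₂ m φ ρ (hφ.mono (fun z hz => .inl (.inr hz))
      ((min_le_left _ _).trans (min_le_right _ _))) hρ fun g hg => (h g hg).trans_le
        ((min_le_left _ _).trans (min_le_right _ _))
    have h₃ := (hφ.2.2 x (by simp) y (by simp)).trans_le (min_le_right _ _)
    have key : φ (x * y) - ρ (x * y) =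
        (φ x - ρ x) * φ y + ρ x * (φ y - ρ y) - (φ x * φ y - φ (x * y)) := by
      rw [hρ.2.1]; noncomm_ring
    rw [key]
    have h₄ := (norm_mul_le_right_of_le_one (A := φ x - ρ x) (hφ.2.1 y)).trans_lt h₁
    have h₅ := (norm_unitary_mul (hρ.2.2 x) (φ y - ρ y)).trans_lt h₂
    linarith [norm_sub_le ((φ x - ρ x) * φ y + ρ x * (φ y - ρ y)) (φ x * φ y - φ (x * y)),
      norm_add_le ((φ x - ρ x) * φ y) (ρ x * (φ y - ρ y))]
  | inv x _ hx =>
    intro ε hε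
    obtain ⟨T₁, δ₁, hT₁, hδ₁, H₁⟩ := hx (ε / 2) (by positivity)
    refine ⟨T₁ ∪ {x, x⁻¹}, min δ₁ (ε / 2), hT₁.union (by simp), by positivity,
      fun m φ ρ hφ hρ h => ?_⟩
    have h₁ := H₁ m φ ρ (hφ.mono (fun z hz => .inl hz) (min_le_left _ _)) hρ
      fun g hg => (h g hg).trans_le (min_le_left _ _)
    have h₂ := (hφ.2.2 x⁻¹ (by simp) x (by simp)).trans_le (min_le_right _ _)
    rw [inv_mul_cancel, hφ.1] at h₂
    have hρx : ρ x⁻¹ * ρ x = 1 := by rw [← hρ.2.1, inv_mul_cancel, hρ.1]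
    rw [← norm_mul_unitary (hρ.2.2 x)]
    have key : (φ x⁻¹ - ρ x⁻¹) * ρ x = (φ x⁻¹ * φ x - 1) - φ x⁻¹ * (φ x - ρ x) := by
      rw [sub_mul, hρx]; noncomm_ring
    rw [key]
    have h₃ := (norm_mul_le_left_of_le_one (B := φ x - ρ x) (hφ.2.1 x⁻¹)).trans_lt h₁
    linarith [norm_sub_le (φ x⁻¹ * φ x - 1) (φ x⁻¹ * (φ x - ρ x))]

theorem exists_forall_norm_sub_lt_of_closure_eq_top {G : Set Γ} (hG : Subgroup.closure G = ⊤)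
    {S : Set Γ} (hS : S.Finite) {ε : ℝ} (hε : 0 < ε) :
    ∃ (T : Set Γ) (δ : ℝ), T.Finite ∧ 0 < δ ∧ ∀ (m : ℕ)
      (φ ρ : Γ → Matrix (Fin m) (Fin m) ℂ), IsQuasiRep T δ φ → IsUnitaryRep ρ →
      (∀ g ∈ G, ‖φ g - ρ g‖ < δ) → ∀ s ∈ S, ‖φ s - ρ s‖ < ε := by
  induction S, hS using Set.Finite.induction_on with
  | empty => exact ⟨∅, 1, Set.finite_empty, one_pos, by simp⟩
  | @insert x S _ _ ih =>
    obtain ⟨T₁, δ₁, hT₁, hδ₁, H₁⟩ := ih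
    obtain ⟨T₂, δ₂, hT₂, hδ₂, H₂⟩ := exists_norm_sub_lt_of_closure_eq_top hG x ε hε
    refine ⟨T₁ ∪ T₂, min δ₁ δ₂, hT₁.union hT₂, by positivity, fun m φ ρ hφ hρ h => ?_⟩
    rw [Set.forall_mem_insert]
    exact ⟨H₂ m φ ρ (hφ.mono Set.subset_union_right (min_le_right _ _)) hρ
        fun g hg => (h g hg).trans_le (min_le_right _ _),
      H₁ m φ ρ (hφ.mono Set.subset_union_left (min_le_left _ _)) hρ
        fun g hg => (h g hg).trans_le (min_le_left _ _)⟩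

theorem IsQuasiRep.norm_pow_sub_le {T : Set Γ} {δ : ℝ} {m : ℕ}
    {φ : Γ → Matrix (Fin m) (Fin m) ℂ} (h : IsQuasiRep T δ φ) {b : Γ} {n : ℕ}
    (hb : b ∈ T) (hT : ∀ i ≤ n, b ^ i ∈ T) : ‖φ b ^ n - φ (b ^ n)‖ ≤ n * δ := by
  induction n with
  | zero => simp [h.1]
  | succ k ih =>
    have h₁ := h.2.2 (b ^ k) (hT k k.le_succ) b hb
    rw [← pow_succ] at h₁
    have key : φ b ^ (k + 1) - φ (b ^ (k + 1)) =
        (φ b ^ k - φ (b ^ k)) * φ b + (φ (b ^ k) * φ b - φ (b ^ (k + 1))) := by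
      rw [pow_succ (φ b)]; noncomm_ring
    rw [key]
    have h₂ := (norm_mul_le_right_of_le_one (A := φ b ^ k - φ (b ^ k)) (h.2.1 b)).trans
      (ih fun i hi => hT i (hi.trans k.le_succ))
    push_cast
    linarith [norm_add_le ((φ b ^ k - φ (b ^ k)) * φ b) (φ (b ^ k) * φ b - φ (b ^ (k + 1)))]

/-- A quasi-representation is close to a unitary at any given element. -/
theorem IsQuasiRep.exists_unitary {T : Set Γ} {δ : ℝ} {m : ℕ}
    {φ : Γ → Matrix (Fin m) (Fin m) ℂ} (h : IsQuasiRep T δ φ) (hδ : 0 ≤ δ) (hδ' : δ ≤ 1 / 4) {g : Γ}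
    (hg : g ∈ T) (hg' : g⁻¹ ∈ T) : ∃ U ∈ unitary (Matrix (Fin m) (Fin m) ℂ), ‖φ g - U‖ ≤ 3 * δ := by
  have h₁ := (h.2.2 g⁻¹ hg' g hg).le
  rw [inv_mul_cancel, h.1] at h₁
  obtain ⟨U, hU, hUX, -⟩ := exists_unitary_of_norm_star_mul_self_sub_one_le
    (norm_star_mul_self_sub_one_le (h.2.1 g) (h.2.1 g⁻¹) h₁) (by nlinarith)
  exact ⟨U, hU, by rw [norm_sub_rev]; nlinarith⟩

end QuasiRep

section BaumslagSolitar

variable {n : ℕ}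

theorem aBar_mul_bBar_pow : (aBar * bBar ^ n : BSnn n) = bBar ^ n * aBar := by
  have h : PresentedGroup.mk {bsRelator n} (bsRelator n) = 1 :=
    PresentedGroup.one_of_mem (Set.mem_singleton _)
  have h' : (aBar * bBar ^ n * aBar⁻¹ * (bBar ^ n)⁻¹ : BSnn n) = 1 := h
  rwa [mul_inv_eq_one, mul_inv_eq_iff_eq_mul] at h'

theorem closure_aBar_bBar : Subgroup.closure {(aBar : BSnn n), bBar} = ⊤ := by
  rw [← PresentedGroup.closure_range_of]
  congr 1
  ext x
  simp [Fin.exists_fin_two, aBar, bBar, eq_comm]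

theorem exists_isUnitaryRep {k : ℕ} {W D : Matrix (Fin k) (Fin k) ℂ}
    (hW : W ∈ unitary (Matrix (Fin k) (Fin k) ℂ)) (hD : D ∈ unitary (Matrix (Fin k) (Fin k) ℂ))
    (h : W * D ^ n = D ^ n * W) :
    ∃ θ : BSnn n → Matrix (Fin k) (Fin k) ℂ, IsUnitaryRep θ ∧ θ aBar = W ∧ θ bBar = D := by
  let f : Fin 2 → unitary (Matrix (Fin k) (Fin k) ℂ) := ![⟨W, hW⟩, ⟨D, hD⟩]
  have hf : ∀ r ∈ ({bsRelator n} : Set (FreeGroup (Fin 2))), FreeGroup.lift f r = 1 := by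
    intro r hr
    rw [Set.mem_singleton_iff.1 hr]
    simp only [bsRelator, map_mul, map_inv, map_pow, FreeGroup.lift_apply_of]
    rw [mul_inv_eq_one, mul_inv_eq_iff_eq_mul]
    exact Subtype.ext h
  refine ⟨fun x => (PresentedGroup.toGroup hf x).1, ⟨by simp, by simp, fun x => Subtype.prop _⟩,
    ?_, ?_⟩
  · simp [aBar, f]
  · simp [bBar, f]

theorem logDet_eq_zero_of_loop {m : ℕ} {c : Matrix (Fin m) (Fin m) ℂ} (hc : ‖c - 1‖ < 1)
    {h : ℝ → ℂ} (hh : ContinuousOn h (Set.Icc 0 1)) (h01 : h 0 = h 1)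
    (hexp : ∀ t ∈ Set.Icc (0 : ℝ) 1, Complex.exp (h t) =
      ((t : ℂ) • (1 : Matrix (Fin m) (Fin m) ℂ) + (1 - (t : ℂ)) • c).det) : logDet c = 0 := by
  have := logDet_sub_logDet_of_path
    (γ := fun t : ℝ => (t : ℂ) • (1 : Matrix (Fin m) (Fin m) ℂ) + (1 - (t : ℂ)) • c)
    (by fun_prop) (fun t ht => ?_) hh hexp
  · simpa [logDet_one, h01] using this
  · have key : (t : ℂ) • (1 : Matrix (Fin m) (Fin m) ℂ) + (1 - (t : ℂ)) • c - 1 =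
        ((1 - t : ℝ) : ℂ) • (c - 1) := by
      push_cast; module
    rw [key, norm_smul, Complex.norm_real, Real.norm_of_nonneg (by linarith [ht.2])]
    nlinarith [ht.1, norm_nonneg (c - 1)]

theorem blockSum_reindexHom {m k : ℕ} {κ : Type*} [Fintype κ] [DecidableEq κ] (e : κ ≃ Fin k)
    (x : Matrix (Fin m) (Fin m) ℂ) (y : Matrix κ κ ℂ) :
    blockSum x (reindexHom e y) =
      reindexHom (((Equiv.refl (Fin m)).sumCongr e).trans finSumFinEquiv)
        (Matrix.fromBlocks x 0 0 y) := by
  rw [blockSum, reindexHom_apply, reindexHom_apply]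
  ext i j
  obtain ⟨i, rfl⟩ := finSumFinEquiv.surjective i
  obtain ⟨j, rfl⟩ := finSumFinEquiv.surjective j
  rcases i with i | i <;> rcases j with j | j <;> simp

theorem norm_blockSum_sub_le {m k : ℕ} {κ : Type*} [Fintype κ] [DecidableEq κ] (e : κ ≃ Fin k)
    {x U : Matrix (Fin m) (Fin m) ℂ} {y : Matrix κ κ ℂ}
    {U' : Matrix (Fin m ⊕ κ) (Fin m ⊕ κ) ℂ} {r s : ℝ} (hr : ‖x - U‖ ≤ r)
    (hs : ‖Matrix.fromBlocks U 0 0 y - U'‖ ≤ s) :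
    ‖blockSum x (reindexHom e y) -
      reindexHom (((Equiv.refl (Fin m)).sumCongr e).trans finSumFinEquiv) U'‖ ≤ r + s := by
  rw [blockSum_reindexHom, ← map_sub, reindexHom_apply, norm_reindex]
  refine (norm_sub_le_norm_sub_add_norm_sub _ (Matrix.fromBlocks U 0 0 y) _).trans
    (add_le_add ?_ hs)
  have : Matrix.fromBlocks x 0 0 y - Matrix.fromBlocks U 0 0 y =
      Matrix.fromBlocks (x - U) 0 0 (0 : Matrix κ κ ℂ) := by
    ext (i | i) (j | j) <;> simp
  rw [this, norm_fromBlocks_diagonal, norm_zero]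
  exact max_le hr ((norm_nonneg _).trans hr)

theorem norm_commutator_le_of_norm_sub_le {m : ℕ} {A D U C : Matrix (Fin m) (Fin m) ℂ}
    (hU : U ∈ unitary (Matrix (Fin m) (Fin m) ℂ)) (hD : ‖D‖ ≤ 1) {r s : ℝ} (hr : ‖A - U‖ ≤ r)
    (hs : ‖D - C‖ ≤ s) : ‖U * C - C * U‖ ≤ ‖A * D - D * A‖ + 2 * (r + s) := by
  have key : U * C - C * U = (A * D - D * A) -
      ((A - U) * D + U * (D - C)) + (D * (A - U) + (D - C) * U) := by noncomm_ring
  rw [key]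
  have h₁ := (norm_mul_le_right_of_le_one (A := A - U) hD).trans hr
  have h₂ := (norm_mul_le_left_of_le_one (B := A - U) hD).trans hr
  have h₃ := (norm_unitary_mul hU (D - C)).trans_le hs
  have h₄ := (norm_mul_unitary hU (D - C)).trans_le hs
  linarith [norm_add_le ((A * D - D * A) - ((A - U) * D + U * (D - C)))
      (D * (A - U) + (D - C) * U), norm_sub_le (A * D - D * A) ((A - U) * D + U * (D - C)),
    norm_add_le ((A - U) * D) (U * (D - C)), norm_add_le (D * (A - U)) ((D - C) * U)]

end BaumslagSolitar

/-- The Baumslag–Solitar group `BS(n,n)` is weakly ucp stable,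
conditional on vanishing of the winding number invariant associated to the relator. -/
theorem statement15 (n : ℕ) (hn : 1 ≤ n)
    (S : Set (BSnn n)) (hS : S.Finite) (ε : ℝ) (hε : 0 < ε) :
    ∃ (T : Set (BSnn n)) (δ : ℝ), T.Finite ∧ 0 < δ ∧
      ∀ (m : ℕ), 1 ≤ m → ∀ φ : BSnn n → Matrix (Fin m) (Fin m) ℂ,
        IsQuasiRep T δ φ → IsUcpQuasiRep φ →
        IsUnit (φ aBar) → IsUnit (φ (bBar ^ n)) →
        ‖relImage φ - 1‖ < 1 →
        (∃ h : ℝ → ℂ, ContinuousOn h (Set.Icc 0 1) ∧ h 0 = h 1 ∧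
          ∀ t ∈ Set.Icc (0 : ℝ) 1,
            Complex.exp (h t) =
              ((t : ℂ) • (1 : Matrix (Fin m) (Fin m) ℂ) + (1 - (t : ℂ)) • relImage φ).det) →
        ∃ (k : ℕ) (θ : BSnn n → Matrix (Fin k) (Fin k) ℂ)
          (π : BSnn n → Matrix (Fin (m + k)) (Fin (m + k)) ℂ),
          IsUnitaryRep θ ∧ IsUnitaryRep π ∧
          ∀ s ∈ S, ‖blockSum (φ s) (θ s) - π s‖ < ε := by
  obtain ⟨T₁, δ₁, hT₁, hδ₁, H₁⟩ :=
    exists_forall_norm_sub_lt_of_closure_eq_top (closure_aBar_bBar (n := n)) hS hε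
  obtain ⟨δ₂, hδ₂, H₂⟩ := exists_completion hn (half_pos hδ₁)
  obtain ⟨Q, hQ⟩ : ∃ Q : ℝ, Q = min (1 / 100) (min δ₂ (δ₁ / 4)) := ⟨_, rfl⟩
  have hQ0 : 0 < Q := by rw [hQ]; positivity
  have hQ₁ : Q ≤ 1 / 100 := hQ.trans_le (min_le_left _ _)
  have hQ₂ : Q ≤ δ₂ := hQ.trans_le ((min_le_right _ _).trans (min_le_left _ _))
  have hQ₃ : Q ≤ δ₁ / 4 := hQ.trans_le ((min_le_right _ _).trans (min_le_right _ _))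
  obtain ⟨δ, hδ⟩ : ∃ δ : ℝ, δ = Q / (8 * (n + 1)) := ⟨_, rfl⟩
  have hδ0 : 0 < δ := by rw [hδ]; positivity
  have hδQ : 8 * (n + 1) * δ = Q := by rw [hδ]; field_simp
  have hnδ : 0 ≤ n * δ := by positivity
  refine ⟨T₁ ∪ ({aBar, aBar⁻¹, bBar, bBar⁻¹} ∪ (fun i : ℕ => bBar ^ i) '' Set.Iic n), δ,
    hT₁.union ((by simp : Set.Finite _).union ((Set.finite_Iic n).image _)), hδ0, ?_⟩
  intro m _ φ hφ _ _ _ hc ⟨h, hh, h01, hexp⟩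
  have hpow : ∀ i ≤ n, (bBar : BSnn n) ^ i ∈
      T₁ ∪ ({aBar, aBar⁻¹, bBar, bBar⁻¹} ∪ (fun i : ℕ => bBar ^ i) '' Set.Iic n) :=
    fun i hi => .inr (.inr ⟨i, hi, rfl⟩)
  obtain ⟨U, hU, hUa⟩ := hφ.exists_unitary hδ0.le (by linarith) (g := aBar) (by simp) (by simp)
  obtain ⟨V, hV, hVb⟩ := hφ.exists_unitary hδ0.le (by linarith) (g := bBar) (by simp) (by simp)
  have hVn := pow_mem hV n
  have hbn : ‖φ (bBar ^ n) - V ^ n‖ ≤ 4 * (n * δ) := by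
    have h₁ := hφ.norm_pow_sub_le (by simp) hpow
    have h₂ := (norm_pow_sub_pow_le (hφ.2.1 bBar) (norm_le_one_of_unitary hV) n).trans
      (mul_le_mul_of_nonneg_left hVb (Nat.cast_nonneg n))
    rw [norm_sub_rev] at h₁
    linarith [norm_sub_le_norm_sub_add_norm_sub (φ (bBar ^ n)) (φ bBar ^ n) (V ^ n)]
  have hcomm : ‖φ aBar * φ (bBar ^ n) - φ (bBar ^ n) * φ aBar‖ ≤ 2 * δ := by
    have h₁ := hφ.2.2 aBar (by simp) (bBar ^ n) (hpow n le_rfl)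
    have h₂ := hφ.2.2 (bBar ^ n) (hpow n le_rfl) aBar (by simp)
    rw [← aBar_mul_bBar_pow, norm_sub_rev] at h₂
    linarith [norm_sub_le_norm_sub_add_norm_sub (φ aBar * φ (bBar ^ n)) (φ (aBar * bBar ^ n))
      (φ (bBar ^ n) * φ aBar)]
  have hUV : ‖U * V ^ n - V ^ n * U‖ ≤ Q := by
    linarith [norm_commutator_le_of_norm_sub_le hU (hφ.2.1 (bBar ^ n)) hUa hbn]
  have hlog : logDet (U * V ^ n * star U * star (V ^ n)) = 0 := by
    rw [← logDet_commutator_eq hU hVn (A := φ aBar) (D := φ (bBar ^ n)) (by linarith)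
      (by linarith) (by linarith)]
    exact logDet_eq_zero_of_loop hc hh h01 hexp
  obtain ⟨κ, _, _, W, hW, D, hD, hWD, U', hU', V', hV', hUV', hUW, hVD⟩ :=
    H₂ (Fin m) U hU V hV (hUV.trans hQ₂) hlog
  obtain ⟨e⟩ := Fintype.truncEquivFin κ |>.nonempty
  obtain ⟨θ, hθ, hθa, hθb⟩ := exists_isUnitaryRep (n := n)
    (Unitary.map_mem (reindexHom e) hW) (Unitary.map_mem (reindexHom e) hD)
    (by rw [← map_pow, ← map_mul, hWD, map_mul])
  obtain ⟨ρ, hρ, hρa, hρb⟩ := exists_isUnitaryRep (n := n)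
    (Unitary.map_mem (reindexHom (((Equiv.refl (Fin m)).sumCongr e).trans finSumFinEquiv)) hU')
    (Unitary.map_mem (reindexHom (((Equiv.refl (Fin m)).sumCongr e).trans finSumFinEquiv)) hV')
    (by rw [← map_pow, ← map_mul, hUV', map_mul])
  refine ⟨Fintype.card κ, θ, ρ, hθ, hρ, H₁ _ _ ρ ((hφ.blockSum hδ0 hθ).mono
    Set.subset_union_left (by linarith)) hρ ?_⟩
  rintro g (rfl | rfl)
  · rw [hθa, hρa]
    linarith [norm_blockSum_sub_le e hUa hUW]
  · rw [hθb, hρb]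
    linarith [norm_blockSum_sub_le e hVb hVD]

end
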